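/- For (x,y) ∈ ℚ^× × ℚ^× define H(x,y) := ∏_v max(|x|_v, |y|_v, |xy|_v^{−1}), where v ranges over the archimedean place and all prime numbers p, |·|_p denoting the p-adic absolute value normalized by |p|_p = 1/p. Then the height zeta function Z(s) := Σ_{(x,y) ∈ ℚ^× × ℚ^×} H(x,y)^{−s} converges absolutely for Re(s) > 1, and there exist ε > 0 and a function f holomorphic on {s ∈ ℂ : Re(s) > 1 − ε} such that Z(s) = Θ/(s−1)^7 + f(s)/(s−1)^6 for all s with Re(s) > 1, where Θ = ∏_p (1 + 7/p + 1/p²)·(1 − 1/p)^7, the product running over all primes p. -/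

import Mathlib

open Filter Topology

/-- The anticanonical height `H(x,y) = ∏_v max(|x|_v, |y|_v, |xy|_v⁻¹)` on the torus
`xyz = 1` inside the cubic surface `xyz = u³`, the product running over the
archimedean place of `ℚ` and all primes `p`. -/
noncomputable def cubicTorusHeight (x y : ℚ) : ℝ :=
  max |(x : ℝ)| (max |(y : ℝ)| |((x * y : ℚ) : ℝ)|⁻¹) *
    ∏' p : Nat.Primes,
      ((max (padicNorm p x) (max (padicNorm p y) (padicNorm p (x * y))⁻¹) : ℚ) : ℝ)

/-- The Euler factor `(1 + 7/p + 1/p²)(1 - 1/p)⁷` at the prime `p`. -/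
noncomputable def cubicTorusEulerFactor (p : Nat.Primes) : ℝ :=
  (1 + 7 / ((p : ℕ) : ℝ) + 1 / ((p : ℕ) : ℝ) ^ 2) * (1 - 1 / ((p : ℕ) : ℝ)) ^ 7

/-- The height zeta function `Z(s) = ∑_{(x,y) ∈ ℚ^× × ℚ^×} H(x,y)^{-s}`. -/
noncomputable def cubicTorusZeta (s : ℂ) : ℂ :=
  ∑' q : ℚˣ × ℚˣ, (cubicTorusHeight (q.1 : ℚ) (q.2 : ℚ) : ℂ) ^ (-s)



namespace CT
open MeasureTheory

/-- holomorphy of a dominated integral -/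
theorem hol_int {α : Type*} [MeasurableSpace α] {μ : Measure α} (F : ℂ → α → ℂ) (U : Set ℂ)
    (hU : IsOpen U) (hol : ∀ a, DifferentiableOn ℂ (fun t => F t a) U)
    (meas : ∀ t ∈ U, AEStronglyMeasurable (F t) μ)
    (dom : ∀ t0 ∈ U, ∃ V ∈ 𝓝 t0, ∃ g : α → ℝ, Integrable g μ ∧ ∀ t ∈ V, ∀ a, ‖F t a‖ ≤ g a) :
    DifferentiableOn ℂ (fun t => ∫ a, F t a ∂μ) U := by
  intro t0 ht0
  obtain ⟨V, hV, g, hg, hb⟩ := dom t0 ht0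
  obtain ⟨r, hr, hball⟩ := Metric.mem_nhds_iff.1 (Filter.inter_mem hV (hU.mem_nhds ht0))
  have hder : ∀ a, ∀ x ∈ Metric.ball t0 (r/2), ‖deriv (fun t => F t a) x‖ ≤ g a / (r/4) := by
    intro a x hx
    have hsub : Metric.closedBall x (r/4) ⊆ Metric.ball t0 r := by
      intro z hz
      rw [Metric.mem_closedBall] at hz
      rw [Metric.mem_ball] at hx ⊢
      linarith [dist_triangle z x t0]
    apply Complex.norm_deriv_le_of_forall_mem_sphere_norm_le (by positivity)
    · apply DifferentiableOn.diffContOnCl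
      rw [closure_ball _ (by positivity)]
      exact (hol a).mono fun z hz => (hball (hsub hz)).2
    · intro z hz
      exact hb z (hball (hsub (Metric.sphere_subset_closedBall hz))).1 a
  have hd : ∀ a, ∀ x ∈ Metric.ball t0 (r/2), HasDerivAt (fun t => F t a) (deriv (fun t => F t a) x) x := by
    intro a x hx
    have hx' : x ∈ U := (hball (Metric.ball_subset_ball (by linarith) hx)).2
    exact ((hol a).differentiableAt (hU.mem_nhds hx')).hasDerivAt
  have hm : AEStronglyMeasurable (fun a => deriv (fun t => F t a) t0) μ := by
    -- limit of difference quotients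
    have hlim : ∀ a, Tendsto (fun n : ℕ => ((r/2/(n+2) : ℝ) : ℂ)⁻¹ * (F (t0 + (r/2/(n+2) : ℝ)) a - F t0 a)) atTop
        (𝓝 (deriv (fun t => F t a) t0)) := by
      intro a
      have h1 := (hd a t0 (Metric.mem_ball_self (by positivity))).tendsto_slope_zero
      have h2 : Tendsto (fun n : ℕ => ((r/2/(n+2) : ℝ) : ℂ)) atTop (𝓝[≠] 0) := by
        rw [tendsto_nhdsWithin_iff]
        constructor
        · rw [← Complex.ofReal_zero]
          apply (Complex.continuous_ofReal.tendsto 0).comp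
          have := tendsto_const_div_atTop_nhds_zero_nat (r/2)
          have h3 := this.comp (tendsto_add_atTop_nat 2)
          refine h3.congr fun n => ?_
          simp
        · refine Eventually.of_forall fun n => ?_
          have : (0:ℝ) < r/2/(n+2) := by positivity
          simp only [Set.mem_compl_iff, Set.mem_singleton_iff]
          exact_mod_cast this.ne'
      exact h1.comp h2
    refine aestronglyMeasurable_of_tendsto_ae atTop (fun n => ?_) (Eventually.of_forall hlim)
    have hin : t0 + ((r/2/((n:ℝ)+2) : ℝ) : ℂ) ∈ U := by
      apply (hball _).2
      rw [Metric.mem_ball, dist_eq_norm, add_sub_cancel_left, Complex.norm_real, Real.norm_of_nonneg (by positivity)]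
      rw [div_lt_iff₀ (by positivity)]
      have : (0:ℝ) ≤ n := Nat.cast_nonneg n
      nlinarith
    exact ((meas _ hin).sub (meas _ ht0)).const_mul _
  have hIntg : Integrable (F t0) μ :=
    hg.mono' (meas t0 ht0) (Eventually.of_forall fun a => hb t0 (mem_of_mem_nhds hV) a)
  have := (hasDerivAt_integral_of_dominated_loc_of_deriv_le (F := F) (x₀ := t0) (μ := μ)
    (F' := fun t a => deriv (fun t => F t a) t) (bound := fun a => g a / (r/4))
    (Metric.ball_mem_nhds t0 (by positivity : 0 < r/2))
    (by filter_upwards [hU.mem_nhds ht0] with t ht using meas t ht) hIntg hm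
    (Eventually.of_forall hder) (hg.div_const _) (Eventually.of_forall hd)).2
  exact this.differentiableAt.differentiableWithinAt

/-- weight -/
noncomputable def rho (a b : ℝ) : ℝ :=
  ((1+|a|)*(1+|b|))^(-(5/4):ℝ) + ((1+|a|)*(1+|a+b|))^(-(5/4):ℝ) + ((1+|b|)*(1+|a+b|))^(-(5/4):ℝ)

theorem rho_nonneg (a b : ℝ) : 0 ≤ rho a b := by unfold rho; positivity

theorem rho_le (a b : ℝ) : rho a b ≤ 3 := by
  have h : ∀ x y : ℝ, ((1+|x|)*(1+|y|))^(-(5/4):ℝ) ≤ 1 := by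
    intro x y
    apply Real.rpow_le_one_of_one_le_of_nonpos _ (by norm_num)
    nlinarith [abs_nonneg x, abs_nonneg y, mul_nonneg (abs_nonneg x) (abs_nonneg y)]
  unfold rho
  linarith [h a b, h a (a+b), h b (a+b)]

theorem one_add_abs_shift (a d r : ℝ) (hd : |d| ≤ r) : 1 + |a| ≤ (1+r) * (1+|a+d|) := by
  have h1 : |a| ≤ |a+d| + |d| := by
    have := abs_sub (a+d) d
    simpa using this
  nlinarith [abs_nonneg (a+d), abs_nonneg d, mul_nonneg ((abs_nonneg d).trans hd) (abs_nonneg (a+d))]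

theorem rho_shift (r : ℝ) (hr : 0 ≤ r) : ∃ C : ℝ, 0 ≤ C ∧ ∀ a b d e : ℝ, |d| ≤ r → |e| ≤ r →
    rho (a+d) (b+e) ≤ C * rho a b := by
  refine ⟨((1+2*r)*(1+2*r))^((5/4):ℝ), by positivity, ?_⟩
  have key : ∀ a b d e : ℝ, |d| ≤ 2*r → |e| ≤ 2*r → ((1+|a+d|)*(1+|b+e|))^(-(5/4):ℝ) ≤
      ((1+2*r)*(1+2*r))^((5/4):ℝ) * ((1+|a|)*(1+|b|))^(-(5/4):ℝ) := by
    intro a b d e hd he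
    have h1 := one_add_abs_shift a d _ hd
    have h2 := one_add_abs_shift b e _ he
    rw [Real.rpow_neg (by positivity), Real.rpow_neg (by positivity), ← div_eq_mul_inv,
      inv_le_comm₀ (by positivity) (by positivity), inv_div, ← Real.div_rpow (by positivity) (by positivity)]
    apply Real.rpow_le_rpow (by positivity) _ (by norm_num)
    rw [div_le_iff₀ (by positivity)]
    calc (1+|a|)*(1+|b|) ≤ ((1+2*r)*(1+|a+d|)) * ((1+2*r)*(1+|b+e|)) := by gcongr
      _ = _ := by ring
  intro a b d e hd he
  have hde : |d+e| ≤ 2*r := (abs_add_le d e).trans (by linarith)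
  have h1 := key a b d e (by linarith) (by linarith)
  have h2 := key a (a+b) d (d+e) (by linarith) hde
  have h3 := key b (a+b) e (d+e) (by linarith) hde
  unfold rho
  rw [show a + d + (b + e) = a + b + (d+e) by ring]
  linarith

theorem int_one : Integrable (fun a : ℝ => (1+|a|)^(-(5/4):ℝ)) := by
  have := integrable_one_add_norm (E := ℝ) (μ := volume) (r := 5/4) (by simp; norm_num)
  simpa using this

theorem int_two : Integrable (fun t : ℝ × ℝ => ((1+|t.1|)*(1+|t.2|))^(-(5/4):ℝ)) := by
  have := int_one.mul_prod int_one
  refine this.congr (Eventually.of_forall fun t => ?_)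
  simp only
  rw [Real.mul_rpow (by positivity) (by positivity)]

/-- linear change of variables on the plane -/
theorem int_lin {E : Type*} [NormedAddCommGroup E] [NormedSpace ℝ E]
    (p q p' q' : ℝ) (hdet : p * q' - q * p' ≠ 0) (f : ℝ × ℝ → E) :
    (Integrable f → Integrable (fun t : ℝ × ℝ => f (p * t.1 + q * t.2, p' * t.1 + q' * t.2))) ∧
    ∫ t : ℝ × ℝ, f (p * t.1 + q * t.2, p' * t.1 + q' * t.2) = |(p * q' - q * p')⁻¹| • ∫ t, f t := by
  set T : (ℝ × ℝ) →ₗ[ℝ] (ℝ × ℝ) :=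
    Matrix.toLin (Module.Basis.finTwoProd ℝ) (Module.Basis.finTwoProd ℝ) !![p, q; p', q'] with hT
  have hTd : LinearMap.det T = p * q' - q * p' := by
    rw [hT, LinearMap.det_toLin, Matrix.det_fin_two_of]
  have hTa : ∀ t : ℝ × ℝ, T t = (p * t.1 + q * t.2, p' * t.1 + q' * t.2) := by
    intro t
    rw [hT, Matrix.toLin_finTwoProd_apply]
  have hd : LinearMap.det T ≠ 0 := by rw [hTd]; exact hdet
  have hmap := Measure.map_linearMap_addHaar_eq_smul_addHaar (μ := (volume : Measure (ℝ × ℝ))) hd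
  have hemb : MeasurableEmbedding T := by
    have h1 : Function.Injective T := by
      have := (LinearMap.equivOfDetNeZero T hd).injective
      exact this
    exact (LinearMap.continuous_of_finiteDimensional T).measurableEmbedding h1
  have hc : ENNReal.ofReal |(LinearMap.det T)⁻¹| ≠ ⊤ := ENNReal.ofReal_ne_top
  constructor
  · intro hf
    have h2 : Integrable f (Measure.map T volume) := by
      rw [hmap]; exact hf.smul_measure hc
    have := (hemb.integrable_map_iff).1 h2
    refine this.congr (Eventually.of_forall fun t => ?_)
    simp [hTa]
  · have h3 := hemb.integral_map (μ := volume) f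
    rw [hmap, integral_smul_measure, ENNReal.toReal_ofReal (abs_nonneg _), hTd] at h3
    rw [h3]
    simp only [hTa]

theorem int_rho : Integrable (fun t : ℝ × ℝ => rho t.1 t.2) := by
  unfold rho
  have h1 := (int_lin 1 0 1 1 (by norm_num) _).1 int_two
  have h2 := (int_lin 0 1 1 1 (by norm_num) _).1 int_two
  refine (int_two.add ?_).add ?_
  · simpa using h1
  · simpa using h2

end CT


namespace CT
open MeasureTheory

def P : Fin 9 → ℤ := ![3,0,-3,2,1,1,-1,-1,-2]
def Q : Fin 9 → ℤ := ![0,3,-3,1,-1,2,1,-2,-1]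

/-- the linear forms -/
noncomputable def lam (i : Fin 9) (x y : ℂ) : ℂ := (P i : ℂ) * x + (Q i : ℂ) * y

def Dom (η : ℝ) : Set (ℂ × ℂ × ℂ) :=
  {p | -η < p.1.re/3 + p.2.1.re ∧ -η < p.1.re/3 + p.2.2.re ∧ -η < p.1.re/3 - p.2.1.re - p.2.2.re}

theorem Dom_open (η : ℝ) : IsOpen (Dom η) := by
  have h1 : IsOpen {p : ℂ × ℂ × ℂ | -η < p.1.re/3 + p.2.1.re} :=
    isOpen_lt continuous_const (by fun_prop)
  have h2 : IsOpen {p : ℂ × ℂ × ℂ | -η < p.1.re/3 + p.2.2.re} :=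
    isOpen_lt continuous_const (by fun_prop)
  have h3 : IsOpen {p : ℂ × ℂ × ℂ | -η < p.1.re/3 - p.2.1.re - p.2.2.re} :=
    isOpen_lt continuous_const (by fun_prop)
  exact h1.inter (h2.inter h3)

structure GoodG (η : ℝ) (G : ℂ → ℂ → ℂ → ℂ) : Prop where
  hol : ∀ w0 x0 y0 dw dx dy : ℂ,
    DifferentiableOn ℂ (fun t : ℂ => G (w0 + t * dw) (x0 + t * dx) (y0 + t * dy))
      {t | (w0 + t * dw, x0 + t * dx, y0 + t * dy) ∈ Dom η}
  cont : ContinuousOn (fun p : ℂ × ℂ × ℂ => G p.1 p.2.1 p.2.2) (Dom η)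
  bd : ∀ R : ℝ, ∃ C : ℝ, 0 ≤ C ∧ ∀ w x y : ℂ, (w, x, y) ∈ Dom η → ‖w‖ ≤ R →
    ‖G w x y‖ ≤ C * rho x.im y.im

noncomputable def Phi (G : ℂ → ℂ → ℂ → ℂ) (A : Finset (Fin 9)) (w x y : ℂ) : ℂ :=
  (∏ i ∈ A, (w + lam i x y)⁻¹) * G w x y

noncomputable def Jint (G : ℂ → ℂ → ℂ → ℂ) (A : Finset (Fin 9)) (w x y : ℂ) : ℂ :=
  ∫ t : ℝ × ℝ, Phi G A w (x + t.1 * Complex.I) (y + t.2 * Complex.I)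

def Reg (η : ℝ) (A : Finset (Fin 9)) : Set (ℂ × ℂ × ℂ) :=
  {p | p ∈ Dom η ∧ ∀ i ∈ A, 0 < (p.1 + lam i p.2.1 p.2.2).re}

theorem lam_cont (i : Fin 9) : Continuous (fun p : ℂ × ℂ => lam i p.1 p.2) := by
  unfold lam; fun_prop

theorem Reg_open (η : ℝ) (A : Finset (Fin 9)) : IsOpen (Reg η A) := by
  have h : Reg η A = Dom η ∩ ⋂ i ∈ A, {p : ℂ × ℂ × ℂ | 0 < (p.1 + lam i p.2.1 p.2.2).re} := by
    ext p; simp [Reg]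
  rw [h]
  refine (Dom_open η).inter (isOpen_biInter_finset fun i _ => isOpen_lt continuous_const ?_)
  unfold lam; fun_prop

theorem lam_shift_re (i : Fin 9) (x y : ℂ) (a b : ℝ) :
    (lam i (x + a * Complex.I) (y + b * Complex.I)).re = (lam i x y).re := by
  simp [lam]

theorem Dom_shift (η : ℝ) (w x y : ℂ) (a b : ℝ) :
    (w, x + a * Complex.I, y + b * Complex.I) ∈ Dom η ↔ (w, x, y) ∈ Dom η := by
  simp [Dom]

theorem Reg_shift (η : ℝ) (A) (w x y : ℂ) (a b : ℝ) :
    (w, x + a * Complex.I, y + b * Complex.I) ∈ Reg η A ↔ (w, x, y) ∈ Reg η A := by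
  simp only [Reg, Set.mem_setOf_eq, Dom_shift, Complex.add_re, lam_shift_re]

theorem Phi_meas {η : ℝ} {G} (hG : GoodG η G) (A) {w x y : ℂ} (h : (w, x, y) ∈ Reg η A) :
    Continuous (fun t : ℝ × ℝ => Phi G A w (x + t.1 * Complex.I) (y + t.2 * Complex.I)) := by
  unfold Phi
  refine Continuous.mul ?_ ?_
  · refine continuous_finsetProd _ fun i hi => Continuous.inv₀ ?_ ?_
    · unfold lam; fun_prop
    · intro t h0
      have h1 := (((Reg_shift η A w x y t.1 t.2).2 h).2 i hi)
      simp only at h1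
      rw [h0] at h1
      simp at h1
  · have := hG.cont.comp_continuous (f := fun t : ℝ × ℝ => (w, x + t.1 * Complex.I, y + t.2 * Complex.I))
      (by fun_prop) (fun t => (Dom_shift η w x y t.1 t.2).2 h.1)
    exact this

/-- local domination -/
theorem Phi_dom {η : ℝ} {G} (hG : GoodG η G) (A) {p : ℂ × ℂ × ℂ} (h : p ∈ Reg η A) :
    ∃ V ∈ 𝓝 p, ∃ g : ℝ × ℝ → ℝ, Integrable g ∧ ∀ q ∈ V, ∀ t : ℝ × ℝ,
      ‖Phi G A q.1 (q.2.1 + t.1 * Complex.I) (q.2.2 + t.2 * Complex.I)‖ ≤ g t := by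
  obtain ⟨C, hC0, hC⟩ := hG.bd (‖p‖ + 1)
  obtain ⟨K, hK0, hK⟩ := rho_shift (‖p‖ + 1) (by positivity)
  let m : Fin 9 → ℝ := fun i => (p.1 + lam i p.2.1 p.2.2).re / 2
  have hm : ∀ i ∈ A, 0 < m i := fun i hi => half_pos (h.2 i hi)
  have hopen : IsOpen (Metric.ball p 1 ∩ (Dom η ∩ ⋂ i ∈ A, {q : ℂ × ℂ × ℂ | m i < (q.1 + lam i q.2.1 q.2.2).re})) := by
    refine Metric.isOpen_ball.inter ((Dom_open η).inter
      (isOpen_biInter_finset fun i _ => isOpen_lt continuous_const ?_))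
    unfold lam; fun_prop
  refine ⟨_, hopen.mem_nhds ⟨Metric.mem_ball_self one_pos, h.1, ?_⟩,
    fun t => (∏ i ∈ A, (m i)⁻¹) * (C * (K * rho t.1 t.2)), ?_, ?_⟩
  · simp only [Set.mem_iInter, Set.mem_setOf_eq]
    intro i hi
    exact half_lt_self (h.2 i hi)
  · exact ((int_rho.const_mul K).const_mul C).const_mul _
  · rintro q ⟨hq1, hq2, hq3⟩ t
    simp only [Set.mem_iInter, Set.mem_setOf_eq] at hq3
    have hqn : ‖q‖ ≤ ‖p‖ + 1 := by
      have h1 : dist q p < 1 := hq1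
      rw [dist_eq_norm] at h1
      have := norm_le_insert' q p
      linarith
    have hq1' : ‖q.1‖ ≤ ‖p‖ + 1 := (norm_fst_le q).trans hqn
    have hq2' : ‖q.2.1‖ ≤ ‖p‖ + 1 := (norm_fst_le q.2).trans ((norm_snd_le q).trans hqn)
    have hq3' : ‖q.2.2‖ ≤ ‖p‖ + 1 := (norm_snd_le q.2).trans ((norm_snd_le q).trans hqn)
    unfold Phi
    rw [norm_mul, norm_prod]
    have hp0 : 0 ≤ ∏ i ∈ A, (m i)⁻¹ := Finset.prod_nonneg fun i hi => (inv_pos.2 (hm i hi)).le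
    apply mul_le_mul _ _ (norm_nonneg _) hp0
    · apply Finset.prod_le_prod (fun i _ => norm_nonneg _)
      intro i hi
      rw [norm_inv]
      apply inv_anti₀ (hm i hi)
      refine le_trans ?_ (Complex.re_le_norm _)
      rw [Complex.add_re, lam_shift_re, ← Complex.add_re]
      exact (hq3 i hi).le
    · refine (hC _ _ _ ((Dom_shift η _ _ _ t.1 t.2).2 hq2) hq1').trans ?_
      apply mul_le_mul_of_nonneg_left _ hC0
      have e1 : (q.2.1 + t.1 * Complex.I).im = t.1 + q.2.1.im := by simp [add_comm]
      have e2 : (q.2.2 + t.2 * Complex.I).im = t.2 + q.2.2.im := by simp [add_comm]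
      rw [e1, e2]
      exact hK _ _ _ _ ((Complex.abs_im_le_norm _).trans hq2') ((Complex.abs_im_le_norm _).trans hq3')

theorem Phi_int {η : ℝ} {G} (hG : GoodG η G) (A) {w x y : ℂ} (h : (w, x, y) ∈ Reg η A) :
    Integrable (fun t : ℝ × ℝ => Phi G A w (x + t.1 * Complex.I) (y + t.2 * Complex.I)) := by
  obtain ⟨V, hV, g, hg, hb⟩ := Phi_dom hG A h
  exact hg.mono' (Phi_meas hG A h).aestronglyMeasurable
    (Eventually.of_forall fun t => hb _ (mem_of_mem_nhds hV) t)

theorem Jint_hol {η : ℝ} {G} (hG : GoodG η G) (A) (w0 x0 y0 dw dx dy : ℂ) :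
    DifferentiableOn ℂ (fun t => Jint G A (w0 + t * dw) (x0 + t * dx) (y0 + t * dy))
      {t | (w0 + t * dw, x0 + t * dx, y0 + t * dy) ∈ Reg η A} := by
  have hc : Continuous (fun t : ℂ => (w0 + t * dw, x0 + t * dx, y0 + t * dy)) := by fun_prop
  unfold Jint
  apply hol_int
  · exact (Reg_open η A).preimage hc
  · intro a
    unfold Phi
    apply DifferentiableOn.mul
    · apply DifferentiableOn.fun_finsetProd
      intro i hi
      apply DifferentiableOn.inv
      · unfold lam; fun_prop
      · intro t ht h0
        have h1 := (((Reg_shift η A _ _ _ a.1 a.2).2 ht).2 i hi)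
        simp only at h1
        rw [h0] at h1
        simp at h1
    · have := hG.hol w0 (x0 + a.1 * Complex.I) (y0 + a.2 * Complex.I) dw dx dy
      refine (this.mono ?_).congr ?_
      · intro t ht
        have := (Dom_shift η _ _ _ a.1 a.2).2 ht.1
        simp only [Set.mem_setOf_eq]
        convert this using 3 <;> ring
      · intro t ht
        congr 1 <;> ring
  · intro t ht
    exact (Phi_meas hG A ht).aestronglyMeasurable
  · intro t ht
    obtain ⟨V, hV, g, hg, hb⟩ := Phi_dom hG A ht
    exact ⟨_, hc.continuousAt.preimage_mem_nhds hV, g, hg, fun t ht a => hb _ ht a⟩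

theorem Jint_shift_im (G A) (w x y : ℂ) (a b : ℝ) :
    Jint G A w (x + a * Complex.I) (y + b * Complex.I) = Jint G A w x y := by
  unfold Jint
  rw [← integral_add_right_eq_self (fun t : ℝ × ℝ => Phi G A w (x + t.1 * Complex.I) (y + t.2 * Complex.I)) (a, b)]
  congr 1
  ext t
  simp only [Prod.fst_add, Prod.snd_add]
  congr 1 <;> push_cast <;> ring

/-- contour shift -/
theorem Jint_shift {η : ℝ} {G} (hG : GoodG η G) (A) (w x y : ℂ) (b1 b2 : ℝ)
    (h : ∀ t : ℝ, t ∈ Set.Icc (0:ℝ) 1 → (w, x + t * b1, y + t * b2) ∈ Reg η A) :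
    Jint G A w (x + b1) (y + b2) = Jint G A w x y := by
  let J : ℂ → ℂ := fun t => Jint G A (w + t * 0) (x + t * b1) (y + t * b2)
  have hJ := Jint_hol hG A w x y 0 b1 b2
  set U := {t : ℂ | (w + t * 0, x + t * b1, y + t * b2) ∈ Reg η A} with hU
  have hUo : IsOpen U := (Reg_open η A).preimage (by fun_prop)
  have hd : ∀ t ∈ U, HasDerivAt J 0 t := by
    intro t ht
    have h1 := (hJ.differentiableAt (hUo.mem_nhds ht)).hasDerivAt
    set c := deriv (fun t => Jint G A (w + t * 0) (x + t * b1) (y + t * b2)) t with hc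
    have h2 : HasDerivAt (fun s : ℝ => t + s * Complex.I) (1 * Complex.I) 0 := by
      have := ((Complex.ofRealCLM.hasDerivAt (x := (0:ℝ))).mul_const Complex.I).const_add t
      simpa using this
    have h3 : HasDerivAt J c (t + (0:ℝ) * Complex.I) := by simpa [J] using h1
    have h4 := HasDerivAt.comp (0:ℝ) h3 h2
    have h5 : (J ∘ fun s : ℝ => t + s * Complex.I) = fun _ => J t := by
      ext s
      simp only [J, Function.comp]
      rw [← Jint_shift_im G A _ (x + t * b1) (y + t * b2) (s * b1) (s * b2)]
      congr 1 <;> push_cast <;> ring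
    rw [h5] at h4
    have h6 := h4.unique (hasDerivAt_const _ _)
    have h7 : c = 0 := by simpa using h6
    rw [h7] at h1
    exact h1
  have hmem : ∀ t ∈ Set.Icc (0:ℝ) 1, (t : ℂ) ∈ U := by
    intro t ht
    have := h t ht
    simpa [hU] using this
  have hd' : ∀ t ∈ Set.Icc (0:ℝ) 1, HasDerivAt (fun s : ℝ => J s) 0 t := fun t ht =>
    (hd t (hmem t ht)).comp_ofReal
  have := constant_of_has_deriv_right_zero (f := fun s : ℝ => J s) (a := 0) (b := 1)
    (fun t ht => (hd' t ht).continuousAt.continuousWithinAt)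
    (fun t ht => (hd' t ⟨ht.1, ht.2.le⟩).hasDerivWithinAt) 1 (by simp)
  simpa [J] using this

end CT


namespace CT
open MeasureTheory

def chambers : List (ℤ × ℤ) :=
  [(-2, -1), (-1, -2), (1, 2), (2, 1), (-3, 1), (-3, 2), (-2, 3), (-1, 3), (1, -3), (2, -3),
    (3, -2), (3, -1)]

def circs : List (Fin 9 → ℕ) :=
  [![0,0,0,1,0,0,0,0,1], ![0,0,0,0,1,0,1,0,0], ![0,0,0,0,0,1,0,1,0], ![1,1,1,0,0,0,0,0,0],
  ![1,2,0,0,0,0,0,3,0], ![2,1,0,0,0,0,0,0,3], ![1,0,2,0,0,3,0,0,0], ![2,0,1,0,0,0,3,0,0],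
  ![1,0,0,0,0,1,0,0,2], ![1,0,0,0,0,0,2,1,0], ![1,0,0,0,0,0,1,0,1], ![0,1,2,3,0,0,0,0,0],
  ![0,2,1,0,3,0,0,0,0], ![0,1,0,1,0,0,0,2,0], ![0,1,0,0,1,0,0,1,0], ![0,1,0,0,2,0,0,0,1],
  ![0,0,1,1,0,1,0,0,0], ![0,0,1,2,0,0,1,0,0], ![0,0,1,0,1,2,0,0,0], ![0,0,0,1,0,0,1,1,0],
  ![0,0,0,0,1,1,0,0,1]]

/-- the order of pole attached to a set of forms -/
def kap (A : Finset (Fin 9)) : ℕ :=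
  (A.card - 2) + if A = {3,8} ∨ A = {4,6} ∨ A = {5,7} then 1 else 0

def isGood (A : Finset (Fin 9)) (b : ℤ × ℤ) : Prop := ∀ i ∈ A, 1 ≤ P i * b.1 + Q i * b.2

instance (A b) : Decidable (isGood A b) := by unfold isGood; infer_instance

theorem comb_step : ∀ A : Finset (Fin 9), (∃ b ∈ chambers, isGood A b) ∨
    ∃ n ∈ circs, ∀ c, n c ≠ 0 → c ∈ A ∧ kap (A.erase c) + 1 ≤ kap A := by
  decide +kernel

theorem chambers_bd : ∀ b ∈ chambers, |b.1| ≤ 3 ∧ |b.2| ≤ 3 ∧ |b.1 + b.2| ≤ 3 := by decide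

theorem circs_ok : ∀ n ∈ circs, (∑ c, (n c : ℤ) * P c = 0) ∧ (∑ c, (n c : ℤ) * Q c = 0) ∧
    0 < ∑ c, n c := by decide +kernel

theorem kap_lt : ∀ A : Finset (Fin 9), A ≠ Finset.univ → kap A ≤ 6 := by decide +kernel
theorem kap_univ : kap Finset.univ = 7 := by decide +kernel

theorem circ_lam (n) (hn : n ∈ circs) (w x y : ℂ) :
    ∑ c, (n c : ℂ) * (w + lam c x y) = ((∑ c, n c : ℕ) : ℂ) * w := by
  obtain ⟨h1, h2, -⟩ := circs_ok n hn
  have h1' : ∑ c, (n c : ℂ) * (P c : ℂ) = 0 := by exact_mod_cast h1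
  have h2' : ∑ c, (n c : ℂ) * (Q c : ℂ) = 0 := by exact_mod_cast h2
  have : ∀ c, (n c : ℂ) * (w + lam c x y) =
      n c * w + ((n c : ℂ) * (P c : ℂ)) * x + ((n c : ℂ) * (Q c : ℂ)) * y := by
    intro c; unfold lam; ring
  simp_rw [this, Finset.sum_add_distrib, ← Finset.sum_mul, h1', h2']
  push_cast; ring

theorem Phi_circ (G A n) (hn : n ∈ circs) (hA : ∀ c, n c ≠ 0 → c ∈ A) (w x y : ℂ)
    (h0 : ∀ i ∈ A, w + lam i x y ≠ 0) :
    ((∑ c, n c : ℕ) : ℂ) * w * Phi G A w x y = ∑ c, (n c : ℂ) * Phi G (A.erase c) w x y := by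
  rw [← circ_lam n hn w x y, Finset.sum_mul]
  refine Finset.sum_congr rfl fun c _ => ?_
  by_cases hc : n c = 0
  · simp [hc]
  · have hcA := hA c hc
    unfold Phi
    rw [← Finset.mul_prod_erase A _ hcA]
    have := h0 c hcA
    field_simp

theorem Reg_zero {η : ℝ} (hη : 0 < η) (A) {w : ℂ} (hw : 0 < w.re) : (w, 0, 0) ∈ Reg η A := by
  refine ⟨⟨?_, ?_, ?_⟩, ?_⟩
  · simp; linarith
  · simp; linarith
  · simp; linarith
  · intro i _; simp [lam, hw]

theorem Reg_ne {η : ℝ} {A} {w x y : ℂ} (h : (w, x, y) ∈ Reg η A) (i) (hi : i ∈ A) :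
    w + lam i x y ≠ 0 := by
  intro h0
  have h1 := h.2 i hi
  simp only at h1
  rw [h0] at h1
  simp at h1

theorem Jint_circ {η : ℝ} (hη : 0 < η) {G} (hG : GoodG η G) (A n) (hn : n ∈ circs)
    (hA : ∀ c, n c ≠ 0 → c ∈ A) (w : ℂ) (hw : 0 < w.re) :
    ((∑ c, n c : ℕ) : ℂ) * w * Jint G A w 0 0 = ∑ c, (n c : ℂ) * Jint G (A.erase c) w 0 0 := by
  unfold Jint
  simp_rw [← integral_const_mul]
  rw [← integral_finsetSum]
  · congr 1
    ext t
    exact Phi_circ G A n hn hA _ _ _ (fun i hi => Reg_ne ((Reg_shift η A w 0 0 t.1 t.2).2 (Reg_zero hη A hw)) i hi)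
  · intro c _
    exact (Phi_int hG _ (Reg_zero hη _ hw)).const_mul _

theorem Jint_good {η : ℝ} (hη : 0 < η) {G} (hG : GoodG η G) (A b) (hb : b ∈ chambers)
    (hA : isGood A b) :
    ∃ Ψ : ℂ → ℂ, DifferentiableOn ℂ Ψ {w | -(η/10) < w.re} ∧
      ∀ w : ℂ, 0 < w.re → Jint G A w 0 0 = Ψ w := by
  obtain ⟨h1, h2, h3⟩ := chambers_bd b hb
  have h1' : |(b.1 : ℝ)| ≤ 3 := by exact_mod_cast h1
  have h2' : |(b.2 : ℝ)| ≤ 3 := by exact_mod_cast h2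
  have h3' : |(b.1 : ℝ) + b.2| ≤ 3 := by exact_mod_cast h3
  rw [abs_le] at h1' h2' h3'
  have key : ∀ (w : ℂ) (t : ℝ), 0 ≤ t → t ≤ 1 → -(t * (η/10)) < w.re →
      (w, ((t * ((η/10) * b.1) : ℝ) : ℂ), ((t * ((η/10) * b.2) : ℝ) : ℂ)) ∈ Reg η A := by
    intro w t ht0 ht1 hw
    set u := t * (η/10) with hu
    have hu0 : 0 ≤ u := by positivity
    have hu1 : u ≤ η/10 := by nlinarith
    refine ⟨⟨?_, ?_, ?_⟩, ?_⟩
    · simp only [Complex.ofReal_re]; nlinarith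
    · simp only [Complex.ofReal_re]; nlinarith
    · simp only [Complex.ofReal_re]; nlinarith
    · intro i hi
      have h := hA i hi
      have h' : (1:ℝ) ≤ P i * b.1 + Q i * b.2 := by exact_mod_cast h
      simp only [lam, Complex.add_re, Complex.mul_re, Complex.intCast_re, Complex.intCast_im, Complex.ofReal_re]
      nlinarith
  refine ⟨fun w => Jint G A w (((η/10) * b.1 : ℝ) : ℂ) (((η/10) * b.2 : ℝ) : ℂ), ?_, ?_⟩
  · have := Jint_hol hG A 0 (((η/10) * b.1 : ℝ) : ℂ) (((η/10) * b.2 : ℝ) : ℂ) 1 0 0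
    simp only [mul_one, mul_zero, add_zero, zero_add] at this
    refine this.mono fun w hw => ?_
    have := key w 1 (by norm_num) le_rfl (by simpa using hw)
    simpa using this
  · intro w hw
    have := Jint_shift hG A w 0 0 ((η/10) * b.1) ((η/10) * b.2) (fun t ht => by
      have := key w t ht.1 ht.2 (by have := mul_nonneg ht.1 (by positivity : (0:ℝ) ≤ η/10); linarith)
      simpa using this)
    rw [← this]
    simp

theorem Jint_cont {η : ℝ} (hη : 0 < η) {G} (hG : GoodG η G) : ∀ A : Finset (Fin 9),
    ∃ Ψ : ℂ → ℂ, DifferentiableOn ℂ Ψ {w | -(η/10) < w.re} ∧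
      ∀ w : ℂ, 0 < w.re → w ^ kap A * Jint G A w 0 0 = Ψ w := by
  intro A
  induction A using Finset.strongInduction with
  | H A ih =>
  rcases comb_step A with ⟨b, hb, hA⟩ | ⟨n, hn, hA⟩
  · obtain ⟨Ψ, h1, h2⟩ := Jint_good hη hG A b hb hA
    refine ⟨fun w => w ^ kap A * Ψ w, ?_, fun w hw => by rw [h2 w hw]⟩
    exact (differentiableOn_id.pow _).mul h1
  · have ih' : ∀ c, ∃ Ψ : ℂ → ℂ, DifferentiableOn ℂ Ψ {w | -(η/10) < w.re} ∧
      (n c ≠ 0 → ∀ w : ℂ, 0 < w.re → w ^ kap (A.erase c) * Jint G (A.erase c) w 0 0 = Ψ w) := by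
      intro c
      by_cases hc : n c = 0
      · exact ⟨0, differentiableOn_const _, fun h => absurd hc h⟩
      · obtain ⟨Ψ, h1, h2⟩ := ih _ (Finset.erase_ssubset (hA c hc).1)
        exact ⟨Ψ, h1, fun _ => h2⟩
    choose Ψ h1 h2 using ih'
    have hN := (circs_ok n hn).2.2
    have hN' : ((∑ c, n c : ℕ) : ℂ) ≠ 0 := by exact_mod_cast hN.ne'
    refine ⟨fun w => ((∑ c, n c : ℕ) : ℂ)⁻¹ * ∑ c, (n c : ℂ) *
      (w ^ (kap A - 1 - kap (A.erase c)) * Ψ c w), ?_, ?_⟩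
    · apply DifferentiableOn.const_mul
      apply DifferentiableOn.fun_sum
      intro c _
      exact ((differentiableOn_id.pow _).mul (h1 c)).const_mul _
    · intro w hw
      have hk : 1 ≤ kap A := by
        by_contra hk
        have : ∀ c, n c = 0 := by
          intro c; by_contra hc; have := (hA c hc).2; omega
        simp [this] at hN
      have e := Jint_circ hη hG A n hn (fun c hc => (hA c hc).1) w hw
      have e2 : w ^ kap A = w ^ (kap A - 1) * w := by
        rw [← pow_succ]; congr 1; omega
      rw [e2, eq_inv_mul_iff_mul_eq₀ hN']
      calc _ = w ^ (kap A - 1) * (((∑ c, n c : ℕ) : ℂ) * w * Jint G A w 0 0) := by ring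
        _ = _ := by
          rw [e, Finset.mul_sum]
          refine Finset.sum_congr rfl fun c _ => ?_
          by_cases hc : n c = 0
          · simp [hc]
          · have e3 : w ^ (kap A - 1) = w ^ (kap A - 1 - kap (A.erase c)) * w ^ kap (A.erase c) := by
              rw [← pow_add, Nat.sub_add_cancel (by have := (hA c hc).2; omega)]
            rw [← h2 c hc w hw, e3]
            ring

end CT


namespace CT
open MeasureTheory

theorem lower_line {z : ℂ} (hz : 0 < z.re) : ∃ k : ℝ, 0 < k ∧ ∀ t : ℝ,
    k * (1 + |t|) ≤ ‖z + t * Complex.I‖ := by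
  set r := |z.im| with hr
  have hr0 : 0 ≤ r := abs_nonneg _
  refine ⟨min (z.re) 1 / (2 * (1 + r)), by positivity, fun t => ?_⟩
  have h1 : z.re ≤ ‖z + t * Complex.I‖ := by
    refine le_trans (le_of_eq ?_) (Complex.re_le_norm _); simp
  have h2 : |t| - r ≤ ‖z + t * Complex.I‖ := by
    refine le_trans ?_ (Complex.abs_im_le_norm _)
    simp only [Complex.add_im, Complex.mul_im, Complex.ofReal_re, Complex.I_im, Complex.ofReal_im, Complex.I_re]
    have := abs_sub_abs_le_abs_sub t (-z.im)
    rw [abs_neg] at this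
    ring_nf at this ⊢
    linarith
  set N := ‖z + t * Complex.I‖
  set m := min z.re 1
  have hm0 : 0 < m := lt_min hz one_pos
  have hm1 : m ≤ z.re := min_le_left _ _
  have hm2 : m ≤ 1 := min_le_right _ _
  rw [div_mul_eq_mul_div, div_le_iff₀ (by positivity)]
  rcases le_total |t| (1 + 2 * r) with h | h
  · nlinarith [abs_nonneg t]
  · nlinarith [abs_nonneg t]

theorem line_ne {z : ℂ} (hz : 0 < z.re) (t : ℝ) : z + t * Complex.I ≠ 0 := by
  intro h
  have : (z + t * Complex.I).re = 0 := by rw [h]; simp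
  simp at this
  linarith

theorem line_ne' {z : ℂ} (hz : 0 < z.re) (t : ℝ) : z - t * Complex.I ≠ 0 := by
  have := line_ne hz (-t)
  simpa [sub_eq_add_neg] using this

theorem int_line1 {z1 z2 : ℂ} (h1 : 0 < z1.re) (h2 : 0 < z2.re) :
    Integrable (fun t : ℝ => ((z1 + t * Complex.I) * (z2 - t * Complex.I))⁻¹) := by
  obtain ⟨k1, hk1, H1⟩ := lower_line h1
  obtain ⟨k2, hk2, H2⟩ := lower_line h2
  refine (int_one.const_mul (k1 * k2)⁻¹).mono' ?_ (Eventually.of_forall fun t => ?_)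
  · refine (Continuous.inv₀ (by fun_prop) fun t => mul_ne_zero (line_ne h1 t) (line_ne' h2 t)).aestronglyMeasurable
  · rw [norm_inv, norm_mul]
    have a1 := H1 t
    have a2 := H2 (-t)
    rw [abs_neg] at a2
    push_cast at a2
    rw [neg_mul, ← sub_eq_add_neg] at a2
    have hX : (1:ℝ) ≤ 1 + |t| := by linarith [abs_nonneg t]
    set X := 1 + |t|
    have hX0 : 0 < X := by linarith
    have : X ^ (-(2:ℝ)) ≤ X ^ (-(5/4):ℝ) := Real.rpow_le_rpow_of_exponent_le hX (by norm_num)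
    calc _ ≤ (k1 * X * (k2 * X))⁻¹ := inv_anti₀ (by positivity) (by gcongr)
      _ = (k1 * k2)⁻¹ * X ^ (-(2:ℝ)) := by
        rw [Real.rpow_neg hX0.le]; norm_cast; field_simp
      _ ≤ _ := by gcongr

theorem prod_le_rho (a b : ℝ) : ((1+|a|)*(1+|b|)*(1+|a+b|))^(-(5/6):ℝ) ≤ rho a b := by
  unfold rho
  have hX : (0:ℝ) < 1 + |a| := by positivity
  have hY : (0:ℝ) < 1 + |b| := by positivity
  have hZ : (0:ℝ) < 1 + |a+b| := by positivity
  set X := 1 + |a|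
  set Y := 1 + |b|
  set Z := 1 + |a+b|
  have e : ∀ U : ℝ, 0 < U → U ^ (-(5/4):ℝ) = (U ^ (-(5/12):ℝ))^3 := by
    intro U hU
    rw [← Real.rpow_natCast, ← Real.rpow_mul hU.le]; norm_num
  have e2 : ∀ U : ℝ, 0 < U → U ^ (-(5/6):ℝ) = (U ^ (-(5/12):ℝ))^2 := by
    intro U hU
    rw [← Real.rpow_natCast, ← Real.rpow_mul hU.le]; norm_num
  rw [e _ (by positivity), e _ (by positivity), e _ (by positivity), e2 _ (by positivity)]
  rw [Real.mul_rpow (by positivity) (by positivity), Real.mul_rpow (by positivity) (by positivity),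
    Real.mul_rpow (by positivity) (by positivity), Real.mul_rpow (by positivity) (by positivity)]
  have hx : 0 < X ^ (-(5/12):ℝ) := by positivity
  have hy : 0 < Y ^ (-(5/12):ℝ) := by positivity
  have hz : 0 < Z ^ (-(5/12):ℝ) := by positivity
  set x := X ^ (-(5/12):ℝ)
  set y := Y ^ (-(5/12):ℝ)
  set z := Z ^ (-(5/12):ℝ)
  have key : ∀ p q r : ℝ, 0 < p → 0 < q → 0 < r → p * q * r ≤ p^3+q^3+r^3 := by
    intro p q r hp hq hr
    nlinarith [sq_nonneg (p-q), sq_nonneg (q-r), sq_nonneg (p-r), mul_pos hp hq, mul_pos (mul_pos hp hq) hr,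
      mul_nonneg (add_nonneg (add_nonneg hp.le hq.le) hr.le) (add_nonneg (add_nonneg (sq_nonneg (p-q)) (sq_nonneg (q-r))) (sq_nonneg (p-r)))]
  calc _ = (x*y)*(x*z)*(y*z) := by ring
    _ ≤ _ := key _ _ _ (by positivity) (by positivity) (by positivity)

theorem int_line2_bd {z1 z2 z3 : ℂ} (h1 : 0 < z1.re) (h2 : 0 < z2.re) (h3 : 0 < z3.re) :
    ∃ C : ℝ, 0 ≤ C ∧ ∀ t : ℝ × ℝ, ‖((z1 + t.1 * Complex.I) * (z2 + t.2 * Complex.I) *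
      (z3 - (t.1 + t.2) * Complex.I))⁻¹‖ ≤ C * rho t.1 t.2 := by
  obtain ⟨k1, hk1, H1⟩ := lower_line h1
  obtain ⟨k2, hk2, H2⟩ := lower_line h2
  obtain ⟨k3, hk3, H3⟩ := lower_line h3
  refine ⟨(k1 * k2 * k3)⁻¹, by positivity, fun t => ?_⟩
  rw [norm_inv, norm_mul, norm_mul]
  have a1 := H1 t.1
  have a2 := H2 t.2
  have a3 := H3 (-(t.1+t.2))
  rw [abs_neg] at a3
  push_cast at a3
  rw [neg_mul, ← sub_eq_add_neg] at a3
  have hX : (1:ℝ) ≤ 1 + |t.1| := by linarith [abs_nonneg t.1]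
  have hY : (1:ℝ) ≤ 1 + |t.2| := by linarith [abs_nonneg t.2]
  have hZ : (1:ℝ) ≤ 1 + |t.1+t.2| := by linarith [abs_nonneg (t.1+t.2)]
  refine le_trans ?_ (mul_le_mul_of_nonneg_left (prod_le_rho t.1 t.2) (by positivity))
  set X := 1 + |t.1|
  set Y := 1 + |t.2|
  set Z := 1 + |t.1+t.2|
  have hXY : 1 ≤ X * Y * Z := one_le_mul_of_one_le_of_one_le (one_le_mul_of_one_le_of_one_le hX hY) hZ
  have hX0 : 0 < X := by linarith
  have hY0 : 0 < Y := by linarith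
  have hZ0 : 0 < Z := by linarith
  calc _ ≤ (k1 * X * (k2 * Y) * (k3 * Z))⁻¹ := inv_anti₀ (by positivity) (by gcongr)
    _ = (k1 * k2 * k3)⁻¹ * (X*Y*Z) ^ (-(1:ℝ)) := by
        rw [Real.rpow_neg (by positivity), Real.rpow_one]; field_simp
    _ ≤ _ := by
        have : (X*Y*Z) ^ (-(1:ℝ)) ≤ (X*Y*Z) ^ (-(5/6):ℝ) :=
          Real.rpow_le_rpow_of_exponent_le hXY (by norm_num)
        gcongr

theorem int_line2 {z1 z2 z3 : ℂ} (h1 : 0 < z1.re) (h2 : 0 < z2.re) (h3 : 0 < z3.re) :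
    Integrable (fun t : ℝ × ℝ => ((z1 + t.1 * Complex.I) * (z2 + t.2 * Complex.I) *
      (z3 - (t.1 + t.2) * Complex.I))⁻¹) := by
  obtain ⟨C, hC, H⟩ := int_line2_bd h1 h2 h3
  refine (int_rho.const_mul C).mono' ?_ (Eventually.of_forall H)
  refine (Continuous.inv₀ (by fun_prop) fun t => mul_ne_zero (mul_ne_zero (line_ne h1 _) (line_ne h2 _)) ?_).aestronglyMeasurable
  have := line_ne' h3 (t.1 + t.2)
  push_cast at this
  exact this

theorem mellin_max {s z : ℂ} (hz : 0 < z.re) (hs : z.re < s.re) :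
    MellinConvergent (fun r : ℝ => ((max 1 r : ℝ) : ℂ) ^ (-s)) z ∧
    mellin (fun r : ℝ => ((max 1 r : ℝ) : ℂ) ^ (-s)) z = s / (z * (s - z)) := by
  have hz0 : z ≠ 0 := by rintro rfl; simp at hz
  have hsz : s - z ≠ 0 := by
    intro h
    have := congrArg Complex.re h
    simp at this; linarith
  have e1 : Set.EqOn (fun r : ℝ => (r:ℂ) ^ (z - 1) • ((max 1 r : ℝ) : ℂ) ^ (-s)) (fun r : ℝ => (r:ℂ)^(z-1)) (Set.Ioc 0 1) := by
    intro r hr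
    simp [max_eq_left hr.2]
  have e2 : Set.EqOn (fun r : ℝ => (r:ℂ) ^ (z - 1) • ((max 1 r : ℝ) : ℂ) ^ (-s)) (fun r : ℝ => (r:ℂ)^(z-1-s)) (Set.Ioi 1) := by
    intro r hr
    have hr' : (1:ℝ) < r := hr
    have h0 : (r:ℂ) ≠ 0 := by exact_mod_cast (by linarith : r ≠ 0)
    simp only [max_eq_right hr'.le, smul_eq_mul]
    rw [← Complex.cpow_add _ _ h0]; congr 1
  have i1 : IntegrableOn (fun r : ℝ => (r:ℂ)^(z-1)) (Set.Ioc 0 1) := by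
    have := intervalIntegral.intervalIntegrable_cpow' (a := 0) (b := 1) (r := z - 1) (by simpa using hz)
    rwa [intervalIntegrable_iff_integrableOn_Ioc_of_le zero_le_one] at this
  have i2 : IntegrableOn (fun r : ℝ => (r:ℂ)^(z-1-s)) (Set.Ioi 1) :=
    integrableOn_Ioi_cpow_of_lt (by simp; linarith) one_pos
  have j1 := i1.congr_fun e1.symm measurableSet_Ioc
  have j2 := i2.congr_fun e2.symm measurableSet_Ioi
  have hU : Set.Ioc (0:ℝ) 1 ∪ Set.Ioi 1 = Set.Ioi 0 := Set.Ioc_union_Ioi_eq_Ioi zero_le_one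
  constructor
  · unfold MellinConvergent
    rw [← hU]
    exact j1.union j2
  · unfold mellin
    rw [← hU, setIntegral_union (Set.Ioc_disjoint_Ioi le_rfl) measurableSet_Ioi j1 j2,
      setIntegral_congr_fun measurableSet_Ioc e1, setIntegral_congr_fun measurableSet_Ioi e2,
      integral_Ioi_cpow_of_lt (by simp; linarith) one_pos,
      ← intervalIntegral.integral_of_le zero_le_one, integral_cpow (Or.inl (by simpa using hz))]
    have h4 : z - 1 - s + 1 ≠ 0 := by
      intro h; apply hsz; linear_combination -h
    simp [hz0]
    have h5 : z - 1 - s + 1 = -(s - z) := by ring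
    rw [h5]
    field_simp
    ring

theorem line1_real {s : ℂ} {σ : ℝ} (h0 : 0 < σ) (hs : σ < s.re) (r : ℝ) (hr : 0 < r) :
    ∫ t : ℝ, (r:ℂ) ^ (-((σ:ℂ) + t * Complex.I)) * (((σ:ℂ) + t * Complex.I) * (s - σ - t * Complex.I))⁻¹ =
      2 * Real.pi * ((max 1 r : ℝ) : ℂ) ^ (-s) / s := by
  have hs0 : s ≠ 0 := by rintro rfl; simp at hs; linarith
  have hm := fun t : ℝ => mellin_max (s := s) (z := (σ:ℂ) + t * Complex.I) (by simpa using h0) (by simpa using hs)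
  have hf : MellinConvergent (fun r : ℝ => ((max 1 r : ℝ) : ℂ) ^ (-s)) (σ:ℂ) := by
    have := (hm 0).1; simpa using this
  have hv : ((fun t : ℝ => mellin (fun r : ℝ => ((max 1 r : ℝ) : ℂ) ^ (-s)) ((σ:ℂ) + t * Complex.I))) =
      fun t : ℝ => s * (((σ:ℂ) + t * Complex.I) * (s - σ - t * Complex.I))⁻¹ := by
    ext t
    rw [(hm t).2, div_eq_mul_inv, sub_sub]
  have hvi : Complex.VerticalIntegrable (mellin (fun r : ℝ => ((max 1 r : ℝ) : ℂ) ^ (-s))) σ := by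
    unfold Complex.VerticalIntegrable
    rw [hv]
    exact (int_line1 (by simpa using h0) (by simpa using hs)).const_mul s
  have hcont : ContinuousAt (fun r : ℝ => ((max 1 r : ℝ) : ℂ) ^ (-s)) r := by
    apply ContinuousAt.cpow (by fun_prop) continuousAt_const
    left
    simp
  have := mellinInv_mellin_eq σ _ hr hf hvi hcont
  unfold mellinInv at this
  have hv' : ∀ t : ℝ, mellin (fun r : ℝ => ((max 1 r : ℝ) : ℂ) ^ (-s)) ((σ:ℂ) + t * Complex.I) = s * (((σ:ℂ) + t * Complex.I) * (s - σ - t * Complex.I))⁻¹ := fun t => congrFun hv t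
  simp_rw [hv', smul_eq_mul] at this
  rw [← this]
  simp_rw [mul_left_comm _ s]
  rw [integral_const_mul, Complex.real_smul]
  have hpi : (Real.pi : ℂ) ≠ 0 := by exact_mod_cast Real.pi_ne_zero
  push_cast
  generalize (∫ t : ℝ, (r:ℂ) ^ (-((σ:ℂ) + t * Complex.I)) *
    (((σ:ℂ) + t * Complex.I) * (s - σ - t * Complex.I))⁻¹) = J
  field_simp

theorem line1 {z1 z2 : ℂ} (h1 : 0 < z1.re) (h2 : 0 < z2.re) (a b : ℝ) (ha : 0 < a) (hb : 0 < b) :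
    ∫ t : ℝ, (a:ℂ) ^ (-(z1 + t * Complex.I)) * (b:ℂ) ^ (-(z2 - t * Complex.I)) *
        ((z1 + t * Complex.I) * (z2 - t * Complex.I))⁻¹ =
      2 * Real.pi * ((max a b : ℝ) : ℂ) ^ (-(z1 + z2)) / (z1 + z2) := by
  have hb0 : (b:ℂ) ≠ 0 := by exact_mod_cast hb.ne'
  have ha0 : (a:ℂ) ≠ 0 := by exact_mod_cast ha.ne'
  have := line1_real (s := z1 + z2) (σ := z1.re) h1 (by simpa using h2) (a/b) (by positivity)
  rw [← integral_add_right_eq_self _ z1.im] at this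
  have hz : ∀ t : ℝ, (z1.re : ℂ) + ((t + z1.im : ℝ) : ℂ) * Complex.I = z1 + t * Complex.I := by
    intro t
    conv_rhs => rw [← Complex.re_add_im z1]
    push_cast; ring
  have hz' : ∀ t : ℝ, z1 + z2 - (z1.re : ℂ) - ((t + z1.im : ℝ) : ℂ) * Complex.I = z2 - t * Complex.I := by
    intro t
    have := hz t
    linear_combination -this
  simp_rw [hz, hz'] at this
  have e : ∀ t : ℝ, (a:ℂ) ^ (-(z1 + t * Complex.I)) * (b:ℂ) ^ (-(z2 - t * Complex.I)) *
        ((z1 + t * Complex.I) * (z2 - t * Complex.I))⁻¹ = (b:ℂ)^(-(z1+z2)) * (((a/b : ℝ):ℂ) ^ (-(z1 + t * Complex.I)) *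
        ((z1 + t * Complex.I) * (z2 - t * Complex.I))⁻¹) := by
    intro t
    have h3 : (a:ℂ) ^ (-(z1 + t * Complex.I)) = ((a/b : ℝ):ℂ) ^ (-(z1 + t * Complex.I)) * (b:ℂ) ^ (-(z1 + t * Complex.I)) := by
      rw [← Complex.mul_cpow_ofReal_nonneg (by positivity) hb.le, ← Complex.ofReal_mul, div_mul_cancel₀ _ hb.ne']
    have h4 : (b:ℂ)^(-(z1+z2)) = (b:ℂ) ^ (-(z1 + t * Complex.I)) * (b:ℂ) ^ (-(z2 - t * Complex.I)) := by
      rw [← Complex.cpow_add _ _ hb0]; congr 1; ring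
    rw [h3, h4]; ring
  simp_rw [e]
  rw [integral_const_mul, this]
  have h5 : ((max a b : ℝ) : ℂ) ^ (-(z1 + z2)) = (b:ℂ)^(-(z1+z2)) * ((max 1 (a/b) : ℝ) : ℂ) ^ (-(z1 + z2)) := by
    rw [← Complex.mul_cpow_ofReal_nonneg hb.le (by positivity), ← Complex.ofReal_mul, mul_max_of_nonneg _ _ hb.le,
      mul_one, mul_div_cancel₀ _ hb.ne', max_comm]
  rw [h5]; ring

/-- the two-dimensional inversion formula -/
theorem line2 {z1 z2 z3 : ℂ} (h1 : 0 < z1.re) (h2 : 0 < z2.re) (h3 : 0 < z3.re) (a b c : ℝ)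
    (ha : 0 < a) (hb : 0 < b) (hc : 0 < c) :
    ∫ t : ℝ × ℝ, (a:ℂ) ^ (-(z1 + t.1 * Complex.I)) * (b:ℂ) ^ (-(z2 + t.2 * Complex.I)) *
        (c:ℂ) ^ (-(z3 - (t.1 + t.2) * Complex.I)) *
        ((z1 + t.1 * Complex.I) * (z2 + t.2 * Complex.I) * (z3 - (t.1 + t.2) * Complex.I))⁻¹ =
      (2 * Real.pi) ^ 2 * ((max a (max b c) : ℝ) : ℂ) ^ (-(z1 + z2 + z3)) / (z1 + z2 + z3) := by
  have ha0 : (a:ℂ) ≠ 0 := by exact_mod_cast ha.ne'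
  have hb0 : (b:ℂ) ≠ 0 := by exact_mod_cast hb.ne'
  have hc0 : (c:ℂ) ≠ 0 := by exact_mod_cast hc.ne'
  have hIntg : Integrable (fun t : ℝ × ℝ => (a:ℂ) ^ (-(z1 + t.1 * Complex.I)) * (b:ℂ) ^ (-(z2 + t.2 * Complex.I)) *
        (c:ℂ) ^ (-(z3 - (t.1 + t.2) * Complex.I)) *
        ((z1 + t.1 * Complex.I) * (z2 + t.2 * Complex.I) * (z3 - (t.1 + t.2) * Complex.I))⁻¹) := by
    refine (int_line2 h1 h2 h3).bdd_mul (c := a ^ (-z1.re) * b ^ (-z2.re) * c ^ (-z3.re)) ?_ (Eventually.of_forall fun t => ?_)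
    · refine Continuous.aestronglyMeasurable ?_
      refine Continuous.mul (Continuous.mul ?_ ?_) ?_
      · exact Continuous.const_cpow (by fun_prop) (Or.inl ha0)
      · exact Continuous.const_cpow (by fun_prop) (Or.inl hb0)
      · exact Continuous.const_cpow (by fun_prop) (Or.inl hc0)
    · rw [norm_mul, norm_mul, Complex.norm_cpow_eq_rpow_re_of_pos ha, Complex.norm_cpow_eq_rpow_re_of_pos hb,
        Complex.norm_cpow_eq_rpow_re_of_pos hc]
      simp
  rw [Measure.volume_eq_prod] at hIntg ⊢
  rw [integral_prod _ hIntg]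
  have step : ∀ t : ℝ, ∫ u : ℝ, (a:ℂ) ^ (-(z1 + t * Complex.I)) * (b:ℂ) ^ (-(z2 + u * Complex.I)) *
        (c:ℂ) ^ (-(z3 - (t + u) * Complex.I)) *
        ((z1 + t * Complex.I) * (z2 + u * Complex.I) * (z3 - (t + u) * Complex.I))⁻¹ =
      2 * Real.pi * ((a:ℂ) ^ (-(z1 + t * Complex.I)) * ((max b c : ℝ):ℂ) ^ (-(z2 + z3 - t * Complex.I)) *
        ((z1 + t * Complex.I) * (z2 + z3 - t * Complex.I))⁻¹) := by
    intro t
    have := line1 (z1 := z2) (z2 := z3 - t * Complex.I) h2 (by simpa using h3) b c hb hc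
    have e : ∀ u : ℝ, (a:ℂ) ^ (-(z1 + t * Complex.I)) * (b:ℂ) ^ (-(z2 + u * Complex.I)) *
        (c:ℂ) ^ (-(z3 - (t + u) * Complex.I)) *
        ((z1 + t * Complex.I) * (z2 + u * Complex.I) * (z3 - (t + u) * Complex.I))⁻¹ =
        ((a:ℂ) ^ (-(z1 + t * Complex.I)) * (z1 + t * Complex.I)⁻¹) *
         ((b:ℂ) ^ (-(z2 + u * Complex.I)) * (c:ℂ) ^ (-(z3 - t * Complex.I - u * Complex.I)) *
          ((z2 + u * Complex.I) * (z3 - t * Complex.I - u * Complex.I))⁻¹) := by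
      intro u
      have : z3 - (t + u) * Complex.I = z3 - t * Complex.I - u * Complex.I := by ring
      rw [this]
      simp only [mul_inv]; ring
    simp_rw [e]
    rw [integral_const_mul, this]
    have : z2 + (z3 - t * Complex.I) = z2 + z3 - t * Complex.I := by ring
    rw [this, mul_inv, div_eq_mul_inv]; ring
  simp only [] at step ⊢
  simp_rw [step]
  rw [integral_const_mul, line1 h1 (by simp; linarith) a _ ha (lt_max_of_lt_left hb), ← add_assoc]
  ring

end CT


namespace CT
open MeasureTheory

/-- positive triples with their relation -/
def leaves : List (Fin 9 × Fin 9 × Fin 9) :=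
  [(0,1,2),(0,1,7),(0,1,8),(0,2,5),(0,2,6),(0,5,8),(0,6,7),(0,6,8),(1,2,3),(1,2,4),(1,3,7),(1,4,7),(1,4,8),(2,3,5),(2,3,6),(2,4,5),(3,6,7),(4,5,8)]

def leafW (l : Fin 9 × Fin 9 × Fin 9) : Fin 9 → ℕ :=
  (circs.find? fun n => n l.1 != 0 && n l.2.1 != 0 && n l.2.2 != 0).getD 0

def detPQ (a b : Fin 9) : ℤ := P a * Q b - Q a * P b

theorem leaves_ok : ∀ l ∈ leaves, l.1 ≠ l.2.1 ∧ l.1 ≠ l.2.2 ∧ l.2.1 ≠ l.2.2 ∧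
    0 < leafW l l.1 ∧ 0 < leafW l l.2.1 ∧ 0 < leafW l l.2.2 ∧ detPQ l.1 l.2.1 ≠ 0 ∧
    leafW l l.1 * P l.1 + leafW l l.2.1 * P l.2.1 + leafW l l.2.2 * P l.2.2 = 0 ∧
    leafW l l.1 * Q l.1 + leafW l l.2.1 * Q l.2.1 + leafW l l.2.2 * Q l.2.2 = 0 := by
  decide +kernel

def leafV (l : Fin 9 × Fin 9 × Fin 9) : ℚ :=
  (leafW l l.2.2 : ℚ) / ((leafW l l.1 + leafW l l.2.1 + leafW l l.2.2 : ℕ) * |(detPQ l.1 l.2.1 : ℚ)|)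

def val : ℕ → Finset (Fin 9) → ℚ
  | 0, _ => 0
  | k+1, A => if ∃ b ∈ chambers, isGood A b then 0 else
    match leaves.find? (fun l => decide (A = {l.1, l.2.1, l.2.2})) with
    | some l => leafV l
    | none => match circs.find? (fun n => decide (∀ c, n c ≠ 0 → c ∈ A)) with
      | some n => ∑ c, if n c = 0 then 0 else (n c : ℚ) / (∑ d, n d : ℕ) * val k (A.erase c)
      | none => 0

def vok : ℕ → Finset (Fin 9) → Prop
  | 0, _ => False
  | k+1, A => if ∃ b ∈ chambers, isGood A b then 3 ≤ A.card else
    match leaves.find? (fun l => decide (A = {l.1, l.2.1, l.2.2})) with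
    | some _ => True
    | none => match circs.find? (fun n => decide (∀ c, n c ≠ 0 → c ∈ A)) with
      | some n => 4 ≤ A.card ∧ ∀ c, n c ≠ 0 → vok k (A.erase c)
      | none => False

instance vokDec : ∀ k A, Decidable (vok k A)
  | 0, _ => inferInstanceAs (Decidable False)
  | k+1, A => by
    have := vokDec k
    unfold vok
    split_ifs
    · infer_instance
    · cases leaves.find? (fun l => decide (A = {l.1, l.2.1, l.2.2})) with
      | some _ => exact inferInstanceAs (Decidable True)
      | none => 
        simp only
        cases circs.find? (fun n => decide (∀ c, n c ≠ 0 → c ∈ A)) with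
        | some n => simp only; infer_instance
        | none => exact inferInstanceAs (Decidable False)

theorem val_univ : val 8 Finset.univ = 1/108 := by decide +kernel
theorem vok_univ : vok 8 Finset.univ := by decide +kernel

/-- the limiting statement -/
def IsLim (G : ℂ → ℂ → ℂ → ℂ) (A : Finset (Fin 9)) (v : ℚ) : Prop :=
  Tendsto (fun w : ℝ => (w : ℂ) ^ (A.card - 2) * Jint G A w 0 0) (𝓝[>] 0)
    (𝓝 (G 0 0 0 * ((2 * Real.pi) ^ 2 * (v : ℂ))))

theorem IsLim_good {η : ℝ} (hη : 0 < η) {G} (hG : GoodG η G) (A) (h : ∃ b ∈ chambers, isGood A b)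
    (h3 : 3 ≤ A.card) : IsLim G A 0 := by
  obtain ⟨b, hb, hA⟩ := h
  obtain ⟨Ψ, h1, h2⟩ := Jint_good hη hG A b hb hA
  have hc : ContinuousAt Ψ 0 := by
    refine (h1.differentiableAt ?_).continuousAt
    refine (isOpen_lt continuous_const Complex.continuous_re).mem_nhds ?_
    simp; positivity
  have hc2 : ContinuousAt (fun w : ℂ => w ^ (A.card - 2) * Ψ w) 0 := by fun_prop
  have hc3 : ContinuousAt (fun w : ℝ => (w:ℂ) ^ (A.card - 2) * Ψ w) 0 :=
    ContinuousAt.comp (f := fun w : ℝ => (w:ℂ)) (g := fun w : ℂ => w ^ (A.card - 2) * Ψ w)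
      (by rw [Complex.ofReal_zero]; exact hc2) Complex.continuous_ofReal.continuousAt
  have h4 := hc3.tendsto.mono_left (nhdsWithin_le_nhds (s := Set.Ioi 0))
  unfold IsLim
  have e : (((0:ℝ):ℂ)) ^ (A.card - 2) * Ψ ((0:ℝ):ℂ) = G 0 0 0 * ((2 * Real.pi) ^ 2 * ((0:ℚ) : ℂ)) := by
    have : A.card - 2 ≠ 0 := by omega
    simp [this]
  rw [e] at h4
  refine h4.congr' ?_
  filter_upwards [self_mem_nhdsWithin] with w hw
  rw [h2 _ (by simpa using hw)]

theorem IsLim_circ {η : ℝ} (hη : 0 < η) {G} (hG : GoodG η G) (A) (n) (hn : n ∈ circs)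
    (hA : ∀ c, n c ≠ 0 → c ∈ A) (h4 : 4 ≤ A.card) (v : Fin 9 → ℚ)
    (hv : ∀ c, n c ≠ 0 → IsLim G (A.erase c) (v c)) :
    IsLim G A (∑ c, if n c = 0 then 0 else (n c : ℚ) / (∑ d, n d : ℕ) * v c) := by
  have hN := (circs_ok n hn).2.2
  have hN' : ((∑ c, n c : ℕ) : ℂ) ≠ 0 := by exact_mod_cast hN.ne'
  set N := ∑ c, n c
  have h1 : ∀ c, Tendsto (fun w : ℝ => if n c = 0 then 0 else ((n c : ℂ) / (N : ℂ)) * ((w : ℂ) ^ (A.card - 3) * Jint G (A.erase c) w 0 0)) (𝓝[>] 0)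
    (𝓝 (if n c = 0 then 0 else ((n c : ℂ) / (N : ℂ)) * (G 0 0 0 * ((2 * Real.pi) ^ 2 * (v c : ℂ))))) := by
    intro c
    split_ifs with hc
    · exact tendsto_const_nhds
    · have := hv c hc
      unfold IsLim at this
      rw [Finset.card_erase_of_mem (hA c hc)] at this
      exact this.const_mul _
  have h2 := tendsto_finsetSum Finset.univ (fun c _ => h1 c)
  unfold IsLim
  have e : ∑ c, (if n c = 0 then 0 else ((n c : ℂ) / (N : ℂ)) * (G 0 0 0 * ((2 * Real.pi) ^ 2 * (v c : ℂ)))) =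
     G 0 0 0 * ((2 * Real.pi) ^ 2 * ((∑ c, if n c = 0 then 0 else (n c : ℚ) / (N : ℕ) * v c : ℚ) : ℂ)) := by
    push_cast
    rw [Finset.mul_sum, Finset.mul_sum]
    refine Finset.sum_congr rfl fun c _ => ?_
    split_ifs
    · simp
    · push_cast; ring
  rw [← e]
  refine h2.congr' ?_
  filter_upwards [self_mem_nhdsWithin] with w hw
  have e := Jint_circ hη hG A n hn hA w (by simpa using hw)
  have e2 : (w:ℂ) ^ (A.card - 2) = (w:ℂ) ^ (A.card - 3) * w := by
    rw [← pow_succ]; congr 1; omega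
  have e3 : (w:ℂ) * Jint G A w 0 0 = (N:ℂ)⁻¹ * ∑ c, (n c : ℂ) * Jint G (A.erase c) w 0 0 := by
    rw [← e, mul_assoc, inv_mul_cancel_left₀ hN']
  rw [e2, mul_assoc, e3, Finset.mul_sum, Finset.mul_sum]
  refine Finset.sum_congr rfl fun c _ => ?_
  split_ifs with hc
  · simp [hc]
  · ring

/-- scaling -/
theorem Jint_scale (G A) (w : ℝ) (hw : 0 < w) :
    (w:ℂ) ^ A.card * Jint G A w 0 0 = w ^ 2 * ∫ u : ℝ × ℝ, (∏ i ∈ A, (1 + lam i (u.1 * Complex.I) (u.2 * Complex.I))⁻¹) *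
      G w (w * (u.1 * Complex.I)) (w * (u.2 * Complex.I)) := by
  have hw0 : (w:ℂ) ≠ 0 := by exact_mod_cast hw.ne'
  have := (int_lin w 0 0 w (by simp; exact hw.ne') (fun t : ℝ × ℝ => Phi G A w (t.1 * Complex.I) (t.2 * Complex.I))).2
  have e : ∀ u : ℝ × ℝ, Phi G A w (((w * u.1 + 0 * u.2 : ℝ):ℂ) * Complex.I) (((0 * u.1 + w * u.2 : ℝ):ℂ) * Complex.I) =
     ((w:ℂ) ^ A.card)⁻¹ * ((∏ i ∈ A, (1 + lam i (u.1 * Complex.I) (u.2 * Complex.I))⁻¹) *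
      G w (w * (u.1 * Complex.I)) (w * (u.2 * Complex.I))) := by
    intro u
    unfold Phi
    rw [← mul_assoc]
    congr 1
    · rw [← inv_pow, ← Finset.prod_const, ← Finset.prod_mul_distrib]
      refine Finset.prod_congr rfl fun i _ => ?_
      rw [← mul_inv]
      congr 1
      unfold lam
      push_cast; ring
    · congr 1 <;> push_cast <;> ring
  simp only [e] at this
  rw [integral_const_mul] at this
  unfold Jint
  simp only [zero_add]
  have e3 : ((|(w * w - 0 * 0)⁻¹| : ℝ) : ℂ) = ((w:ℂ)^2)⁻¹ := by
    rw [abs_of_pos (by rw [mul_zero, sub_zero]; positivity)]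
    push_cast; congr 1; ring
  rw [← Complex.coe_smul, e3, smul_eq_mul] at this
  set I1 := ∫ u : ℝ × ℝ, (∏ i ∈ A, (1 + lam i (u.1 * Complex.I) (u.2 * Complex.I))⁻¹) *
      G w (w * (u.1 * Complex.I)) (w * (u.2 * Complex.I))
  set I2 := ∫ t : ℝ × ℝ, Phi G A w (t.1 * Complex.I) (t.2 * Complex.I)
  field_simp at this
  linear_combination -this

theorem lam_im (i : Fin 9) (u1 u2 : ℝ) : lam i (u1 * Complex.I) (u2 * Complex.I) = ((P i * u1 + Q i * u2 : ℝ) : ℂ) * Complex.I := by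
  unfold lam; push_cast; ring

theorem leaf_int (l) (hl : l ∈ leaves) :
    Integrable (fun u : ℝ × ℝ => ∏ i ∈ ({l.1, l.2.1, l.2.2} : Finset (Fin 9)), (1 + lam i (u.1 * Complex.I) (u.2 * Complex.I))⁻¹) ∧
    ∫ u : ℝ × ℝ, ∏ i ∈ ({l.1, l.2.1, l.2.2} : Finset (Fin 9)), (1 + lam i (u.1 * Complex.I) (u.2 * Complex.I))⁻¹ =
      (2 * Real.pi) ^ 2 * (leafV l : ℂ) := by
  obtain ⟨h12, h13, h23, ha, hb, hc, hd, hP, hQ⟩ := leaves_ok l hl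
  unfold leafV
  obtain ⟨a, b, c⟩ := l
  simp only at *
  generalize leafW (a,b,c) = n at *
  set na := n a
  set nb := n b
  set nc := n c
  have ha' : (0:ℝ) < na := by exact_mod_cast ha
  have hb' : (0:ℝ) < nb := by exact_mod_cast hb
  have hc' : (0:ℝ) < nc := by exact_mod_cast hc
  have ha0 : (na:ℂ) ≠ 0 := by exact_mod_cast ha.ne'
  have hb0 : (nb:ℂ) ≠ 0 := by exact_mod_cast hb.ne'
  have hc0 : (nc:ℂ) ≠ 0 := by exact_mod_cast hc.ne'
  have hd' : (na * P a : ℝ) * (nb * Q b) - (na * Q a) * (nb * P b) = na * nb * (detPQ a b : ℝ) := by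
    unfold detPQ; push_cast; ring
  have hd0 : (detPQ a b : ℝ) ≠ 0 := by exact_mod_cast hd
  have hdne : (na * P a : ℝ) * (nb * Q b) - (na * Q a) * (nb * P b) ≠ 0 := by
    rw [hd']; positivity
  have hPr : (na * P a + nb * P b + nc * P c : ℝ) = 0 := by exact_mod_cast hP
  have hQr : (na * Q a + nb * Q b + nc * Q c : ℝ) = 0 := by exact_mod_cast hQ
  have hlin := int_lin (na * P a : ℝ) (na * Q a) (nb * P b) (nb * Q b) hdne
    (fun t : ℝ × ℝ => (((na:ℂ) + t.1 * Complex.I) * ((nb:ℂ) + t.2 * Complex.I) *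
      ((nc:ℂ) - (t.1 + t.2) * Complex.I))⁻¹)
  have hi := int_line2 (z1 := (na:ℂ)) (z2 := (nb:ℂ)) (z3 := (nc:ℂ)) (by simpa using ha') (by simpa using hb') (by simpa using hc')
  have hv := line2 (z1 := (na:ℂ)) (z2 := (nb:ℂ)) (z3 := (nc:ℂ)) (by simpa using ha') (by simpa using hb') (by simpa using hc') 1 1 1 one_pos one_pos one_pos
  simp only [Complex.ofReal_one, Complex.one_cpow, one_mul, max_self, mul_one] at hv
  have e : ∀ u : ℝ × ℝ, ∏ i ∈ ({a, b, c} : Finset (Fin 9)), (1 + lam i (u.1 * Complex.I) (u.2 * Complex.I))⁻¹ =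
     ((na:ℂ) * nb * nc) * ((((na:ℂ) + ((na * P a * u.1 + na * Q a * u.2 : ℝ):ℂ) * Complex.I) * ((nb:ℂ) + ((nb * P b * u.1 + nb * Q b * u.2 : ℝ):ℂ) * Complex.I) *
      ((nc:ℂ) - (((na * P a * u.1 + na * Q a * u.2 : ℝ):ℂ) + ((nb * P b * u.1 + nb * Q b * u.2 : ℝ):ℂ)) * Complex.I))⁻¹) := by
    intro u
    rw [Finset.prod_insert (by simp [h12, h13]), Finset.prod_insert (by simp [h23]), Finset.prod_singleton]
    rw [lam_im, lam_im, lam_im]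
    have e1 : (na:ℂ) + ((na * P a * u.1 + na * Q a * u.2 : ℝ):ℂ) * Complex.I = na * (1 + ((P a * u.1 + Q a * u.2 : ℝ) : ℂ) * Complex.I) := by
      push_cast; ring
    have e2 : (nb:ℂ) + ((nb * P b * u.1 + nb * Q b * u.2 : ℝ):ℂ) * Complex.I = nb * (1 + ((P b * u.1 + Q b * u.2 : ℝ) : ℂ) * Complex.I) := by
      push_cast; ring
    have e3 : (nc:ℂ) - (((na * P a * u.1 + na * Q a * u.2 : ℝ):ℂ) + ((nb * P b * u.1 + nb * Q b * u.2 : ℝ):ℂ)) * Complex.I = nc * (1 + ((P c * u.1 + Q c * u.2 : ℝ) : ℂ) * Complex.I) := by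
      have : nc * (P c * u.1 + Q c * u.2) = -((na * P a * u.1 + na * Q a * u.2) + (nb * P b * u.1 + nb * Q b * u.2)) := by
        linear_combination u.1 * hPr + u.2 * hQr
      have := congrArg (fun r : ℝ => (r:ℂ)) this
      push_cast at this ⊢
      linear_combination -Complex.I * this
    rw [e1, e2, e3]
    simp only [mul_inv]
    field_simp
  simp_rw [e]
  constructor
  · exact (hlin.1 hi).const_mul _
  · rw [integral_const_mul, hlin.2, hv, hd', ← Complex.coe_smul, smul_eq_mul]
    have e4 : ((|((na:ℝ) * nb * (detPQ a b : ℝ))⁻¹| : ℝ) : ℂ) = ((na:ℂ) * nb * ((|(detPQ a b : ℚ)| : ℚ) : ℂ))⁻¹ := by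
      rw [abs_inv, abs_mul, abs_of_pos (by positivity : (0:ℝ) < na * nb)]
      push_cast
      congr 2
      norm_cast
    rw [e4]
    have hd1 : ((|(detPQ a b : ℚ)| : ℚ) : ℂ) ≠ 0 := by
      have : (detPQ a b : ℚ) ≠ 0 := by exact_mod_cast hd
      exact_mod_cast (abs_pos.2 this).ne'
    have hs : (na:ℂ) + nb + nc ≠ 0 := by
      have : na + nb + nc ≠ 0 := by omega
      exact_mod_cast this
    push_cast at hd1 ⊢
    field_simp

theorem IsLim_leaf {η : ℝ} (hη : 0 < η) {G} (hG : GoodG η G) (l) (hl : l ∈ leaves) :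
    IsLim G {l.1, l.2.1, l.2.2} (leafV l) := by
  obtain ⟨hi, hv⟩ := leaf_int l hl
  obtain ⟨h12, h13, h23, -⟩ := leaves_ok l hl
  set A : Finset (Fin 9) := {l.1, l.2.1, l.2.2} with hA
  have hcard : A.card = 3 := by
    rw [hA, Finset.card_insert_of_notMem (by simp [h12, h13]), Finset.card_insert_of_notMem (by simp [h23]), Finset.card_singleton]
  obtain ⟨C, hC0, hC⟩ := hG.bd 1
  have hD : ∀ (w : ℝ) (u : ℝ × ℝ), 0 ≤ w → ((w:ℂ), (w * (u.1 * Complex.I) : ℂ), (w * (u.2 * Complex.I) : ℂ)) ∈ Dom η := by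
    intro w u hw
    refine ⟨?_, ?_, ?_⟩ <;> simp <;> linarith
  have key : Tendsto (fun w : ℝ => ∫ u : ℝ × ℝ, (∏ i ∈ A, (1 + lam i (u.1 * Complex.I) (u.2 * Complex.I))⁻¹) *
      G w (w * (u.1 * Complex.I)) (w * (u.2 * Complex.I))) (𝓝[>] 0)
      (𝓝 (∫ u : ℝ × ℝ, (∏ i ∈ A, (1 + lam i (u.1 * Complex.I) (u.2 * Complex.I))⁻¹) * G 0 0 0)) := by
    refine tendsto_integral_filter_of_dominated_convergence
      (fun u : ℝ × ℝ => ‖∏ i ∈ A, (1 + lam i (u.1 * Complex.I) (u.2 * Complex.I))⁻¹‖ * (C * 3)) ?_ ?_ ?_ ?_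
    · filter_upwards [self_mem_nhdsWithin] with w hw
      refine hi.aestronglyMeasurable.mul (Continuous.aestronglyMeasurable ?_)
      exact hG.cont.comp_continuous (f := fun u : ℝ × ℝ => ((w:ℂ), (w * (u.1 * Complex.I) : ℂ), (w * (u.2 * Complex.I) : ℂ)))
        (by fun_prop) (fun u => hD w u (le_of_lt hw))
    · have h1 : ∀ᶠ w : ℝ in 𝓝[>] 0, w < 1 := nhdsWithin_le_nhds (gt_mem_nhds one_pos)
      filter_upwards [self_mem_nhdsWithin, h1] with w hw hw1
      refine Eventually.of_forall fun u => ?_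
      rw [norm_mul]
      have hw' : 0 < w := hw
      refine mul_le_mul_of_nonneg_left ?_ (norm_nonneg _)
      refine (hC _ _ _ (hD w u hw'.le) ?_).trans ?_
      · rw [Complex.norm_real, Real.norm_of_nonneg hw'.le]; exact hw1.le
      · exact mul_le_mul_of_nonneg_left (rho_le _ _) hC0
    · exact hi.norm.mul_const _
    · refine Eventually.of_forall fun u => ?_
      refine Tendsto.const_mul _ ?_
      have h0 : ((0:ℂ),(0:ℂ),(0:ℂ)) ∈ Dom η := by have := hD 0 u le_rfl; simpa using this
      have h1 : ContinuousAt (fun p : ℂ × ℂ × ℂ => G p.1 p.2.1 p.2.2) (0,0,0) :=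
        hG.cont.continuousAt ((Dom_open η).mem_nhds h0)
      have h2 : Tendsto (fun w : ℝ => ((w:ℂ), (w * (u.1 * Complex.I) : ℂ), (w * (u.2 * Complex.I) : ℂ))) (𝓝 0) (𝓝 (0,0,0)) := by
        have : Continuous (fun w : ℝ => ((w:ℂ), (w * (u.1 * Complex.I) : ℂ), (w * (u.2 * Complex.I) : ℂ))) := by fun_prop
        have := this.tendsto 0
        simpa using this
      exact (h1.tendsto.comp h2).mono_left nhdsWithin_le_nhds
  rw [integral_mul_const, hv, mul_comm] at key
  unfold IsLim
  refine key.congr' ?_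
  filter_upwards [self_mem_nhdsWithin] with w hw
  have h1 := Jint_scale G A w hw
  rw [hcard] at h1 ⊢
  have hw0 : (w:ℂ) ≠ 0 := by
    have : 0 < w := hw
    exact_mod_cast this.ne'
  have h2 : (w:ℂ)^2 * ((w:ℂ)^(3-2) * Jint G A w 0 0) = w ^ 2 * ∫ u : ℝ × ℝ, (∏ i ∈ A, (1 + lam i (u.1 * Complex.I) (u.2 * Complex.I))⁻¹) *
      G w (w * (u.1 * Complex.I)) (w * (u.2 * Complex.I)) := by
    rw [← h1]; ring
  exact (mul_left_cancel₀ (pow_ne_zero 2 hw0) h2).symm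

theorem IsLim_val {η : ℝ} (hη : 0 < η) {G} (hG : GoodG η G) : ∀ k A, vok k A → IsLim G A (val k A) := by
  intro k
  induction k with
  | zero => intro A h; exact h.elim
  | succ k ih =>
    intro A h
    unfold vok at h
    unfold val
    split_ifs at h ⊢ with hg
    · exact IsLim_good hη hG A hg h
    · cases hf : leaves.find? (fun l => decide (A = {l.1, l.2.1, l.2.2})) with
      | some l =>
        have h1 := List.find?_some hf
        have h2 := List.mem_of_find?_eq_some hf
        have h3 : A = {l.1, l.2.1, l.2.2} := by simpa using h1
        simp only
        rw [h3]
        exact IsLim_leaf hη hG l h2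
      | none =>
        rw [hf] at h
        simp only at h ⊢
        cases hf2 : circs.find? (fun n => decide (∀ c, n c ≠ 0 → c ∈ A)) with
        | some n =>
          rw [hf2] at h
          simp only at h ⊢
          have h1 := List.find?_some hf2
          have h2 := List.mem_of_find?_eq_some hf2
          exact IsLim_circ hη hG A n h2 (of_decide_eq_true h1) h.1 _ (fun c hc => ih _ (h.2 c hc))
        | none =>
          rw [hf2] at h
          exact h.elim

theorem IsLim_univ {η : ℝ} (hη : 0 < η) {G} (hG : GoodG η G) :
    Tendsto (fun w : ℝ => (w : ℂ) ^ 7 * Jint G Finset.univ w 0 0) (𝓝[>] 0)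
    (𝓝 (G 0 0 0 * (Real.pi ^ 2 / 27))) := by
  have := IsLim_val hη hG 8 _ vok_univ
  unfold IsLim at this
  rw [val_univ] at this
  simp only [Finset.card_univ, Fintype.card_fin] at this
  convert this using 3
  push_cast; ring

end CT


namespace CT
open MeasureTheory

/-- summands of the regularised zeta function -/
noncomputable def hterm (n : ℕ) (z : ℂ) : ℂ :=
  ∫ x in Set.Ioc ((n:ℝ)+1) ((n:ℝ)+2), (((n+1 : ℝ) : ℂ) ^ (-(1+z)) - (x : ℂ) ^ (-(1+z)))

noncomputable def hreg (z : ℂ) : ℂ := ∑' n, hterm n z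

theorem cpow_diff_bd (a : ℝ) (ha : 1 ≤ a) (x : ℝ) (hx : x ∈ Set.Icc a (a+1)) (u : ℂ) (hu : 0 < u.re) :
    ‖(a:ℂ)^(-u) - (x:ℂ)^(-u)‖ ≤ ‖u‖ * a ^ (-u.re - 1) := by
  have h := norm_image_sub_le_of_norm_deriv_le_segment' (f := fun x : ℝ => (x:ℂ)^(-u))
    (f' := fun x : ℝ => (-u) * (x:ℂ)^(-u-1)) (a := a) (b := a+1) (C := ‖u‖ * a ^ (-u.re - 1))
    (fun y hy => by
      have hy0 : 0 < y := by linarith [hy.1]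
      have := (hasDerivAt_ofReal_cpow_const (x := y) hy0.ne' (r := -u) (by
        intro h
        have h2 := congrArg Complex.re h
        simp at h2
        linarith))
      exact this.hasDerivWithinAt) (fun y hy => by
      have hy0 : 0 < y := by linarith [hy.1]
      rw [norm_mul, norm_neg, Complex.norm_cpow_eq_rpow_re_of_pos hy0]
      gcongr ‖u‖ * ?_
      simp only [Complex.sub_re, Complex.neg_re, Complex.one_re]
      exact Real.rpow_le_rpow_of_nonpos (by linarith) hy.1 (by linarith)) x hx
  rw [norm_sub_rev]
  refine h.trans ?_
  have : x - a ≤ 1 := by linarith [hx.2]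
  have h0 : 0 ≤ ‖u‖ * a ^ (-u.re - 1) := by
    have : 0 ≤ a := by linarith
    positivity
  nlinarith [hx.1]

theorem cpow_diff_bd2 (a : ℝ) (ha : 1 ≤ a) (x : ℝ) (hx : x ∈ Set.Icc a (a+1)) (u : ℂ) (hu : 0 < u.re)
    (δ : ℝ) (h0 : 0 ≤ δ) (h1 : δ ≤ 1) :
    ‖(a:ℂ)^(-u) - (x:ℂ)^(-u)‖ ≤ 2 * ‖u‖ ^ δ * a ^ (-u.re - δ) := by
  have ha0 : 0 < a := by linarith
  have hx0 : 0 < x := by linarith [hx.1]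
  have b1 := cpow_diff_bd a ha x hx u hu
  have b2 : ‖(a:ℂ)^(-u) - (x:ℂ)^(-u)‖ ≤ 2 * a ^ (-u.re) := by
    refine (norm_sub_le _ _).trans ?_
    rw [Complex.norm_cpow_eq_rpow_re_of_pos ha0, Complex.norm_cpow_eq_rpow_re_of_pos hx0, two_mul]
    simp only [Complex.neg_re]
    gcongr ?_ + ?_
    · exact le_rfl
    exact Real.rpow_le_rpow_of_nonpos ha0 hx.1 (by linarith)
  set N := ‖(a:ℂ)^(-u) - (x:ℂ)^(-u)‖
  have hN : 0 ≤ N := norm_nonneg _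
  have hu0 : 0 < ‖u‖ := lt_of_lt_of_le hu (Complex.re_le_norm u)
  calc N = N ^ δ * N ^ (1 - δ) := by
        rw [← Real.rpow_add_of_nonneg hN h0 (by linarith)]; simp
    _ ≤ (‖u‖ * a ^ (-u.re - 1)) ^ δ * (2 * a ^ (-u.re)) ^ (1-δ) := by
        gcongr
    _ = 2 ^ (1-δ) * ‖u‖ ^ δ * (a ^ ((-u.re - 1) * δ) * a ^ ((-u.re) * (1-δ))) := by
        rw [Real.mul_rpow (by positivity) (by positivity), Real.mul_rpow (by positivity) (by positivity),
          ← Real.rpow_mul ha0.le, ← Real.rpow_mul ha0.le]; ring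
    _ = 2 ^ (1-δ) * ‖u‖ ^ δ * a ^ (-u.re - δ) := by
        rw [← Real.rpow_add ha0]; congr 2; ring
    _ ≤ _ := by
        gcongr
        calc (2:ℝ)^(1-δ) ≤ 2 ^ (1:ℝ) := Real.rpow_le_rpow_of_exponent_le (by norm_num) (by linarith)
          _ = 2 := by simp

theorem hterm_bd (n : ℕ) (z : ℂ) (δ : ℝ) (h0 : 0 < δ) (h1 : δ ≤ 1) (hz : -(δ/2) < z.re) :
    ‖hterm n z‖ ≤ 2 * ‖1+z‖ ^ δ * ((n:ℝ)+1) ^ (-(1+δ/2)) := by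
  unfold hterm
  have hu : 0 < (1+z).re := by simp; linarith
  have hn : (1:ℝ) ≤ n + 1 := by simp
  have := norm_setIntegral_le_of_norm_le_const (μ := volume) (s := Set.Ioc ((n:ℝ)+1) ((n:ℝ)+2))
    (f := fun x : ℝ => (((n+1 : ℝ) : ℂ) ^ (-(1+z)) - (x : ℂ) ^ (-(1+z))))
    (C := 2 * ‖1+z‖ ^ δ * ((n:ℝ)+1) ^ (-(1+δ/2))) (by simp) (by
      intro x hx
      refine (cpow_diff_bd2 ((n:ℝ)+1) hn x ⟨hx.1.le, by linarith [hx.2]⟩ (1+z) hu δ h0.le h1).trans ?_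
      gcongr 2 * ‖1+z‖ ^ δ * ?_
      apply Real.rpow_le_rpow_of_exponent_le hn
      simp; linarith)
  refine this.trans (le_of_eq ?_)
  simp [Measure.real]
  norm_num

theorem hterm_hol (n : ℕ) (U : Set ℂ) (hU : IsOpen U) (hU1 : ∀ z ∈ U, -1 < z.re) : DifferentiableOn ℂ (hterm n) U := by
  unfold hterm
  have hpos : ∀ x : ℝ, 0 < max x 1 := fun x => lt_max_of_lt_right one_pos
  have hbd : ∀ (y : ℝ) (z : ℂ), 1 ≤ y → -1 < z.re → ‖(y:ℂ) ^ (-(1+z))‖ ≤ 1 := by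
    intro y z hy hz
    rw [Complex.norm_cpow_eq_rpow_re_of_pos (by linarith)]
    apply Real.rpow_le_one_of_one_le_of_nonpos hy
    simp; linarith
  have := hol_int (μ := volume.restrict (Set.Ioc ((n:ℝ)+1) ((n:ℝ)+2)))
    (fun z (x : ℝ) => (((n+1 : ℝ) : ℂ) ^ (-(1+z)) - ((max x 1 : ℝ) : ℂ) ^ (-(1+z)))) U hU ?_ ?_ ?_
  · refine this.congr fun z hz => ?_
    refine setIntegral_congr_fun measurableSet_Ioc fun x hx => ?_
    have : max x 1 = x := max_eq_left (by have h1 := hx.1; have : (0:ℝ) ≤ n := by positivity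
                                          linarith)
    simp only [this]
  · intro x z hz
    have h1 : (((n+1 : ℝ) : ℂ)) ≠ 0 := by exact_mod_cast (by positivity : (n+1:ℝ) ≠ 0)
    have h2 : ((max x 1 : ℝ) : ℂ) ≠ 0 := by exact_mod_cast (hpos x).ne'
    apply DifferentiableAt.differentiableWithinAt
    apply DifferentiableAt.sub
    · exact DifferentiableAt.const_cpow (by fun_prop) (Or.inl h1)
    · exact DifferentiableAt.const_cpow (by fun_prop) (Or.inl h2)
  · intro z hz
    apply Continuous.aestronglyMeasurable
    refine continuous_const.sub ?_
    rw [continuous_iff_continuousAt]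
    intro x
    apply ContinuousAt.cpow (by fun_prop) continuousAt_const
    left
    simp
  · intro z hz
    refine ⟨U, hU.mem_nhds hz, fun _ => 2, integrable_const _, fun t ht x => ?_⟩
    refine (norm_sub_le _ _).trans ?_
    have h1 := hbd ((n:ℝ)+1) t (by simp) (hU1 t ht)
    have h2 := hbd (max x 1) t (le_max_right _ _) (hU1 t ht)
    linarith

theorem summable_nat (δ : ℝ) (h0 : 0 < δ) : Summable (fun n : ℕ => ((n:ℝ)+1) ^ (-(1+δ/2))) := by
  have := (summable_nat_add_iff 1).2 (Real.summable_nat_rpow (p := -(1+δ/2)) |>.2 (by linarith))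
  simpa using this

theorem hreg_bd (δ : ℝ) (h0 : 0 < δ) (h1 : δ ≤ 1) : ∃ C : ℝ, 0 ≤ C ∧ ∀ z : ℂ, -(δ/2) < z.re → ‖hreg z‖ ≤ C * ‖1+z‖^δ := by
  refine ⟨2 * ∑' n : ℕ, ((n:ℝ)+1) ^ (-(1+δ/2)), by positivity, fun z hz => ?_⟩
  have := tsum_of_norm_bounded ((summable_nat δ h0).hasSum.mul_left (2 * ‖1+z‖ ^ δ)) (fun n => hterm_bd n z δ h0 h1 hz)
  refine this.trans (le_of_eq (by ring))

theorem hreg_hol : DifferentiableOn ℂ hreg {z | -(1/2) < z.re} := by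
  intro z hz
  set V := {u : ℂ | -(1/2) < u.re} ∩ Metric.ball z 1
  have hV : IsOpen V := (isOpen_lt continuous_const Complex.continuous_re).inter Metric.isOpen_ball
  have : DifferentiableOn ℂ hreg V := by
    unfold hreg
    refine Complex.differentiableOn_tsum_of_summable_norm (u := fun n : ℕ => 2 * (2 + ‖z‖) * ((n:ℝ)+1) ^ (-(1+(1:ℝ)/2))) 
      ((summable_nat 1 one_pos).mul_left _) (fun n => hterm_hol n V hV (fun u hu => by have : -(1/2) < u.re := hu.1; linarith)) hV ?_
    intro n u hu
    refine (hterm_bd n u 1 one_pos le_rfl hu.1).trans ?_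
    have h2 : ‖u - z‖ < 1 := by simpa [dist_eq_norm] using hu.2
    have h3 : ‖1 + u‖ ≤ 2 + ‖z‖ := by
      calc ‖1+u‖ = ‖1 + (u - z) + z‖ := by ring_nf
        _ ≤ ‖(1:ℂ)‖ + ‖u-z‖ + ‖z‖ := norm_add₃_le
        _ ≤ _ := by simp; linarith
    rw [Real.rpow_one]
    gcongr
  exact (this.differentiableAt (hV.mem_nhds ⟨hz, by simp⟩)).differentiableWithinAt

theorem hterm_eq (n : ℕ) (z : ℂ) (hz : 0 < z.re) :
    hterm n z = 1 / ((n:ℂ)+1) ^ (1+z) - (((n:ℂ)+1) ^ (-z) * z⁻¹ - (((n+1 : ℕ):ℂ)+1) ^ (-z) * z⁻¹) := by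
  have hz0 : z ≠ 0 := by rintro rfl; simp at hz
  have hn : (0:ℝ) ≤ n := by positivity
  unfold hterm
  have hle : (n:ℝ) + 1 ≤ n + 2 := by linarith
  have h0 : (0:ℝ) ∉ Set.uIcc ((n:ℝ)+1) (n+2) := by
    rw [Set.uIcc_of_le hle]
    intro h; have := h.1; linarith
  rw [← intervalIntegral.integral_of_le hle, intervalIntegral.integral_sub (by simp)
    (intervalIntegral.intervalIntegrable_cpow (Or.inr h0)), intervalIntegral.integral_const,
    integral_cpow (Or.inr ⟨by intro h; apply hz0; linear_combination -h, h0⟩)]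
  have e1 : -(1+z) + 1 = -z := by ring
  rw [e1]
  have e2 : ((n:ℝ) + 2 - (n+1)) = 1 := by ring
  rw [e2, one_smul, Complex.cpow_neg]
  push_cast
  rw [show (n:ℂ) + 1 + 1 = n + 2 by ring]
  field_simp
  ring

theorem zeta_hreg (z : ℂ) (hz : 0 < z.re) : riemannZeta (1+z) = z⁻¹ + hreg z := by
  have hs : 1 < (1+z).re := by simpa using hz
  have hz0 : z ≠ 0 := by rintro rfl; simp at hz
  rw [zeta_eq_tsum_one_div_nat_add_one_cpow hs]
  have s1 : Summable (fun n : ℕ => 1 / ((n:ℂ)+1) ^ (1+z)) := by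
    have := (summable_nat_add_iff 1).2 (Complex.summable_one_div_nat_cpow.2 hs)
    simpa using this
  have s2 : Summable (fun n : ℕ => hterm n z) :=
    Summable.of_norm_bounded ((summable_nat 1 one_pos).mul_left (2 * ‖1+z‖ ^ (1:ℝ)))
      (fun n => hterm_bd n z 1 one_pos le_rfl (by linarith))
  have s3 : Summable (fun n : ℕ => (((n:ℂ)+1) ^ (-z) * z⁻¹ - (((n+1 : ℕ):ℂ)+1) ^ (-z) * z⁻¹)) := by
    refine (s1.sub s2).congr fun n => ?_
    rw [hterm_eq n z hz]; ring
  have s4 : HasSum (fun n : ℕ => (((n:ℂ)+1) ^ (-z) * z⁻¹ - (((n+1 : ℕ):ℂ)+1) ^ (-z) * z⁻¹)) z⁻¹ := by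
    rw [s3.hasSum_iff_tendsto_nat]
    have : ∀ N : ℕ, ∑ n ∈ Finset.range N, (((n:ℂ)+1) ^ (-z) * z⁻¹ - (((n+1 : ℕ):ℂ)+1) ^ (-z) * z⁻¹) = z⁻¹ - ((N:ℂ)+1) ^ (-z) * z⁻¹ := by
      intro N
      rw [Finset.sum_range_sub' (fun n : ℕ => ((n:ℂ)+1) ^ (-z) * z⁻¹)]
      simp
    simp_rw [this]
    have ht : Tendsto (fun N : ℕ => ((N:ℂ)+1) ^ (-z)) atTop (𝓝 0) := by
      rw [tendsto_zero_iff_norm_tendsto_zero]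
      have : ∀ N : ℕ, ‖((N:ℂ)+1) ^ (-z)‖ = ((N:ℝ)+1) ^ (-z.re) := by
        intro N
        have := Complex.norm_cpow_eq_rpow_re_of_pos (x := (N:ℝ)+1) (by positivity) (-z)
        simpa using this
      simp_rw [this]
      exact (tendsto_rpow_neg_atTop hz).comp (tendsto_atTop_add_const_right _ _ tendsto_natCast_atTop_atTop)
    have := (ht.mul_const z⁻¹).const_sub z⁻¹
    simpa using this
  have s5 : HasSum (fun n : ℕ => 1 / ((n:ℂ)+1) ^ (1+z)) (z⁻¹ + hreg z) := by
    refine (s4.add s2.hasSum).congr_fun fun n => ?_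
    rw [hterm_eq n z hz]; ring
  exact s5.tsum_eq

end CT


namespace CT
open MeasureTheory

/-- numerator polynomial -/
def Np (X Y Z : ℂ) : ℂ := 1 + X*Y*Z + X^2*Y + X^2*Z + Y^2*X + Y^2*Z + Z^2*X + Z^2*Y + X^2*Y^2*Z^2

def Ep (X Y Z : ℂ) : ℂ := Np X Y Z * (1 - X*Y*Z) * (1 - X^2*Y) * (1 - X^2*Z) * (1 - Y^2*X) *
  (1 - Y^2*Z) * (1 - Z^2*X) * (1 - Z^2*Y)

theorem step_bd {f a m : ℂ} {C k q : ℝ} (hq1 : q ≤ 1) (hC : 0 ≤ C)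
    (h1 : ‖f - 1 - a‖ ≤ C * q^2) (h2 : ‖a‖ ≤ k * q) (h3 : ‖m‖ ≤ q) :
    ‖f * (1 - m) - 1 - (a - m)‖ ≤ (2 * C + k) * q ^ 2 := by
  have hq0 : 0 ≤ q := (norm_nonneg m).trans h3
  have e : f * (1 - m) - 1 - (a - m) = (f - 1 - a) * (1 - m) - a * m := by ring
  rw [e]
  have h4 : ‖1 - m‖ ≤ 2 := by
    refine (norm_sub_le _ _).trans ?_
    simp; linarith
  calc _ ≤ ‖(f - 1 - a) * (1 - m)‖ + ‖a * m‖ := norm_sub_le _ _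
    _ ≤ (C * q^2) * 2 + (k * q) * q := by
      rw [norm_mul, norm_mul]
      gcongr
      exact (norm_nonneg a).trans h2
    _ = _ := by ring

theorem Ep_bd {X Y Z : ℂ} {R : ℝ} (hR : R ≤ 1) (hX : ‖X‖ ≤ R) (hY : ‖Y‖ ≤ R) (hZ : ‖Z‖ ≤ R) :
    ‖Ep X Y Z - 1‖ ≤ 1000 * (R^3)^2 := by
  have hR0 : 0 ≤ R := (norm_nonneg X).trans hX
  set q := R^3 with hq
  have hq0 : 0 ≤ q := by positivity
  have hq1 : q ≤ 1 := pow_le_one₀ hR0 hR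
  have hm : ∀ {A B : ℂ}, ‖A‖ ≤ R → ‖B‖ ≤ R → ‖A^2*B‖ ≤ q := by
    intro A B hA hB
    rw [norm_mul, norm_pow, hq]
    calc ‖A‖^2*‖B‖ ≤ R^2*R := by gcongr
      _ = R^3 := by ring
  have m1 : ‖X*Y*Z‖ ≤ q := by
    rw [norm_mul, norm_mul, hq]
    calc _ ≤ R * R * R := by gcongr
      _ = _ := by ring
  have m2 := hm hX hY
  have m3 := hm hX hZ
  have m4 := hm hY hX
  have m5 := hm hY hZ
  have m6 := hm hZ hX
  have m7 := hm hZ hY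
  unfold Ep Np
  generalize hx1 : X*Y*Z = n1 at *
  have hx : X^2*Y^2*Z^2 = n1^2 := by rw [← hx1]; ring
  rw [hx]
  generalize X^2*Y = n2 at *
  generalize X^2*Z = n3 at *
  generalize Y^2*X = n4 at *
  generalize Y^2*Z = n5 at *
  generalize Z^2*X = n6 at *
  generalize Z^2*Y = n7 at *
  have tri : ∀ {a b : ℂ} {k : ℝ}, ‖a‖ ≤ k * q → ‖b‖ ≤ q → ‖a + b‖ ≤ (k+1) * q := by
    intro a b k ha hb
    have := norm_add_le a b
    linarith
  have s0 : ‖(1 + n1 + n2 + n3 + n4 + n5 + n6 + n7 + n1^2) - 1 - (n1 + n2 + n3 + n4 + n5 + n6 + n7)‖ ≤ 1 * q^2 := by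
    have : (1 + n1 + n2 + n3 + n4 + n5 + n6 + n7 + n1^2) - 1 - (n1 + n2 + n3 + n4 + n5 + n6 + n7) = n1^2 := by ring
    rw [this, norm_pow, one_mul]
    gcongr
  have b7 : ‖n7‖ ≤ 1 * q := by simpa using m7
  have b6 : ‖n6 + n7‖ ≤ 2 * q := by have := norm_add_le n6 n7; linarith
  have b5 : ‖n5 + (n6 + n7)‖ ≤ 3 * q := by have := norm_add_le n5 (n6 + n7); linarith
  have b4 : ‖n4 + (n5 + (n6 + n7))‖ ≤ 4 * q := by have := norm_add_le n4 (n5 + (n6 + n7)); linarith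
  have b3 : ‖n3 + (n4 + (n5 + (n6 + n7)))‖ ≤ 5 * q := by have := norm_add_le n3 (n4 + (n5 + (n6 + n7))); linarith
  have b2 : ‖n2 + (n3 + (n4 + (n5 + (n6 + n7))))‖ ≤ 6 * q := by have := norm_add_le n2 (n3 + (n4 + (n5 + (n6 + n7)))); linarith
  have b1 : ‖n1 + (n2 + (n3 + (n4 + (n5 + (n6 + n7)))))‖ ≤ 7 * q := by have := norm_add_le n1 (n2 + (n3 + (n4 + (n5 + (n6 + n7))))); linarith
  have s1 := step_bd (k := 7) hq1 (by norm_num) s0 (by convert b1 using 2; ring) m1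
  have s2 := step_bd (k := 6) hq1 (by norm_num) s1 (by convert b2 using 2; ring) m2
  have s3 := step_bd (k := 5) hq1 (by norm_num) s2 (by convert b3 using 2; ring) m3
  have s4 := step_bd (k := 4) hq1 (by norm_num) s3 (by convert b4 using 2; ring) m4
  have s5 := step_bd (k := 3) hq1 (by norm_num) s4 (by convert b5 using 2; ring) m5
  have s6 := step_bd (k := 2) hq1 (by norm_num) s5 (by convert b6 using 2; ring) m6
  have s7 := step_bd (k := 1) hq1 (by norm_num) s6 (by convert b7 using 2; ring) m7
  have e : (1 + n1 + n2 + n3 + n4 + n5 + n6 + n7 + n1 ^ 2) * (1 - n1) * (1 - n2) * (1 - n3) * (1 - n4) * (1 - n5) * (1 - n6) * (1 - n7) - 1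
    - (n1 + n2 + n3 + n4 + n5 + n6 + n7 - n1 - n2 - n3 - n4 - n5 - n6 - n7) = (1 + n1 + n2 + n3 + n4 + n5 + n6 + n7 + n1 ^ 2) * (1 - n1) * (1 - n2) * (1 - n3) * (1 - n4) * (1 - n5) * (1 - n6) * (1 - n7) - 1 := by ring
  rw [e] at s7
  refine s7.trans ?_
  gcongr
  norm_num

noncomputable def eps : ℝ := 1/400

/-- local factor at a prime -/
noncomputable def Eloc (p : Nat.Primes) (s : ℂ × ℂ × ℂ) : ℂ :=
  Ep ((p:ℂ)^(-s.1)) ((p:ℂ)^(-s.2.1)) ((p:ℂ)^(-s.2.2))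

noncomputable def EE (s : ℂ × ℂ × ℂ) : ℂ := ∏' p : Nat.Primes, Eloc p s

def SDom : Set (ℂ × ℂ × ℂ) := {s | 1/3 - eps < s.1.re ∧ 1/3 - eps < s.2.1.re ∧ 1/3 - eps < s.2.2.re}

theorem SDom_open : IsOpen SDom := by
  have h1 : IsOpen {s : ℂ × ℂ × ℂ | 1/3 - eps < s.1.re} := isOpen_lt continuous_const (by fun_prop)
  have h2 : IsOpen {s : ℂ × ℂ × ℂ | 1/3 - eps < s.2.1.re} := isOpen_lt continuous_const (by fun_prop)
  have h3 : IsOpen {s : ℂ × ℂ × ℂ | 1/3 - eps < s.2.2.re} := isOpen_lt continuous_const (by fun_prop)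
  exact h1.inter (h2.inter h3)

noncomputable def Eu (p : Nat.Primes) : ℝ := 1000 * ((p:ℕ):ℝ) ^ (-(3/2):ℝ)

theorem Eu_sum : Summable Eu := by
  have : Summable (fun n : ℕ => (n:ℝ) ^ (-(3/2):ℝ)) := Real.summable_nat_rpow.2 (by norm_num)
  exact (this.comp_injective Nat.Primes.coe_nat_injective).mul_left 1000

theorem Eloc_bd (p : Nat.Primes) (s) (hs : s ∈ SDom) : ‖Eloc p s - 1‖ ≤ Eu p := by
  have hp : (1:ℝ) < ((p:ℕ):ℝ) := by exact_mod_cast p.2.one_lt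
  have hp0 : (0:ℝ) < ((p:ℕ):ℝ) := by linarith
  have hb : ∀ z : ℂ, 1/3 - eps < z.re → ‖(p:ℂ)^(-z)‖ ≤ ((p:ℕ):ℝ)^(-(1/3 - eps)) := by
    intro z hz
    have := Complex.norm_cpow_eq_rpow_re_of_pos hp0 (-z)
    rw [Complex.ofReal_natCast] at this
    rw [this]
    apply Real.rpow_le_rpow_of_exponent_le hp.le
    simp; linarith
  have h := Ep_bd (R := ((p:ℕ):ℝ)^(-(1/3 - eps))) ?_ (hb _ hs.1) (hb _ hs.2.1) (hb _ hs.2.2)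
  · refine h.trans ?_
    unfold Eu
    rw [← pow_mul, ← Real.rpow_natCast, ← Real.rpow_mul hp0.le]
    gcongr 1000 * ?_
    apply Real.rpow_le_rpow_of_exponent_le hp.le
    norm_num [eps]
  · apply Real.rpow_le_one_of_one_le_of_nonpos hp.le
    norm_num [eps]

theorem Eloc_cont (p : Nat.Primes) : Continuous (Eloc p) := by
  have hp : ((p:ℕ):ℂ) ≠ 0 := by exact_mod_cast p.2.ne_zero
  have h : ∀ f : ℂ × ℂ × ℂ → ℂ, Continuous f → Continuous (fun s => ((p:ℕ):ℂ) ^ (-f s)) := by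
    intro f hf
    exact Continuous.const_cpow hf.neg (Or.inl hp)
  unfold Eloc Ep Np
  have h1 := h (fun s => s.1) (by fun_prop)
  have h2 := h (fun s => s.2.1) (by fun_prop)
  have h3 := h (fun s => s.2.2) (by fun_prop)
  fun_prop

theorem EE_tlu : HasProdLocallyUniformlyOn Eloc EE SDom := by
  have := Summable.hasProdLocallyUniformlyOn_one_add (f := fun p s => Eloc p s - 1) (K := SDom) SDom_open Eu_sum
    (Eventually.of_forall fun p s hs => Eloc_bd p s hs) (fun p => ((Eloc_cont p).sub continuous_const).continuousOn)
  simp only [add_sub_cancel] at this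
  exact this

theorem EE_hasProd (s) (hs : s ∈ SDom) : HasProd (fun p => Eloc p s) (EE s) := EE_tlu.hasProd hs

theorem EE_cont : ContinuousOn EE SDom := by
  refine TendstoLocallyUniformlyOn.continuousOn (hasProdLocallyUniformlyOn_iff_tendstoLocallyUniformlyOn.1 EE_tlu) ?_
  refine Eventually.frequently (Eventually.of_forall fun F => ?_)
  exact (continuous_finsetProd _ fun p _ => Eloc_cont p).continuousOn

theorem EE_hol (a b : ℂ × ℂ × ℂ) : DifferentiableOn ℂ (fun t : ℂ => EE (a + t • b)) {t | a + t • b ∈ SDom} := by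
  have hc : Continuous (fun t : ℂ => a + t • b) := by fun_prop
  have h1 := (hasProdLocallyUniformlyOn_iff_tendstoLocallyUniformlyOn.1 EE_tlu).comp (fun t : ℂ => a + t • b) (t := {t | a + t • b ∈ SDom})
    (fun t ht => ht) hc.continuousOn
  refine h1.differentiableOn (Eventually.of_forall fun F => ?_) (SDom_open.preimage hc)
  have : ∀ p : Nat.Primes, Differentiable ℂ (fun t : ℂ => Eloc p (a + t • b)) := by
    intro p
    have hp : ((p:ℕ):ℂ) ≠ 0 := by exact_mod_cast p.2.ne_zero
    have h : ∀ f : ℂ → ℂ, Differentiable ℂ f → Differentiable ℂ (fun s => ((p:ℕ):ℂ) ^ (-f s)) := by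
      intro f hf t
      exact DifferentiableAt.const_cpow (hf t).neg (Or.inl hp)
    unfold Eloc Ep Np
    have h1 := h (fun t => (a + t • b).1) (by simp only [Prod.fst_add, Prod.smul_fst]; fun_prop)
    have h2 := h (fun t => (a + t • b).2.1) (by simp only [Prod.fst_add, Prod.smul_fst, Prod.snd_add, Prod.smul_snd]; fun_prop)
    have h3 := h (fun t => (a + t • b).2.2) (by simp only [Prod.snd_add, Prod.smul_snd]; fun_prop)
    fun_prop
  have h3 : Differentiable ℂ (fun t : ℂ => ∏ p ∈ F, Eloc p (a + t • b)) := Differentiable.fun_finsetProd fun p _ => this p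
  exact h3.differentiableOn

theorem EE_bd : ∃ C : ℝ, 0 ≤ C ∧ ∀ s ∈ SDom, ‖EE s‖ ≤ C := by
  refine ⟨Real.exp (∑' p, Eu p), (Real.exp_pos _).le, fun s hs => ?_⟩
  have h := (EE_hasProd s hs).norm
  refine le_of_tendsto h (Eventually.of_forall fun F => ?_)
  have hE : ∀ p, 0 ≤ Eu p := fun p => by unfold Eu; positivity
  calc ∏ p ∈ F, ‖Eloc p s‖ ≤ ∏ p ∈ F, Real.exp (Eu p) := by
        apply Finset.prod_le_prod (fun _ _ => norm_nonneg _)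
        intro p _
        have h1 := Eloc_bd p s hs
        have h2 : ‖Eloc p s‖ ≤ 1 + Eu p := by
          have := norm_add_le (1:ℂ) (Eloc p s - 1)
          simp at this
          linarith
        linarith [Real.add_one_le_exp (Eu p)]
    _ = Real.exp (∑ p ∈ F, Eu p) := (Real.exp_sum _ _).symm
    _ ≤ _ := Real.exp_le_exp.2 (Eu_sum.sum_le_tsum _ (fun p _ => hE p))

end CT


namespace CT
open MeasureTheory

def e1 : Fin 9 → ℕ := ![3,0,0,2,2,1,0,1,0]
def e2 : Fin 9 → ℕ := ![0,3,0,1,0,2,2,0,1]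
def e3 : Fin 9 → ℕ := ![0,0,3,0,1,0,1,2,2]

theorem e_sum : ∀ i, e1 i + e2 i + e3 i = 3 := by decide
theorem e_P : ∀ i, P i = e1 i - e3 i := by decide
theorem e_Q : ∀ i, Q i = e2 i - e3 i := by decide

theorem lam_e (i : Fin 9) (w x y : ℂ) :
    w + lam i x y = e1 i * (w/3 + x) + e2 i * (w/3 + y) + e3 i * (w/3 - x - y) := by
  have h : (e1 i : ℂ) + e2 i + e3 i = 3 := by exact_mod_cast e_sum i
  unfold lam
  rw [e_P, e_Q]
  push_cast
  linear_combination (-w/3) * h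

noncomputable def sv (w x y : ℂ) : ℂ × ℂ × ℂ := (1/3 + w/3 + x, 1/3 + w/3 + y, 1/3 + w/3 - x - y)

theorem sv_mem {w x y : ℂ} (h : (w,x,y) ∈ Dom eps) : sv w x y ∈ SDom := by
  obtain ⟨h1, h2, h3⟩ := h
  simp only at h1 h2 h3
  have e : ∀ z : ℂ, (z/3).re = z.re/3 := fun z => by
    have : z/3 = ((1/3:ℝ):ℂ) * z := by push_cast; ring
    rw [this, Complex.re_ofReal_mul]; ring
  refine ⟨?_, ?_, ?_⟩ <;> simp only [sv, Complex.add_re, Complex.sub_re, e, Complex.one_re] <;> linarith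

theorem lam_re_gt {w x y : ℂ} (h : (w,x,y) ∈ Dom eps) (i) : -(1/108) < (w + lam i x y).re := by
  have hh := sv_mem h
  obtain ⟨h1, h2, h3⟩ := h
  simp only at h1 h2 h3
  have e : ∀ z : ℂ, (z/3).re = z.re/3 := fun z => by
    have : z/3 = ((1/3:ℝ):ℂ) * z := by push_cast; ring
    rw [this, Complex.re_ofReal_mul]; ring
  have n : ∀ (k : ℕ) (z : ℂ), ((k:ℂ) * z).re = k * z.re := fun k z => by simp
  rw [lam_e]
  simp only [Complex.add_re, n, Complex.sub_re, e]
  have hs : (e1 i : ℝ) + e2 i + e3 i = 3 := by exact_mod_cast e_sum i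
  have a1 : (0:ℝ) ≤ e1 i := Nat.cast_nonneg _
  have a2 : (0:ℝ) ≤ e2 i := Nat.cast_nonneg _
  have a3 : (0:ℝ) ≤ e3 i := Nat.cast_nonneg _
  unfold eps at *
  nlinarith [mul_le_mul_of_nonneg_left h1.le a1, mul_le_mul_of_nonneg_left h2.le a2, mul_le_mul_of_nonneg_left h3.le a3]

noncomputable def GB (B : Finset (Fin 9)) (w x y : ℂ) : ℂ :=
  (∏ i ∈ B, hreg (w + lam i x y)) * EE (sv w x y) * (1 + w) *
    ((sv w x y).1 * (sv w x y).2.1 * (sv w x y).2.2)⁻¹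

theorem sdom_norm {z : ℂ} (h : 1/3 - eps < z.re) : 1/4 ≤ ‖z‖ := by
  have := Complex.re_le_norm z
  unfold eps at h
  linarith

theorem sdom_ne {z : ℂ} (h : 1/3 - eps < z.re) : z ≠ 0 := by
  intro h0
  have := sdom_norm h
  rw [h0] at this
  norm_num at this

theorem sv_ne {s : ℂ × ℂ × ℂ} (h : s ∈ SDom) : s.1 * s.2.1 * s.2.2 ≠ 0 :=
  mul_ne_zero (mul_ne_zero (sdom_ne h.1) (sdom_ne h.2.1)) (sdom_ne h.2.2)

theorem sv_cont : Continuous (fun p : ℂ × ℂ × ℂ => sv p.1 p.2.1 p.2.2) := by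
  unfold sv; fun_prop

theorem GB_cont (B) : ContinuousOn (fun p : ℂ × ℂ × ℂ => GB B p.1 p.2.1 p.2.2) (Dom eps) := by
  unfold GB
  have hE : ContinuousOn (fun p : ℂ × ℂ × ℂ => EE (sv p.1 p.2.1 p.2.2)) (Dom eps) :=
    EE_cont.comp sv_cont.continuousOn (fun p hp => sv_mem hp)
  have hs := sv_cont
  refine ((ContinuousOn.mul ?_ hE).mul (by fun_prop)).mul (ContinuousOn.inv₀ (by fun_prop) ?_)
  · refine continuousOn_finsetProd _ fun i _ => ?_
    refine hreg_hol.continuousOn.comp (f := fun p : ℂ × ℂ × ℂ => p.1 + lam i p.2.1 p.2.2) ?_ ?_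
    · unfold lam; fun_prop
    · intro p hp
      have := lam_re_gt (w := p.1) (x := p.2.1) (y := p.2.2) hp i
      simp only [Set.mem_setOf_eq]
      linarith
  · intro p hp
    exact sv_ne (sv_mem hp)

theorem GB_hol (B) (w0 x0 y0 dw dx dy : ℂ) :
    DifferentiableOn ℂ (fun t : ℂ => GB B (w0 + t * dw) (x0 + t * dx) (y0 + t * dy))
      {t | (w0 + t * dw, x0 + t * dx, y0 + t * dy) ∈ Dom eps} := by
  unfold GB
  set b : ℂ × ℂ × ℂ := (dw/3 + dx, dw/3+dy, dw/3-dx-dy) with hb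
  have hsv : ∀ t : ℂ, sv (w0 + t * dw) (x0 + t * dx) (y0 + t * dy) = sv w0 x0 y0 + t • b := by
    intro t
    simp only [sv, hb, Prod.smul_mk, Prod.mk_add_mk, smul_eq_mul]
    refine Prod.ext ?_ (Prod.ext ?_ ?_) <;> simp only <;> ring
  have hE : DifferentiableOn ℂ (fun t : ℂ => EE (sv (w0 + t * dw) (x0 + t * dx) (y0 + t * dy)))
    {t | (w0 + t * dw, x0 + t * dx, y0 + t * dy) ∈ Dom eps} := by
    simp_rw [hsv]
    refine (EE_hol _ b).mono fun t ht => ?_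
    have := sv_mem ht
    rw [hsv] at this
    exact this
  refine ((DifferentiableOn.mul ?_ hE).mul (by fun_prop)).mul (DifferentiableOn.inv ?_ ?_)
  · refine DifferentiableOn.fun_finsetProd fun i _ => ?_
    refine hreg_hol.comp (f := fun t : ℂ => (w0 + t * dw) + lam i (x0 + t * dx) (y0 + t * dy)) ?_ ?_
    · unfold lam; fun_prop
    · intro p hp
      have := lam_re_gt hp i
      simp only [Set.mem_setOf_eq]
      linarith
  · unfold sv; simp only; fun_prop
  · intro p hp
    exact sv_ne (sv_mem hp)

theorem GB_bd (B) (R : ℝ) : ∃ C : ℝ, 0 ≤ C ∧ ∀ w x y : ℂ, (w, x, y) ∈ Dom eps → ‖w‖ ≤ R →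
    ‖GB B w x y‖ ≤ C * rho x.im y.im := by
  obtain ⟨C1, hC1, hh⟩ := hreg_bd (1/54) (by norm_num) (by norm_num)
  obtain ⟨C2, hC2, hE⟩ := EE_bd
  set C0 := max C1 1
  have hC0 : 1 ≤ C0 := le_max_right _ _
  set K := (2 + |R|)^3 with hK
  have hK0 : 0 < K := by positivity
  refine ⟨64 * C0^9 * C2 * (1 + |R|) * (K⁻¹)^(-(5/6):ℝ), by positivity, fun w x y h hw => ?_⟩
  have hs := sv_mem h
  have hR : ‖w‖ ≤ |R| := hw.trans (le_abs_self R)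
  have n1 := sdom_norm hs.1
  have n2 := sdom_norm hs.2.1
  have n3 := sdom_norm hs.2.2
  have h1e : ∀ i, 1 + (w + lam i x y) = e1 i * (sv w x y).1 + e2 i * (sv w x y).2.1 + e3 i * (sv w x y).2.2 := by
    intro i
    have h : (e1 i : ℂ) + e2 i + e3 i = 3 := by exact_mod_cast e_sum i
    rw [lam_e]; simp only [sv]
    linear_combination (-1/3) * h
  have im3 : |(w/3).im| ≤ |R| := by
    refine (Complex.abs_im_le_norm _).trans ?_
    rw [norm_div]; norm_num; linarith [norm_nonneg w]
  have i13 : (1/3:ℂ).im = 0 := by norm_num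
  have low : ∀ (z : ℂ) (t : ℝ), 1/4 ≤ ‖z‖ → |t| ≤ |R| + |z.im| → 1 + |t| ≤ (2 + |R|) * (4 * ‖z‖) := by
    intro z t hz ht
    have := Complex.abs_im_le_norm z
    nlinarith [abs_nonneg R]
  have q1 := low (sv w x y).1 x.im n1 (by
    have e : x.im = (sv w x y).1.im - (w/3).im := by
      simp only [sv, Complex.add_im, i13]; ring
    rw [e]
    exact (abs_sub _ _).trans (by linarith))
  have q2 := low (sv w x y).2.1 y.im n2 (by
    have e : y.im = (sv w x y).2.1.im - (w/3).im := by
      simp only [sv, Complex.add_im, i13]; ring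
    rw [e]
    exact (abs_sub _ _).trans (by linarith))
  have q3 := low (sv w x y).2.2 (x.im + y.im) n3 (by
    have e : x.im + y.im = (w/3).im - (sv w x y).2.2.im := by
      simp only [sv, Complex.add_im, Complex.sub_im, i13]; ring
    rw [e]
    exact (abs_sub _ _).trans (by linarith))
  unfold GB
  have hEE := hE _ hs
  have hz := fun i => lam_re_gt h i
  generalize sv w x y = s at *
  set M := 64 * (‖s.1‖ * ‖s.2.1‖ * ‖s.2.2‖) with hM
  have hM1 : 1 ≤ M := by
    have : (1/4:ℝ) * (1/4) * (1/4) ≤ ‖s.1‖ * ‖s.2.1‖ * ‖s.2.2‖ := by gcongr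
    linarith
  have hM0 : 0 < M := by linarith
  have b12 : (1/16:ℝ) ≤ ‖s.1‖ * ‖s.2.1‖ := by nlinarith
  have b13 : (1/16:ℝ) ≤ ‖s.1‖ * ‖s.2.2‖ := by nlinarith
  have b23 : (1/16:ℝ) ≤ ‖s.2.1‖ * ‖s.2.2‖ := by nlinarith
  have m1 : 4 * ‖s.1‖ ≤ M := by nlinarith
  have m2 : 4 * ‖s.2.1‖ ≤ M := by nlinarith
  have m3 : 4 * ‖s.2.2‖ ≤ M := by nlinarith
  have hreg1 : ∀ i, ‖hreg (w + lam i x y)‖ ≤ C0 * M^(1/54:ℝ) := by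
    intro i
    refine (hh _ (by linarith [hz i])).trans ?_
    have : ‖1 + (w + lam i x y)‖ ≤ M := by
      rw [h1e]
      have a1 : (0:ℝ) ≤ e1 i := Nat.cast_nonneg _
      have a2 : (0:ℝ) ≤ e2 i := Nat.cast_nonneg _
      have a3 : (0:ℝ) ≤ e3 i := Nat.cast_nonneg _
      have hs : (e1 i : ℝ) + e2 i + e3 i = 3 := by exact_mod_cast e_sum i
      have := norm_add₃_le (a := e1 i * s.1) (b := e2 i * s.2.1) (c := e3 i * s.2.2)
      simp only [norm_mul, Complex.norm_natCast] at this
      refine this.trans ?_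
      have t1 : ‖s.1‖ ≤ M/4 := by linarith
      have t2 : ‖s.2.1‖ ≤ M/4 := by linarith
      have t3 : ‖s.2.2‖ ≤ M/4 := by linarith
      calc _ ≤ (e1 i:ℝ) * (M/4) + e2 i * (M/4) + e3 i * (M/4) := by gcongr
        _ = (e1 i + e2 i + e3 i : ℝ) * (M/4) := by ring
        _ ≤ M := by rw [hs]; linarith
    gcongr
    exact le_max_left _ _
  have hX1 : 1 ≤ C0 * M^(1/54:ℝ) := one_le_mul_of_one_le_of_one_le hC0 (Real.one_le_rpow hM1 (by norm_num))
  have hprod : ‖∏ i ∈ B, hreg (w + lam i x y)‖ ≤ C0^9 * M^(1/6:ℝ) := by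
    rw [norm_prod]
    calc _ ≤ ∏ i ∈ B, (C0 * M^(1/54:ℝ)) := Finset.prod_le_prod (fun _ _ => norm_nonneg _) fun i _ => hreg1 i
      _ = (C0 * M^(1/54:ℝ))^B.card := by simp
      _ ≤ (C0 * M^(1/54:ℝ))^9 := pow_le_pow_right₀ hX1 (by simpa using Finset.card_le_univ B)
      _ = _ := by
        rw [mul_pow, ← Real.rpow_natCast (M^(1/54:ℝ)), ← Real.rpow_mul hM0.le]; norm_num
  have h1w : ‖1 + w‖ ≤ 1 + |R| := (norm_add_le _ _).trans (by simpa using hR)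
  have hinv : ‖(s.1 * s.2.1 * s.2.2)⁻¹‖ = 64 * M⁻¹ := by
    rw [norm_inv, norm_mul, norm_mul, hM, mul_inv]; ring
  have hlow : K⁻¹ * ((1+|x.im|)*(1+|y.im|)*(1+|x.im+y.im|)) ≤ M := by
    rw [inv_mul_le_iff₀ hK0]
    calc _ ≤ ((2 + |R|) * (4 * ‖s.1‖)) * ((2 + |R|) * (4 * ‖s.2.1‖)) * ((2 + |R|) * (4 * ‖s.2.2‖)) := by gcongr
      _ = _ := by rw [hK, hM]; ring
  have hfin : M^(-(5/6):ℝ) ≤ (K⁻¹)^(-(5/6):ℝ) * rho x.im y.im := by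
    have hD : 0 < (1+|x.im|)*(1+|y.im|)*(1+|x.im+y.im|) := by positivity
    refine (Real.rpow_le_rpow_of_nonpos (by positivity) hlow (by norm_num)).trans ?_
    rw [Real.mul_rpow (by positivity) hD.le]
    gcongr
    exact prod_le_rho _ _
  have hMM : M^(1/6:ℝ) * M⁻¹ = M^(-(5/6):ℝ) := by
    rw [← Real.rpow_neg_one, ← Real.rpow_add hM0]; norm_num
  rw [norm_mul, norm_mul, norm_mul, hinv]
  calc _ ≤ (C0^9 * M^(1/6:ℝ)) * C2 * (1 + |R|) * (64 * M⁻¹) := by gcongr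
    _ = 64 * C0^9 * C2 * (1 + |R|) * (M^(1/6:ℝ) * M⁻¹) := by ring
    _ ≤ 64 * C0^9 * C2 * (1 + |R|) * ((K⁻¹)^(-(5/6):ℝ) * rho x.im y.im) := by rw [hMM]; gcongr
    _ = _ := by ring

theorem GB_good (B) : GoodG eps (GB B) := ⟨GB_hol B, GB_cont B, GB_bd B⟩

end CT


namespace CT
open MeasureTheory

/-- complete homogeneous polynomials -/
noncomputable def hom3 (X Y Z : ℂ) (n : ℕ) : ℂ :=
  ∑ kl ∈ Finset.HasAntidiagonal.antidiagonal n, X ^ kl.1 * ∑ ij ∈ Finset.HasAntidiagonal.antidiagonal kl.2, Y ^ ij.1 * Z ^ ij.2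

theorem hom3_sum {X Y Z : ℂ} (hX : ‖X‖ < 1) (hY : ‖Y‖ < 1) (hZ : ‖Z‖ < 1) :
    Summable (fun n => ‖hom3 X Y Z n‖) ∧ HasSum (hom3 X Y Z) ((1-X)⁻¹ * ((1-Y)⁻¹ * (1-Z)⁻¹)) := by
  have g : ∀ {W : ℂ}, ‖W‖ < 1 → Summable (fun n => ‖W ^ n‖) := by
    intro W hW
    simp only [norm_pow]
    exact summable_geometric_of_lt_one (norm_nonneg _) hW
  have h1 := summable_norm_sum_mul_antidiagonal_of_summable_norm (g hY) (g hZ)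
  have h2 := summable_norm_sum_mul_antidiagonal_of_summable_norm (g hX) h1
  have t1 := tsum_mul_tsum_eq_tsum_sum_antidiagonal_of_summable_norm (g hY) (g hZ)
  have t2 := tsum_mul_tsum_eq_tsum_sum_antidiagonal_of_summable_norm (g hX) h1
  refine ⟨h2, ?_⟩
  have := h2.of_norm.hasSum
  rw [← t2, ← t1, tsum_geometric_of_norm_lt_one hX, tsum_geometric_of_norm_lt_one hY,
    tsum_geometric_of_norm_lt_one hZ] at this
  exact this

theorem hom3_scale (X Y Z w : ℂ) (n : ℕ) : hom3 (w*X) (w*Y) (w*Z) n = w^n * hom3 X Y Z n := by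
  unfold hom3
  rw [Finset.mul_sum]
  refine Finset.sum_congr rfl fun kl hkl => ?_
  rw [Finset.HasAntidiagonal.mem_antidiagonal] at hkl
  rw [← hkl, pow_add, mul_pow]
  have : ∑ ij ∈ Finset.HasAntidiagonal.antidiagonal kl.2, (w*Y) ^ ij.1 * (w*Z) ^ ij.2 =
      w ^ kl.2 * ∑ ij ∈ Finset.HasAntidiagonal.antidiagonal kl.2, Y ^ ij.1 * Z ^ ij.2 := by
    rw [Finset.mul_sum]
    refine Finset.sum_congr rfl fun ij hij => ?_
    rw [Finset.HasAntidiagonal.mem_antidiagonal] at hij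
    rw [← hij, pow_add, mul_pow, mul_pow]; ring
  rw [this]; ring

theorem exists_omega : ∃ w : ℂ, w^2 + w + 1 = 0 ∧ ‖w‖ = 1 := by
  have h := Complex.isPrimitiveRoot_exp 3 (by norm_num)
  set w := Complex.exp (2 * Real.pi * Complex.I / (3:ℕ))
  have h3 : w^3 = 1 := h.pow_eq_one
  have h1 : w ≠ 1 := h.ne_one (by norm_num)
  refine ⟨w, ?_, ?_⟩
  · have : (w - 1) * (w^2 + w + 1) = 0 := by linear_combination h3
    exact (mul_eq_zero.1 this).resolve_left (sub_ne_zero.2 h1)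
  · exact Complex.norm_eq_one_of_pow_eq_one h3 (by norm_num)

theorem one_sub_ne {X : ℂ} (hX : ‖X‖ < 1) : 1 - X ≠ 0 := by
  intro h
  have : X = 1 := by linear_combination -h
  rw [this] at hX; simp at hX

theorem local_sum {X Y Z : ℂ} (hX : ‖X‖ < 1) (hY : ‖Y‖ < 1) (hZ : ‖Z‖ < 1) :
    Summable (fun n => ‖hom3 X Y Z (3*n)‖) ∧
    HasSum (fun n => hom3 X Y Z (3*n)) (Np X Y Z * ((1-X^3) * (1-Y^3) * (1-Z^3))⁻¹) := by
  obtain ⟨w, hw, hwn⟩ := exists_omega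
  have h3inj : Function.Injective (fun n : ℕ => 3 * n) := fun a b h => by simpa using h
  refine ⟨(hom3_sum hX hY hZ).1.comp_injective h3inj, ?_⟩
  have hw3 : w^3 = 1 := by linear_combination (w - 1) * hw
  have nn : ∀ {v A : ℂ}, ‖v‖ = 1 → ‖A‖ < 1 → ‖v * A‖ < 1 := by
    intro v A hv hA; rw [norm_mul, hv, one_mul]; exact hA
  have hwn2 : ‖w^2‖ = 1 := by rw [norm_pow, hwn, one_pow]
  have s0 := (hom3_sum hX hY hZ).2
  have s1 := (hom3_sum (nn hwn hX) (nn hwn hY) (nn hwn hZ)).2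
  have s2 := (hom3_sum (nn hwn2 hX) (nn hwn2 hY) (nn hwn2 hZ)).2
  have ss := ((s0.add s1).add s2).div_const 3
  have hsupp : ∀ n, n ∉ Set.range (fun n : ℕ => 3 * n) →
      (hom3 X Y Z n + hom3 (w*X) (w*Y) (w*Z) n + hom3 (w^2*X) (w^2*Y) (w^2*Z) n) / 3 = 0 := by
    intro n hn
    rw [hom3_scale, hom3_scale]
    have hmod : n % 3 = 1 ∨ n % 3 = 2 := by
      by_contra hc
      exact hn ⟨n / 3, by simp only; omega⟩
    have hz : 1 + w^n + (w^2)^n = 0 := by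
      rw [← pow_mul, mul_comm 2 n, pow_mul, ← Nat.div_add_mod n 3, pow_add, pow_mul, hw3, one_pow, one_mul]
      rcases hmod with h | h <;> rw [h]
      · linear_combination hw
      · linear_combination (w^2 - w + 1) * hw
    linear_combination (hom3 X Y Z n / 3) * hz
  have key := (h3inj.hasSum_iff hsupp).2 ss
  have hfun : (fun n => (hom3 X Y Z n + hom3 (w*X) (w*Y) (w*Z) n + hom3 (w^2*X) (w^2*Y) (w^2*Z) n) / 3) ∘
      (fun n : ℕ => 3 * n) = fun n => hom3 X Y Z (3*n) := by
    funext n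
    simp only [Function.comp]
    have h1 : w^(3*n) = 1 := by rw [pow_mul, hw3, one_pow]
    have h2 : (w^2)^(3*n) = 1 := by rw [← pow_mul, mul_comm, pow_mul, h1, one_pow]
    rw [hom3_scale, hom3_scale, h1, h2]
    ring
  rw [hfun] at key
  convert key using 1
  have f : ∀ A : ℂ, (1 - A) * (1 - w*A) * (1 - w^2*A) = 1 - A^3 := by
    intro A; linear_combination (A^2*w - A^2*1 + A^2 - A - A^3*(w-1)) * hw
  have n0X := one_sub_ne hX
  have n0Y := one_sub_ne hY
  have n0Z := one_sub_ne hZ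
  have n1X := one_sub_ne (nn hwn hX)
  have n1Y := one_sub_ne (nn hwn hY)
  have n1Z := one_sub_ne (nn hwn hZ)
  have n2X := one_sub_ne (nn hwn2 hX)
  have n2Y := one_sub_ne (nn hwn2 hY)
  have n2Z := one_sub_ne (nn hwn2 hZ)
  rw [← f X, ← f Y, ← f Z]
  have d1 : (1 - w*X)*((1 - w*Y)*(1-w*Z)) = 1 - w*(X+Y+Z) + w^2*(X*Y+X*Z+Y*Z) - X*Y*Z := by
    linear_combination (-X*Y*Z) * hw3
  have d2 : (1 - w^2*X)*((1 - w^2*Y)*(1-w^2*Z)) = 1 - w^2*(X+Y+Z) + w*(X*Y+X*Z+Y*Z) - X*Y*Z := by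
    linear_combination (-X*Y*Z*(w^3+1) + w*(X*Y+X*Z+Y*Z)) * hw3
  have d12 : ∀ A : ℂ, (1 - w*A)*(1-w^2*A) = 1 + A + A^2 := by
    intro A; linear_combination (-A) * hw + A^2 * hw3
  have hN : 3 * Np X Y Z = ((1 - w*X)*((1 - w*Y)*(1-w*Z))) * ((1 - w^2*X)*((1 - w^2*Y)*(1-w^2*Z))) +
      ((1-X)*((1-Y)*(1-Z))) * ((1 - w^2*X)*((1 - w^2*Y)*(1-w^2*Z)) + (1 - w*X)*((1 - w*Y)*(1-w*Z))) := by
    have a : ((1 - w*X)*((1 - w*Y)*(1-w*Z))) * ((1 - w^2*X)*((1 - w^2*Y)*(1-w^2*Z))) =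
      (1 + X + X^2) * (1+Y+Y^2) * (1+Z+Z^2) := by
      rw [← d12, ← d12, ← d12]; ring
    rw [a, d1, d2]
    unfold Np
    linear_combination ((1-X)*((1-Y)*(1-Z))) * (X+Y+Z - (X*Y+X*Z+Y*Z)) * hw
  have hNp : Np X Y Z = (((1 - w*X)*((1 - w*Y)*(1-w*Z))) * ((1 - w^2*X)*((1 - w^2*Y)*(1-w^2*Z))) +
      ((1-X)*((1-Y)*(1-Z))) * ((1 - w^2*X)*((1 - w^2*Y)*(1-w^2*Z)) + (1 - w*X)*((1 - w*Y)*(1-w*Z)))) / 3 := by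
    rw [← hN]; ring
  rw [hNp]
  generalize 1 - w*X = a1 at *
  generalize 1 - w*Y = a2 at *
  generalize 1 - w*Z = a3 at *
  generalize 1 - w^2*X = b1 at *
  generalize 1 - w^2*Y = b2 at *
  generalize 1 - w^2*Z = b3 at *
  generalize 1 - X = c1 at *
  generalize 1 - Y = c2 at *
  generalize 1 - Z = c3 at *
  field_simp
  ring

/-- power function as arithmetic function -/
noncomputable def gpow (s : ℂ) : ArithmeticFunction ℂ := ⟨fun n => if n = 0 then 0 else (n:ℂ)^(-s), by simp⟩

theorem gpow_apply (s : ℂ) {n : ℕ} (h : n ≠ 0) : gpow s n = (n:ℂ)^(-s) := by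
  simp [gpow, h]

theorem gpow_mult (s : ℂ) : (gpow s).IsMultiplicative := by
  rw [ArithmeticFunction.IsMultiplicative.iff_ne_zero]
  refine ⟨by simp [gpow], fun {m n} hm hn _ => ?_⟩
  rw [gpow_apply s hm, gpow_apply s hn, gpow_apply s (mul_ne_zero hm hn)]
  push_cast
  exact Complex.natCast_mul_natCast_cpow m n (-s)

noncomputable def conv3 (s : ℂ × ℂ × ℂ) : ArithmeticFunction ℂ := gpow s.1 * (gpow s.2.1 * gpow s.2.2)

theorem conv3_mult (s) : (conv3 s).IsMultiplicative := (gpow_mult _).mul ((gpow_mult _).mul (gpow_mult _))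

noncomputable def fcube (s : ℂ × ℂ × ℂ) (u : ℕ) : ℂ := conv3 s (u^3)

theorem fcube_zero (s) : fcube s 0 = 0 := by simp [fcube]
theorem fcube_one (s) : fcube s 1 = 1 := by simp [fcube, (conv3_mult s).1]
theorem fcube_mul (s) {m n : ℕ} (h : Nat.Coprime m n) : fcube s (m*n) = fcube s m * fcube s n := by
  unfold fcube
  rw [mul_pow, (conv3_mult s).map_mul_of_coprime (Nat.Coprime.pow 3 3 h)]

theorem conv_prime_pow (f g : ArithmeticFunction ℂ) {p : ℕ} (hp : p.Prime) (n : ℕ) :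
    (f * g) (p^n) = ∑ kl ∈ Finset.HasAntidiagonal.antidiagonal n, f (p^kl.1) * g (p^kl.2) := by
  rw [ArithmeticFunction.mul_apply, Nat.sum_divisorsAntidiagonal (f := fun a b => f a * g b),
    Nat.sum_divisors_prime_pow hp, Finset.Nat.sum_antidiagonal_eq_sum_range_succ (f := fun a b => f (p^a) * g (p^b))]
  refine Finset.sum_congr rfl fun k hk => ?_
  rw [Nat.pow_div (by simpa [Nat.lt_succ_iff] using hk) hp.pos]

theorem gpow_prime_pow (s : ℂ) {p : ℕ} (hp : p.Prime) (n : ℕ) : gpow s (p^n) = ((p:ℂ)^(-s))^n := by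
  rw [gpow_apply s (pow_ne_zero _ hp.ne_zero)]
  push_cast
  rw [← Complex.natCast_cpow_natCast_mul, ← Complex.cpow_mul_nat, mul_comm]

theorem fcube_prime_pow (s : ℂ × ℂ × ℂ) {p : ℕ} (hp : p.Prime) (n : ℕ) :
    fcube s (p^n) = hom3 ((p:ℂ)^(-s.1)) ((p:ℂ)^(-s.2.1)) ((p:ℂ)^(-s.2.2)) (3*n) := by
  unfold fcube conv3 hom3
  rw [← pow_mul, mul_comm n 3, conv_prime_pow _ _ hp]
  refine Finset.sum_congr rfl fun kl _ => ?_
  rw [conv_prime_pow _ _ hp, gpow_prime_pow _ hp]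
  congr 1
  refine Finset.sum_congr rfl fun ij _ => ?_
  rw [gpow_prime_pow _ hp, gpow_prime_pow _ hp]

end CT


namespace CT
open MeasureTheory

def tri (u : ℕ) : Finset (ℕ × ℕ × ℕ) :=
  ((u^3).divisors ×ˢ ((u^3).divisors ×ˢ (u^3).divisors)).filter (fun x => x.1 * x.2.1 * x.2.2 = u^3)

theorem mem_tri {u : ℕ} {x : ℕ × ℕ × ℕ} : x ∈ tri u ↔ u ≠ 0 ∧ x.1 * x.2.1 * x.2.2 = u^3 := by
  unfold tri
  simp only [Finset.mem_filter, Finset.mem_product, Nat.mem_divisors]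
  constructor
  · rintro ⟨⟨h, -⟩, h2⟩
    exact ⟨fun h0 => h.2 (by simp [h0]), h2⟩
  · rintro ⟨h, h2⟩
    have h3 : u^3 ≠ 0 := pow_ne_zero _ h
    refine ⟨⟨⟨?_, h3⟩, ⟨?_, h3⟩, ?_, h3⟩, h2⟩ <;> rw [← h2]
    · exact ⟨x.2.1 * x.2.2, by ring⟩
    · exact ⟨x.1 * x.2.2, by ring⟩
    · exact ⟨x.1 * x.2.1, by ring⟩

theorem tri_ne {u : ℕ} {x : ℕ × ℕ × ℕ} (h : x ∈ tri u) : x.1 ≠ 0 ∧ x.2.1 ≠ 0 ∧ x.2.2 ≠ 0 := by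
  obtain ⟨h1, h2⟩ := mem_tri.1 h
  have h3 : x.1 * x.2.1 * x.2.2 ≠ 0 := by rw [h2]; exact pow_ne_zero _ h1
  refine ⟨?_, ?_, ?_⟩ <;> intro h0 <;> simp [h0] at h3

noncomputable def mon (s : ℂ × ℂ × ℂ) (x : ℕ × ℕ × ℕ) : ℂ :=
  (x.1 : ℂ)^(-s.1) * (x.2.1 : ℂ)^(-s.2.1) * (x.2.2 : ℂ)^(-s.2.2)

theorem fcube_eq (s) (u : ℕ) : fcube s u = ∑ x ∈ tri u, mon s x := by
  unfold fcube conv3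
  rw [ArithmeticFunction.mul_apply]
  simp_rw [ArithmeticFunction.mul_apply, Finset.mul_sum]
  rw [Finset.sum_sigma']
  refine Finset.sum_bij' (fun a _ => (a.1.1, a.2.1, a.2.2)) (fun x _ => ⟨(x.1, x.2.1*x.2.2), (x.2.1, x.2.2)⟩) ?_ ?_ ?_ ?_ ?_
  · rintro ⟨⟨a, m⟩, ⟨b, c⟩⟩ h
    simp only [Finset.mem_sigma, Nat.mem_divisorsAntidiagonal] at h
    obtain ⟨⟨h1, h2⟩, h3, h4⟩ := h
    rw [mem_tri]
    refine ⟨fun h0 => h2 (by simp [h0]), ?_⟩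
    simp only
    rw [← h1, ← h3]; ring
  · rintro x h
    have hn := tri_ne h
    obtain ⟨h1, h2⟩ := mem_tri.1 h
    simp only [Finset.mem_sigma, Nat.mem_divisorsAntidiagonal]
    exact ⟨⟨by rw [← h2]; ring, pow_ne_zero _ h1⟩, by trivial, mul_ne_zero hn.2.1 hn.2.2⟩
  · rintro ⟨⟨a, m⟩, ⟨b, c⟩⟩ h
    simp only [Finset.mem_sigma, Nat.mem_divisorsAntidiagonal] at h
    obtain ⟨-, h3, -⟩ := h
    simp only [h3]
  · rintro x h
    rfl
  · rintro ⟨⟨a, m⟩, ⟨b, c⟩⟩ h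
    simp only [Finset.mem_sigma, Nat.mem_divisorsAntidiagonal] at h
    obtain ⟨⟨h1, h2⟩, h3, h4⟩ := h
    have ha : a ≠ 0 := by rintro rfl; simp at h1; exact h2 (by simp [← h1])
    have hb : b ≠ 0 := by rintro rfl; simp at h3; exact h4 h3.symm
    have hc : c ≠ 0 := by rintro rfl; simp at h3; exact h4 h3.symm
    simp only [mon, gpow_apply _ ha, gpow_apply _ hb, gpow_apply _ hc]
    ring

def TDom : Set (ℂ × ℂ × ℂ) := {s | 1/3 < s.1.re ∧ 1/3 < s.2.1.re ∧ 1/3 < s.2.2.re}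

def reC (s : ℂ × ℂ × ℂ) : ℂ × ℂ × ℂ := ((s.1.re : ℂ), (s.2.1.re : ℂ), (s.2.2.re : ℂ))

noncomputable def fr (s : ℂ × ℂ × ℂ) (u : ℕ) : ℝ := ∑ x ∈ tri u, ‖mon s x‖

theorem fr_nonneg (s : ℂ × ℂ × ℂ) (u : ℕ) : 0 ≤ fr s u := Finset.sum_nonneg fun _ _ => norm_nonneg _

theorem cpow_re {n : ℕ} (hn : n ≠ 0) (z : ℂ) : ((n:ℂ)^(-(z.re:ℂ))) = ((‖(n:ℂ)^(-z)‖ : ℝ) : ℂ) := by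
  rw [Complex.norm_natCast_cpow_of_pos (Nat.pos_of_ne_zero hn), Complex.ofReal_cpow (Nat.cast_nonneg n)]
  simp

theorem fcube_reC (s u) : fcube (reC s) u = (fr s u : ℂ) := by
  rw [fcube_eq, fr]
  push_cast
  refine Finset.sum_congr rfl fun x hx => ?_
  obtain ⟨h1, h2, h3⟩ := tri_ne hx
  simp only [mon, reC, cpow_re h1, cpow_re h2, cpow_re h3, norm_mul]
  push_cast
  ring

theorem p_norm_lt {p : ℕ} (hp : p.Prime) {z : ℂ} (hz : 0 < z.re) : ‖(p:ℂ)^(-z)‖ < 1 := by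
  rw [Complex.norm_natCast_cpow_of_pos hp.pos]
  apply Real.rpow_lt_one_of_one_lt_of_neg (by exact_mod_cast hp.one_lt)
  simpa using hz

theorem fcube_local (s) (hs : s ∈ TDom) {p : ℕ} (hp : p.Prime) :
    Summable (fun n => ‖fcube s (p^n)‖) ∧
    ∑' n, fcube s (p^n) = Np ((p:ℂ)^(-s.1)) ((p:ℂ)^(-s.2.1)) ((p:ℂ)^(-s.2.2)) *
      ((1-((p:ℂ)^(-s.1))^3) * (1-((p:ℂ)^(-s.2.1))^3) * (1-((p:ℂ)^(-s.2.2))^3))⁻¹ := by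
  have h := local_sum (p_norm_lt hp (z := s.1) (by linarith [hs.1])) (p_norm_lt hp (z := s.2.1) (by linarith [hs.2.1]))
    (p_norm_lt hp (z := s.2.2) (by linarith [hs.2.2]))
  simp_rw [fcube_prime_pow s hp]
  exact ⟨h.1, h.2.tsum_eq⟩

theorem local_bd {X Y Z : ℂ} {R : ℝ} (hR : R ≤ 1) (hR3 : R^3 ≤ 1/2) (hX : ‖X‖ ≤ R) (hY : ‖Y‖ ≤ R) (hZ : ‖Z‖ ≤ R) :
    ‖Np X Y Z * ((1-X^3) * (1-Y^3) * (1-Z^3))⁻¹‖ ≤ Real.exp (14 * R^3) := by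
  have hR0 : 0 ≤ R := (norm_nonneg X).trans hX
  have hm : ∀ {A B : ℂ}, ‖A‖ ≤ R → ‖B‖ ≤ R → ‖A^2*B‖ ≤ R^3 := by
    intro A B hA hB
    rw [norm_mul, norm_pow]
    calc ‖A‖^2*‖B‖ ≤ R^2*R := by gcongr
      _ = R^3 := by ring
  have m1 : ‖X*Y*Z‖ ≤ R^3 := by
    rw [norm_mul, norm_mul]
    calc _ ≤ R * R * R := by gcongr
      _ = _ := by ring
  have m2 := hm hX hY
  have m3 := hm hX hZ
  have m4 := hm hY hX
  have m5 := hm hY hZ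
  have m6 := hm hZ hX
  have m7 := hm hZ hY
  have m8 : ‖X^2*Y^2*Z^2‖ ≤ R^3 := by
    have : X^2*Y^2*Z^2 = (X*Y*Z)*(X*Y*Z) := by ring
    rw [this, norm_mul]
    have := norm_nonneg (X*Y*Z)
    nlinarith
  have hN : ‖Np X Y Z‖ ≤ 1 + 8 * R^3 := by
    unfold Np
    have t1 := norm_add_le (1:ℂ) (X*Y*Z)
    have t2 := norm_add_le (1 + X*Y*Z) (X^2*Y)
    have t3 := norm_add_le (1 + X*Y*Z + X^2*Y) (X^2*Z)
    have t4 := norm_add_le (1 + X*Y*Z + X^2*Y + X^2*Z) (Y^2*X)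
    have t5 := norm_add_le (1 + X*Y*Z + X^2*Y + X^2*Z + Y^2*X) (Y^2*Z)
    have t6 := norm_add_le (1 + X*Y*Z + X^2*Y + X^2*Z + Y^2*X + Y^2*Z) (Z^2*X)
    have t7 := norm_add_le (1 + X*Y*Z + X^2*Y + X^2*Z + Y^2*X + Y^2*Z + Z^2*X) (Z^2*Y)
    have t8 := norm_add_le (1 + X*Y*Z + X^2*Y + X^2*Z + Y^2*X + Y^2*Z + Z^2*X + Z^2*Y) (X^2*Y^2*Z^2)
    rw [norm_one] at t1
    linarith
  have hi : ∀ {A : ℂ}, ‖A‖ ≤ R → ‖(1 - A^3)⁻¹‖ ≤ Real.exp (2 * R^3) := by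
    intro A hA
    have h3 : ‖A^3‖ ≤ R^3 := by rw [norm_pow]; gcongr
    have h1 : 1 - R^3 ≤ ‖1 - A^3‖ := by
      have := norm_sub_norm_le (1:ℂ) (A^3)
      rw [norm_one] at this; linarith
    have h0 : 0 < 1 - R^3 := by linarith
    have hpos : 0 ≤ R^3 := by positivity
    rw [norm_inv]
    calc _ ≤ (1 - R^3)⁻¹ := by gcongr
      _ ≤ 1 + 2 * R^3 := by
        rw [inv_le_iff_one_le_mul₀ h0]; nlinarith
      _ ≤ _ := by linarith [Real.add_one_le_exp (2*R^3)]
  rw [norm_mul, mul_inv, mul_inv, norm_mul, norm_mul]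
  calc _ ≤ Real.exp (8 * R^3) * (Real.exp (2 * R^3) * Real.exp (2 * R^3) * Real.exp (2 * R^3)) := by
        have := hi hX
        have := hi hY
        have := hi hZ
        have : ‖Np X Y Z‖ ≤ Real.exp (8 * R^3) := by linarith [Real.add_one_le_exp (8*R^3)]
        gcongr
    _ = _ := by
      rw [← Real.exp_add, ← Real.exp_add, ← Real.exp_add]; ring_nf

theorem reC_mem {s} (hs : s ∈ TDom) : reC s ∈ TDom := by
  simpa [TDom, reC] using hs

theorem fr_summable (s) (hs : s ∈ TDom) : Summable (fr s) := by
  set σ := min s.1.re (min s.2.1.re s.2.2.re) with hσ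
  have hσ3 : 1/3 < σ := lt_min hs.1 (lt_min hs.2.1 hs.2.2)
  set τ := 3 * σ with hτ
  have hτ1 : 1 < τ := by linarith
  have hsum : Summable (fun n : ℕ => (n:ℝ)^(-τ)) := Real.summable_nat_rpow.2 (by linarith)
  refine summable_of_sum_range_le (c := Real.exp (14 * ∑' n : ℕ, (n:ℝ)^(-τ))) (fr_nonneg s) fun N => ?_
  have hE := EulerProduct.summable_and_hasSum_smoothNumbers_prod_primesBelow_tsum (f := fcube (reC s))
    (fcube_one _) (fcube_mul _) (fun hp => (fcube_local _ (reC_mem hs) hp).1) N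
  have h1 : Summable (fun m : N.smoothNumbers => fr s m) := by
    refine hE.1.congr fun m => ?_
    rw [fcube_reC, Complex.norm_real, Real.norm_of_nonneg (fr_nonneg _ _)]
  have h2 : ((∑' m : N.smoothNumbers, fr s m : ℝ) : ℂ) = ∏ p ∈ N.primesBelow, ∑' n : ℕ, fcube (reC s) (p ^ n) := by
    rw [← hE.2.tsum_eq, Complex.ofReal_tsum]
    simp_rw [fcube_reC]
  have h3 : ∑ n ∈ Finset.range N, fr s n ≤ ∑' m : N.smoothNumbers, fr s m := by
    rw [tsum_subtype (N.smoothNumbers) (fr s)]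
    have hind : Summable (Set.indicator N.smoothNumbers (fr s)) := summable_subtype_iff_indicator.1 h1
    refine le_trans (le_of_eq ?_) (hind.sum_le_tsum (Finset.range N) fun i _ => Set.indicator_nonneg (fun _ _ => fr_nonneg _ _) _)
    refine Finset.sum_congr rfl fun n hn => ?_
    rcases eq_or_ne n 0 with rfl | h0
    · have : fr s 0 = 0 := by simp [fr, tri]
      rw [Set.indicator_apply]; simp [this]
    · rw [Set.indicator_of_mem]
      exact Nat.mem_smoothNumbers_of_lt (Nat.pos_of_ne_zero h0) (Finset.mem_range.1 hn)
  refine h3.trans ?_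
  have h4 : ∑' m : N.smoothNumbers, fr s m = ‖∏ p ∈ N.primesBelow, ∑' n : ℕ, fcube (reC s) (p ^ n)‖ := by
    rw [← h2, Complex.norm_real, Real.norm_of_nonneg (tsum_nonneg fun _ => fr_nonneg _ _)]
  rw [h4, norm_prod]
  calc _ ≤ ∏ p ∈ N.primesBelow, Real.exp (14 * (p:ℝ)^(-τ)) := by
        refine Finset.prod_le_prod (fun _ _ => norm_nonneg _) fun p hp => ?_
        have hpp := Nat.prime_of_mem_primesBelow hp
        rw [(fcube_local _ (reC_mem hs) hpp).2]
        have hp1 : (1:ℝ) < p := by exact_mod_cast hpp.one_lt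
        have hp2 : (2:ℝ) ≤ p := by exact_mod_cast hpp.two_le
        have hp0 : (0:ℝ) < p := by linarith
        have hR : ((p:ℝ)^(-σ))^3 = (p:ℝ)^(-τ) := by
          rw [← Real.rpow_natCast, ← Real.rpow_mul hp0.le, hτ]; congr 1; push_cast; ring
        rw [← hR]
        have hb : ∀ z : ℂ, σ ≤ z.re → ‖(p:ℂ)^(-z)‖ ≤ (p:ℝ)^(-σ) := by
          intro z hz
          rw [Complex.norm_natCast_cpow_of_pos hpp.pos]
          apply Real.rpow_le_rpow_of_exponent_le hp1.le
          simpa using hz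
        refine local_bd ?_ ?_ (hb _ ?_) (hb _ ?_) (hb _ ?_)
        · exact Real.rpow_le_one_of_one_le_of_nonpos hp1.le (by linarith)
        · rw [hR]
          calc (p:ℝ)^(-τ) ≤ (p:ℝ)^(-1:ℝ) := Real.rpow_le_rpow_of_exponent_le hp1.le (by linarith)
            _ = (p:ℝ)⁻¹ := Real.rpow_neg_one _
            _ ≤ 1/2 := by rw [one_div]; gcongr
        · simp [reC, hσ]
        · simp [reC, hσ]
        · simp [reC, hσ]
    _ = Real.exp (14 * ∑ p ∈ N.primesBelow, (p:ℝ)^(-τ)) := by rw [← Real.exp_sum, Finset.mul_sum]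
    _ ≤ _ := by
      gcongr
      exact hsum.sum_le_tsum _ fun n _ => by positivity

theorem fcube_summable (s) (hs : s ∈ TDom) : Summable (fun u => ‖fcube s u‖) := by
  refine (fr_summable s hs).of_nonneg_of_le (fun _ => norm_nonneg _) fun u => ?_
  rw [fcube_eq]
  exact norm_sum_le _ _

/-- the nine linear forms -/
noncomputable def ell (i : Fin 9) (s : ℂ × ℂ × ℂ) : ℂ := e1 i * s.1 + e2 i * s.2.1 + e3 i * s.2.2

theorem ell_re {s} (hs : s ∈ TDom) (i) : 1 < (ell i s).re := by
  obtain ⟨h1, h2, h3⟩ := hs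
  have n : ∀ (k : ℕ) (z : ℂ), ((k:ℂ) * z).re = k * z.re := fun k z => by simp
  simp only [ell, Complex.add_re, n]
  fin_cases i <;> simp [e1, e2, e3] <;> linarith

theorem p_ell (i) (s : ℂ × ℂ × ℂ) {p : ℕ} (hp : p ≠ 0) :
    (p:ℂ)^(-(ell i s)) = ((p:ℂ)^(-s.1))^(e1 i) * ((p:ℂ)^(-s.2.1))^(e2 i) * ((p:ℂ)^(-s.2.2))^(e3 i) := by
  have hp0 : (p:ℂ) ≠ 0 := by exact_mod_cast hp
  rw [← Complex.cpow_mul_nat, ← Complex.cpow_mul_nat, ← Complex.cpow_mul_nat, ← Complex.cpow_add _ _ hp0,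
    ← Complex.cpow_add _ _ hp0]
  congr 1
  unfold ell; ring

theorem TDom_sub {s} (hs : s ∈ TDom) : s ∈ SDom := by
  obtain ⟨h1, h2, h3⟩ := hs
  refine ⟨?_, ?_, ?_⟩ <;> unfold eps <;> linarith

theorem fcube_tsum (s) (hs : s ∈ TDom) :
    ∑' u, fcube s u = riemannZeta (s.1 + s.2.1 + s.2.2) * (∏ i, riemannZeta (ell i s)) * EE s := by
  have hP := EulerProduct.eulerProduct_hasProd (fcube_one s) (fcube_mul s) (fcube_summable s hs) (fcube_zero s)
  have hs3 : 1 < (s.1 + s.2.1 + s.2.2).re := by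
    simp only [Complex.add_re]; linarith [hs.1, hs.2.1, hs.2.2]
  have h1 := riemannZeta_eulerProduct_hasProd hs3
  have h2 : HasProd (fun p : Nat.Primes => ∏ i, (1 - (p:ℂ)^(-(ell i s)))⁻¹) (∏ i, riemannZeta (ell i s)) :=
    hasProd_prod fun i _ => riemannZeta_eulerProduct_hasProd (ell_re hs i)
  have h3 := (h1.mul h2).mul (EE_hasProd s (TDom_sub hs))
  refine hP.unique ?_
  convert h3 using 2 with p
  have hp := p.2
  rw [(fcube_local s hs hp).2]
  have hsum : (p:ℂ)^(-(s.1 + s.2.1 + s.2.2)) = (p:ℂ)^(-s.1) * (p:ℂ)^(-s.2.1) * (p:ℂ)^(-s.2.2) := by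
    have hp0 : ((p:ℕ):ℂ) ≠ 0 := by exact_mod_cast hp.ne_zero
    rw [← Complex.cpow_add _ _ hp0, ← Complex.cpow_add _ _ hp0]
    congr 1; ring
  have ne1 : 1 - (p:ℂ)^(-(s.1 + s.2.1 + s.2.2)) ≠ 0 := one_sub_ne (p_norm_lt hp (by linarith))
  have ne2 : ∀ i, 1 - (p:ℂ)^(-(ell i s)) ≠ 0 := fun i => one_sub_ne (p_norm_lt hp (by linarith [ell_re hs i]))
  rw [hsum] at ne1 ⊢
  simp only [p_ell _ s hp.ne_zero] at ne2 ⊢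
  unfold Eloc Ep
  generalize (p:ℂ)^(-s.1) = X at *
  generalize (p:ℂ)^(-s.2.1) = Y at *
  generalize (p:ℂ)^(-s.2.2) = Z at *
  have n0 := ne2 0
  have n1 := ne2 1
  have n2 := ne2 2
  have n3 := ne2 3
  have n4 := ne2 4
  have n5 := ne2 5
  have n6 := ne2 6
  have n7 := ne2 7
  have n8 := ne2 8
  simp [Fin.prod_univ_succ, e1, e2, e3] at n0 n1 n2 n3 n4 n5 n6 n7 n8 ⊢
  rw [mul_comm X (Y^2)] at n5 ⊢
  rw [mul_comm X (Z^2)] at n7 ⊢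
  rw [mul_comm Y (Z^2)] at n8 ⊢
  generalize Np X Y Z = N
  generalize 1 - X*Y*Z = c0 at *
  generalize 1 - X^3 = c1 at *
  generalize 1 - Y^3 = c2 at *
  generalize 1 - Z^3 = c3 at *
  generalize 1 - X^2*Y = c4 at *
  generalize 1 - X^2*Z = c5 at *
  generalize 1 - Y^2*X = c6 at *
  generalize 1 - Y^2*Z = c7 at *
  generalize 1 - Z^2*X = c8 at *
  generalize 1 - Z^2*Y = c9 at *
  field_simp

/-- the index type of cube triples -/
abbrev TT : Type := Σ u : ℕ, {x // x ∈ tri u}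

theorem T_summable (s) (hs : s ∈ TDom) : Summable (fun t : TT => ‖mon s t.2‖) := by
  refine (summable_sigma_of_nonneg fun _ => norm_nonneg _).2 ⟨fun u => (hasSum_fintype _).summable, ?_⟩
  refine (fr_summable s hs).congr fun u => ?_
  rw [tsum_fintype]
  exact (Finset.sum_coe_sort (tri u) (fun x => ‖mon s x‖)).symm

theorem T_tsum (s) (hs : s ∈ TDom) : ∑' t : TT, mon s t.2 =
    riemannZeta (s.1 + s.2.1 + s.2.2) * (∏ i, riemannZeta (ell i s)) * EE s := by
  rw [(T_summable s hs).of_norm.tsum_sigma' (fun u => (hasSum_fintype _).summable), ← fcube_tsum s hs]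
  refine tsum_congr fun u => ?_
  rw [tsum_fintype, fcube_eq]
  exact (Finset.sum_coe_sort (tri u) (fun x => mon s x))

end CT


namespace CT
open MeasureTheory

theorem hasSum_cg {ι : Type*} {f g : ι → ℂ} {a b : ℂ} (h : HasSum g b) (hf : ∀ t, f t = g t) (ha : a = b) :
    HasSum f a := by
  rw [funext hf, ha]; exact h

noncomputable def mx (x : ℕ × ℕ × ℕ) : ℝ := max (x.1:ℝ) (max (x.2.1:ℝ) (x.2.2:ℝ))

/-- shifted points on the vertical plane -/
noncomputable def sw (w : ℂ) (t : ℝ × ℝ) : ℂ × ℂ × ℂ :=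
  sv w (0 + t.1 * Complex.I) (0 + t.2 * Complex.I)

theorem sw_eq (w : ℂ) (t : ℝ × ℝ) : sw w t =
    ((1+w)/3 + t.1 * Complex.I, (1+w)/3 + t.2 * Complex.I, (1+w)/3 - (t.1 + t.2) * Complex.I) := by
  unfold sw sv
  refine Prod.ext ?_ (Prod.ext ?_ ?_) <;> simp only <;> ring

theorem third_re {w : ℂ} (hw : 0 < w.re) : 1/3 < ((1+w)/3).re := by
  have : (1+w)/3 = ((1/3:ℝ):ℂ) * (1+w) := by push_cast; ring
  rw [this, Complex.re_ofReal_mul]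
  simp; linarith

theorem sw_mem {w : ℂ} (hw : 0 < w.re) (t : ℝ × ℝ) : sw w t ∈ TDom := by
  have := third_re hw
  rw [sw_eq]
  refine ⟨?_, ?_, ?_⟩ <;> simpa using this

theorem mon_norm {s s' : ℂ × ℂ × ℂ} (h1 : s.1.re = s'.1.re) (h2 : s.2.1.re = s'.2.1.re) (h3 : s.2.2.re = s'.2.2.re)
    {u : ℕ} {x : ℕ × ℕ × ℕ} (hx : x ∈ tri u) : ‖mon s x‖ = ‖mon s' x‖ := by
  obtain ⟨a, b, c⟩ := tri_ne hx
  unfold mon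
  simp only [norm_mul, Complex.norm_natCast_cpow_of_pos (Nat.pos_of_ne_zero a), Complex.norm_natCast_cpow_of_pos (Nat.pos_of_ne_zero b),
    Complex.norm_natCast_cpow_of_pos (Nat.pos_of_ne_zero c), Complex.neg_re, h1, h2, h3]

noncomputable def sinv (w : ℂ) (t : ℝ × ℝ) : ℂ := ((sw w t).1 * (sw w t).2.1 * (sw w t).2.2)⁻¹

theorem sinv_int {w : ℂ} (hw : 0 < w.re) : Integrable (sinv w) := by
  have h : 0 < ((1+w)/3).re := by linarith [third_re hw]
  have := int_line2 h h h
  unfold sinv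
  simp only [sw_eq]
  exact this

theorem mon_cont (w : ℂ) {u : ℕ} {x : ℕ × ℕ × ℕ} (hx : x ∈ tri u) : Continuous (fun t => mon (sw w t) x) := by
  obtain ⟨a, b, c⟩ := tri_ne hx
  unfold mon
  simp only [sw_eq]
  have h : ∀ (n : ℕ) (hn : n ≠ 0) (f : ℝ × ℝ → ℂ), Continuous f → Continuous (fun t => (n:ℂ)^(-f t)) := by
    intro n hn f hf
    exact Continuous.const_cpow hf.neg (Or.inl (by exact_mod_cast hn))
  exact ((h _ a _ (by fun_prop)).mul (h _ b _ (by fun_prop))).mul (h _ c _ (by fun_prop))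

theorem swap {w : ℂ} (hw : 0 < w.re) :
    HasSum (fun t : TT => (2 * Real.pi) ^ 2 * ((mx t.2 : ℝ) : ℂ) ^ (-(1+w)) / (1+w))
      (∫ τ : ℝ × ℝ, (∑' t : TT, mon (sw w τ) t.2) * sinv w τ) := by
  have h3 : 0 < ((1+w)/3).re := by linarith [third_re hw]
  have hIntg := sinv_int hw
  have hn : ∀ (t : TT) (τ : ℝ × ℝ), ‖mon (sw w τ) t.2‖ = ‖mon (sw w 0) t.2‖ := by
    intro t τ
    refine mon_norm ?_ ?_ ?_ t.2.2 <;> simp [sw_eq]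
  have hF : ∀ t : TT, Integrable (fun τ => mon (sw w τ) t.2 * sinv w τ) := by
    intro t
    refine Integrable.bdd_mul (c := ‖mon (sw w 0) t.2‖) hIntg (mon_cont w t.2.2).aestronglyMeasurable ?_
    exact Eventually.of_forall fun τ => (hn t τ).le
  have hS : Summable (fun t : TT => ∫ τ, ‖mon (sw w τ) t.2 * sinv w τ‖) := by
    refine ((T_summable (sw w 0) (sw_mem hw 0)).mul_right (∫ τ, ‖sinv w τ‖)).congr fun t => ?_
    rw [← integral_const_mul]
    refine integral_congr_ae (Eventually.of_forall fun τ => ?_)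
    simp only [norm_mul, hn t τ]
  have h := hasSum_integral_of_summable_integral_norm hF hS
  simp_rw [tsum_mul_right] at h
  refine hasSum_cg h (fun t => ?_) rfl
  obtain ⟨a, b, c⟩ := tri_ne t.2.2
  have hl := line2 h3 h3 h3 (t.2.1.1:ℝ) (t.2.1.2.1:ℝ) (t.2.1.2.2:ℝ) (by exact_mod_cast Nat.pos_of_ne_zero a)
    (by exact_mod_cast Nat.pos_of_ne_zero b) (by exact_mod_cast Nat.pos_of_ne_zero c)
  have e : (1+w)/3 + (1+w)/3 + (1+w)/3 = 1 + w := by ring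
  rw [e] at hl
  unfold mx
  rw [← hl]
  refine integral_congr_ae (Eventually.of_forall fun τ => ?_)
  simp only [mon, sinv, sw_eq, Complex.ofReal_natCast]

theorem W_eq {w : ℂ} (hw : 0 < w.re) :
    HasSum (fun t : TT => ((mx t.2 : ℝ) : ℂ) ^ (-(1+w)))
      (riemannZeta (1+w) * ((∑ S : Finset (Fin 9), Jint (GB Sᶜ) S w 0 0) / (2 * Real.pi)^2)) := by
  have hpi : ((2 * Real.pi)^2 : ℂ) ≠ 0 := by
    exact pow_ne_zero _ (mul_ne_zero two_ne_zero (by exact_mod_cast Real.pi_ne_zero))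
  have h1w : 1 + w ≠ 0 := by
    intro h
    have := congrArg Complex.re h
    simp at this
    linarith
  have h := ((swap hw).mul_left ((1+w) / (2 * Real.pi)^2))
  refine hasSum_cg h (fun t => ?_) ?_
  · field_simp
  · have hi : ∀ S : Finset (Fin 9), Integrable (fun τ : ℝ × ℝ => Phi (GB Sᶜ) S w (0 + τ.1 * Complex.I) (0 + τ.2 * Complex.I)) :=
      fun S => Phi_int (GB_good Sᶜ) S (Reg_zero (by norm_num [eps]) S hw)
    unfold Jint
    rw [← integral_finset_sum _ (fun S _ => hi S), ← mul_div_assoc, ← integral_const_mul, ← integral_const_mul, ← integral_div]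
    refine integral_congr_ae (Eventually.of_forall fun τ => ?_)
    simp only
    rw [T_tsum _ (sw_mem hw τ)]
    have e1 : (sw w τ).1 + (sw w τ).2.1 + (sw w τ).2.2 = 1 + w := by
      rw [sw_eq]; ring
    have e2 : ∀ i, ell i (sw w τ) = 1 + (w + lam i (0 + τ.1 * Complex.I) (0 + τ.2 * Complex.I)) := by
      intro i
      have h : (CT.e1 i : ℂ) + CT.e2 i + CT.e3 i = 3 := by exact_mod_cast e_sum i
      rw [lam_e]; simp only [ell, sw, sv]
      linear_combination (1/3) * h
    have hz : ∀ i, riemannZeta (ell i (sw w τ)) = (w + lam i (0 + τ.1 * Complex.I) (0 + τ.2 * Complex.I))⁻¹ +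
        hreg (w + lam i (0 + τ.1 * Complex.I) (0 + τ.2 * Complex.I)) := by
      intro i
      rw [e2, zeta_hreg]
      have := ell_re (sw_mem hw τ) i
      rw [e2] at this
      simp only [Complex.add_re, Complex.one_re] at this ⊢
      linarith
    rw [e1]
    simp_rw [hz]
    rw [Finset.prod_add]
    simp only [Finset.powerset_univ, Phi, GB]
    rw [Finset.mul_sum, Finset.mul_sum, Finset.sum_mul, Finset.sum_mul, Finset.mul_sum, Finset.sum_div]
    refine Finset.sum_congr rfl fun S _ => ?_
    rw [Finset.compl_eq_univ_sdiff]
    unfold sinv sw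
    field_simp

end CT


namespace CT
open MeasureTheory

theorem pn_abs (p : ℕ) (x : ℚ) : padicNorm p |x| = padicNorm p x := by
  rcases abs_choice x with h | h <;> rw [h]
  exact padicNorm.neg x

theorem prod_val (m : ℕ) (hm : m ≠ 0) :
    ∏' p : Nat.Primes, (((padicNorm p (m:ℚ))⁻¹ : ℚ) : ℝ) = m := by
  have h1 : ∀ p : Nat.Primes, (((padicNorm p (m:ℚ))⁻¹ : ℚ) : ℝ) = (((p:ℕ) ^ (m.factorization p) : ℕ) : ℝ) := by
    intro p
    have := Fact.mk p.2
    rw [padicNorm.eq_zpow_of_nonzero (by exact_mod_cast hm), padicValRat.of_nat, Nat.factorization_def _ p.2]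
    simp
  simp_rw [h1]
  refine (tprod_eq_prod (β := Nat.Primes) (s := m.primeFactors.subtype Nat.Prime) ?_).trans ?_
  · intro p hp
    have : (p:ℕ) ∉ m.primeFactors := by
      intro h; exact hp (Finset.mem_subtype.2 h)
    rw [← Nat.support_factorization, Finsupp.notMem_support_iff] at this
    simp [this]
  · have := Finset.prod_subtype_of_mem (s := m.primeFactors) (p := Nat.Prime)
      (fun p => ((p ^ m.factorization p : ℕ) : ℝ)) (fun x hx => Nat.prime_of_mem_primeFactors hx)
    refine Eq.trans this ?_
    rw [← Nat.cast_prod]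
    congr 1
    conv_rhs => rw [← Nat.prod_factorization_pow_eq_self hm]
    rw [Finsupp.prod, Nat.support_factorization]

theorem height_prim (x y : ℚ) (a b c m : ℕ) (ha : a ≠ 0) (hb : b ≠ 0) (hc : c ≠ 0) (hm : m ≠ 0)
    (habc : a * b * c = m ^ 3) (hx : |x| = a / m) (hy : |y| = b / m)
    (hg : Nat.gcd a (Nat.gcd b c) = 1) : cubicTorusHeight x y = max (a:ℝ) (max (b:ℝ) (c:ℝ)) := by
  have hq : (a:ℚ) * b * c = m ^ 3 := by exact_mod_cast habc
  have ha' : (a:ℚ) ≠ 0 := by exact_mod_cast ha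
  have hb' : (b:ℚ) ≠ 0 := by exact_mod_cast hb
  have hc' : (c:ℚ) ≠ 0 := by exact_mod_cast hc
  have hm' : (m:ℚ) ≠ 0 := by exact_mod_cast hm
  have hz : |x * y|⁻¹ = c / m := by
    rw [abs_mul, hx, hy]
    field_simp
    linear_combination -hq
  have hloc : ∀ p : Nat.Primes, max (padicNorm p x) (max (padicNorm p y) (padicNorm p (x * y))⁻¹) = (padicNorm p (m:ℚ))⁻¹ := by
    intro p
    have := Fact.mk p.2
    have hpm : 0 < padicNorm p (m:ℚ) := lt_of_le_of_ne (padicNorm.nonneg _) (Ne.symm (padicNorm.nonzero hm'))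
    have hinv : (padicNorm p (x * y))⁻¹ = padicNorm p ((|x * y|)⁻¹) := by
      rw [inv_eq_one_div, inv_eq_one_div, padicNorm.div, padicNorm.one, pn_abs]
    rw [hinv, ← pn_abs p x, ← pn_abs p y, hx, hy, hz, padicNorm.div, padicNorm.div, padicNorm.div]
    have i1 := padicNorm.of_nat (p := p) a
    have i2 := padicNorm.of_nat (p := p) b
    have i3 := padicNorm.of_nat (p := p) c
    have hor : padicNorm p (a:ℚ) = 1 ∨ padicNorm p (b:ℚ) = 1 ∨ padicNorm p (c:ℚ) = 1 := by
      simp only [padicNorm.nat_eq_one_iff]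
      by_contra hcon
      push Not at hcon
      obtain ⟨h1, h2, h3⟩ := hcon
      have := Nat.dvd_gcd h1 (Nat.dvd_gcd h2 h3)
      rw [hg] at this
      exact p.2.one_lt.ne' (Nat.dvd_one.1 this)
    rw [inv_eq_one_div]
    apply le_antisymm
    · refine max_le ?_ (max_le ?_ ?_) <;> gcongr
    · rcases hor with h | h | h
      · rw [h]; exact le_max_left _ _
      · rw [h]; exact le_max_of_le_right (le_max_left _ _)
      · rw [h]; exact le_max_of_le_right (le_max_right _ _)
  unfold cubicTorusHeight
  simp_rw [hloc]
  rw [prod_val m hm]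
  have hmR : (0:ℝ) < m := by exact_mod_cast Nat.pos_of_ne_zero hm
  have r1 : |(x:ℝ)| = a / m := by rw [← Rat.cast_abs, hx]; push_cast; rfl
  have r2 : |(y:ℝ)| = b / m := by rw [← Rat.cast_abs, hy]; push_cast; rfl
  have r3 : |((x * y : ℚ) : ℝ)|⁻¹ = c / m := by rw [← Rat.cast_abs, ← Rat.cast_inv, hz]; push_cast; rfl
  rw [r1, r2, r3, max_div_div_right hmR.le, max_div_div_right hmR.le]
  field_simp

noncomputable def gg (x : ℕ × ℕ × ℕ) : ℕ := Nat.gcd x.1 (Nat.gcd x.2.1 x.2.2)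

theorem gg_ne {u : ℕ} {x : ℕ × ℕ × ℕ} (hx : x ∈ tri u) : gg x ≠ 0 := by
  intro h
  exact (tri_ne hx).1 (Nat.eq_zero_of_gcd_eq_zero_left h)

theorem gg_dvd {u a b c : ℕ} (h : a * b * c = u ^ 3) : gg (a, b, c) ∣ u := by
  rw [← Nat.pow_dvd_pow_iff (n := 3) (by norm_num), ← h]
  have h1 : gg (a,b,c) ∣ a := Nat.gcd_dvd_left _ _
  have h2 : gg (a,b,c) ∣ b := (Nat.gcd_dvd_right _ _).trans (Nat.gcd_dvd_left _ _)
  have h3 : gg (a,b,c) ∣ c := (Nat.gcd_dvd_right _ _).trans (Nat.gcd_dvd_right _ _)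
  have := mul_dvd_mul (mul_dvd_mul h1 h2) h3
  rwa [pow_succ, sq]

theorem gg_mul (k a b c : ℕ) : gg (k * a, k * b, k * c) = k * gg (a, b, c) := by
  simp only [gg, Nat.gcd_mul_left]

theorem height_tri (x y : ℚ) {u : ℕ} {t : ℕ × ℕ × ℕ} (ht : t ∈ tri u) (hx : |x| = t.1 / u) (hy : |y| = t.2.1 / u) :
    cubicTorusHeight x y * gg t = mx t := by
  obtain ⟨a, b, c⟩ := t
  obtain ⟨ha, hb, hc⟩ := tri_ne ht
  obtain ⟨hu, habc⟩ := mem_tri.1 ht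
  have hg := gg_ne ht
  simp only at *
  obtain ⟨m, hm⟩ := gg_dvd habc
  obtain ⟨a', ha'⟩ : gg (a,b,c) ∣ a := Nat.gcd_dvd_left _ _
  obtain ⟨b', hb'⟩ : gg (a,b,c) ∣ b := (Nat.gcd_dvd_right _ _).trans (Nat.gcd_dvd_left _ _)
  obtain ⟨c', hc'⟩ : gg (a,b,c) ∣ c := (Nat.gcd_dvd_right _ _).trans (Nat.gcd_dvd_right _ _)
  have hgg : gg (a', b', c') = 1 := by
    have := gg_mul (gg (a,b,c)) a' b' c'
    rw [← ha', ← hb', ← hc'] at this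
    exact (Nat.eq_of_mul_eq_mul_left (Nat.pos_of_ne_zero hg) (by rw [mul_one]; exact this)).symm
  generalize gg (a,b,c) = g at *
  subst hm ha' hb' hc'
  have hgQ : (g:ℚ) ≠ 0 := by exact_mod_cast hg
  rw [height_prim x y a' b' c' m (right_ne_zero_of_mul ha) (right_ne_zero_of_mul hb) (right_ne_zero_of_mul hc)
    (right_ne_zero_of_mul hu) ?_ ?_ ?_ hgg]
  · unfold mx
    push_cast
    rw [← mul_max_of_nonneg _ _ (Nat.cast_nonneg g), ← mul_max_of_nonneg _ _ (Nat.cast_nonneg g), mul_comm]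
  · have h3 : g ^ 3 * (a' * b' * c') = g ^ 3 * m ^ 3 := by linear_combination habc
    exact Nat.eq_of_mul_eq_mul_left (pow_pos (Nat.pos_of_ne_zero hg) 3) h3
  · rw [hx]; push_cast; rw [mul_div_mul_left _ _ hgQ]
  · rw [hy]; push_cast; rw [mul_div_mul_left _ _ hgQ]

end CT


namespace CT
open MeasureTheory

noncomputable def sgn (e : ℤˣ) : ℚ := ((e : ℤ) : ℚ)

theorem sgn_abs (e : ℤˣ) : |sgn e| = 1 := by
  rcases Int.units_eq_one_or e with h | h <;> simp [sgn, h]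

theorem sgn_ne (e : ℤˣ) : sgn e ≠ 0 := by
  rcases Int.units_eq_one_or e with h | h <;> simp [sgn, h]

theorem sgn_inj {e e' : ℤˣ} {r r' : ℚ} (hr : 0 < r) (hr' : 0 < r') (h : sgn e * r = sgn e' * r') : e = e' ∧ r = r' := by
  rcases Int.units_eq_one_or e with h1 | h1 <;> rcases Int.units_eq_one_or e' with h2 | h2 <;> subst h1 h2 <;>
    simp [sgn] at h ⊢ <;> linarith

theorem sgn_ex (x : ℚ) : ∃ e : ℤˣ, sgn e * |x| = x := by
  rcases abs_choice x with h | h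
  · exact ⟨1, by simp [sgn, h]⟩
  · exact ⟨-1, by simp [sgn, h]⟩

theorem tri_q {u : ℕ} {x : ℕ × ℕ × ℕ} (hx : x ∈ tri u) : (0:ℚ) < x.1 / u ∧ (0:ℚ) < x.2.1 / u ∧ (0:ℚ) < u := by
  obtain ⟨a, b, c⟩ := tri_ne hx
  obtain ⟨hu, -⟩ := mem_tri.1 hx
  have a' : (0:ℚ) < x.1 := by exact_mod_cast Nat.pos_of_ne_zero a
  have b' : (0:ℚ) < x.2.1 := by exact_mod_cast Nat.pos_of_ne_zero b
  have u' : (0:ℚ) < u := by exact_mod_cast Nat.pos_of_ne_zero hu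
  exact ⟨by positivity, by positivity, u'⟩

noncomputable def FF (z : TT × (ℤˣ × ℤˣ)) : (ℚˣ × ℚˣ) × ℕ :=
  ((Units.mk0 (sgn z.2.1 * (z.1.2.1.1 / z.1.1)) (mul_ne_zero (sgn_ne _) (tri_q z.1.2.2).1.ne'),
    Units.mk0 (sgn z.2.2 * (z.1.2.1.2.1 / z.1.1)) (mul_ne_zero (sgn_ne _) (tri_q z.1.2.2).2.1.ne')),
    (gg z.1.2.1).pred)

theorem FF_height (z : TT × (ℤˣ × ℤˣ)) :
    cubicTorusHeight ((FF z).1.1 : ℚ) ((FF z).1.2 : ℚ) * (((FF z).2 : ℝ) + 1) = mx z.1.2.1 := by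
  have h1 : (((FF z).2 : ℝ) + 1) = gg z.1.2.1 := by
    have : (gg z.1.2.1).pred + 1 = gg z.1.2.1 := Nat.succ_pred (gg_ne z.1.2.2)
    exact_mod_cast this
  rw [h1]
  refine height_tri _ _ z.1.2.2 ?_ ?_
  · simp only [FF, Units.val_mk0]
    rw [abs_mul, sgn_abs, one_mul, abs_of_pos (tri_q z.1.2.2).1]
  · simp only [FF, Units.val_mk0]
    rw [abs_mul, sgn_abs, one_mul, abs_of_pos (tri_q z.1.2.2).2.1]

theorem FF_inj : Function.Injective FF := by
  rintro ⟨⟨u, ⟨⟨a, b, c⟩, ht⟩⟩, e, d⟩ ⟨⟨u', ⟨⟨a', b', c'⟩, ht'⟩⟩, e', d'⟩ h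
  simp only [FF, Prod.mk.injEq, Units.ext_iff, Units.val_mk0] at h
  obtain ⟨⟨h1, h2⟩, h3⟩ := h
  obtain ⟨rfl, k1⟩ := sgn_inj (tri_q ht).1 (tri_q ht').1 h1
  obtain ⟨rfl, k2⟩ := sgn_inj (tri_q ht).2.1 (tri_q ht').2.1 h2
  have hg : gg (a,b,c) = gg (a',b',c') := by
    have i1 := Nat.succ_pred (gg_ne ht)
    have i2 := Nat.succ_pred (gg_ne ht')
    rw [← i1, ← i2, h3]
  have p1 := (tri_q ht).2.2
  have p2 := (tri_q ht').2.2
  simp only at k1 k2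
  rw [div_eq_div_iff p1.ne' p2.ne'] at k1 k2
  have n1 : u' * a = u * a' := by
    have : (a * u' : ℕ) = a' * u := by exact_mod_cast k1
    linarith
  have n2 : u' * b = u * b' := by
    have : (b * u' : ℕ) = b' * u := by exact_mod_cast k2
    linarith
  obtain ⟨hu, m1⟩ := mem_tri.1 ht
  obtain ⟨hu', m2⟩ := mem_tri.1 ht'
  obtain ⟨ha, hb, hc⟩ := tri_ne ht
  simp only at m1 m2 ha hb hc
  have n3 : u' * c = u * c' := by
    have h0 : 0 < (u' * a) * (u' * b) := by positivity
    apply Nat.eq_of_mul_eq_mul_left h0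
    conv_rhs => rw [n1, n2]
    calc (u' * a) * (u' * b) * (u' * c) = u'^3 * (a * b * c) := by ring
      _ = u ^ 3 * (a' * b' * c') := by rw [m1, m2]; ring
      _ = _ := by ring
  have huu : u = u' := by
    have g1 := gg_mul u' a b c
    rw [n1, n2, n3, gg_mul, ← hg] at g1
    exact Nat.eq_of_mul_eq_mul_right (Nat.pos_of_ne_zero (gg_ne ht)) g1
  subst huu
  have hu0 := Nat.pos_of_ne_zero hu
  obtain rfl := Nat.eq_of_mul_eq_mul_left hu0 n1
  obtain rfl := Nat.eq_of_mul_eq_mul_left hu0 n2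
  obtain rfl := Nat.eq_of_mul_eq_mul_left hu0 n3
  rfl

theorem tri_exists (r t : ℚ) (hr : 0 < r) (ht : 0 < t) (n : ℕ) (hn : n ≠ 0) :
    ∃ (u : ℕ) (x : ℕ × ℕ × ℕ), x ∈ tri u ∧ (x.1 / u : ℚ) = r ∧ (x.2.1 / u : ℚ) = t ∧ gg x = n := by
  obtain ⟨a0, b0, d, ha0, hb0, hd, h1, h2⟩ : ∃ a0 b0 d : ℕ, a0 ≠ 0 ∧ b0 ≠ 0 ∧ d ≠ 0 ∧ (a0 / d : ℚ) = r ∧ (b0 / d : ℚ) = t := by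
    have e1 : ((r.num.natAbs : ℕ) : ℚ) = r.num := by
      have : ((r.num.natAbs : ℕ) : ℤ) = r.num := Int.natAbs_of_nonneg (Rat.num_pos.2 hr).le
      rw [← Int.cast_natCast, this]
    have e2 : ((t.num.natAbs : ℕ) : ℚ) = t.num := by
      have : ((t.num.natAbs : ℕ) : ℤ) = t.num := Int.natAbs_of_nonneg (Rat.num_pos.2 ht).le
      rw [← Int.cast_natCast, this]
    have f1 : (r.den : ℚ) ≠ 0 := by exact_mod_cast r.den_nz
    have f2 : (t.den : ℚ) ≠ 0 := by exact_mod_cast t.den_nz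
    refine ⟨r.num.natAbs * t.den, t.num.natAbs * r.den, r.den * t.den, ?_, ?_, mul_ne_zero r.den_nz t.den_nz, ?_, ?_⟩
    · exact mul_ne_zero (Int.natAbs_ne_zero.2 (Rat.num_pos.2 hr).ne') t.den_nz
    · exact mul_ne_zero (Int.natAbs_ne_zero.2 (Rat.num_pos.2 ht).ne') r.den_nz
    · push_cast
      rw [e1, mul_div_mul_right _ _ f2, Rat.num_div_den]
    · push_cast
      rw [e2, mul_comm (r.den:ℚ), mul_div_mul_right _ _ f1, Rat.num_div_den]
  obtain ⟨A, hA⟩ : ∃ A, A = a0 * a0 * b0 := ⟨_, rfl⟩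
  obtain ⟨B, hB⟩ : ∃ B, B = a0 * b0 * b0 := ⟨_, rfl⟩
  obtain ⟨C, hC⟩ : ∃ C, C = d * d * d := ⟨_, rfl⟩
  obtain ⟨U, hU⟩ : ∃ U, U = a0 * b0 * d := ⟨_, rfl⟩
  have hABC : A * B * C = U ^ 3 := by subst hA hB hC hU; ring
  have hA0 : A ≠ 0 := by subst hA; positivity
  have hU0 : U ≠ 0 := by subst hU; positivity
  have ha0Q : (a0:ℚ) ≠ 0 := by exact_mod_cast ha0
  have hb0Q : (b0:ℚ) ≠ 0 := by exact_mod_cast hb0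
  have hdQ : (d:ℚ) ≠ 0 := by exact_mod_cast hd
  have q1 : (A / U : ℚ) = r := by subst hA hU; rw [← h1]; push_cast; field_simp
  have q2 : (B / U : ℚ) = t := by subst hB hU; rw [← h2]; push_cast; field_simp
  have hg : gg (A,B,C) ≠ 0 := fun h => hA0 (Nat.eq_zero_of_gcd_eq_zero_left h)
  obtain ⟨m, hm⟩ := gg_dvd hABC
  obtain ⟨a', ha'⟩ : gg (A,B,C) ∣ A := Nat.gcd_dvd_left _ _
  obtain ⟨b', hb'⟩ : gg (A,B,C) ∣ B := (Nat.gcd_dvd_right _ _).trans (Nat.gcd_dvd_left _ _)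
  obtain ⟨c', hc'⟩ : gg (A,B,C) ∣ C := (Nat.gcd_dvd_right _ _).trans (Nat.gcd_dvd_right _ _)
  have hgg : gg (a', b', c') = 1 := by
    have := gg_mul (gg (A,B,C)) a' b' c'
    rw [← ha', ← hb', ← hc'] at this
    exact (Nat.eq_of_mul_eq_mul_left (Nat.pos_of_ne_zero hg) (by rw [mul_one]; exact this)).symm
  clear hA hB hC hU
  generalize gg (A,B,C) = g at *
  subst hm ha' hb' hc'
  have hgQ : (g:ℚ) ≠ 0 := by exact_mod_cast hg
  have hnQ : (n:ℚ) ≠ 0 := by exact_mod_cast hn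
  have hm0 := right_ne_zero_of_mul hU0
  have h3 : a' * b' * c' = m ^ 3 := by
    have : g ^ 3 * (a' * b' * c') = g ^ 3 * m ^ 3 := by linear_combination hABC
    exact Nat.eq_of_mul_eq_mul_left (pow_pos (Nat.pos_of_ne_zero hg) 3) this
  refine ⟨n * m, (n * a', n * b', n * c'), mem_tri.2 ⟨mul_ne_zero hn hm0, ?_⟩, ?_, ?_, ?_⟩
  · simp only; linear_combination n ^ 3 * h3
  · rw [← q1]; push_cast; rw [mul_div_mul_left _ _ hgQ, mul_div_mul_left _ _ hnQ]
  · rw [← q2]; push_cast; rw [mul_div_mul_left _ _ hgQ, mul_div_mul_left _ _ hnQ]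
  · rw [gg_mul, hgg, mul_one]

theorem FF_surj : Function.Surjective FF := by
  rintro ⟨⟨x, y⟩, n⟩
  obtain ⟨e, he⟩ := sgn_ex x
  obtain ⟨d, hd⟩ := sgn_ex y
  obtain ⟨u, t, ht, h1, h2, h3⟩ := tri_exists |(x:ℚ)| |(y:ℚ)| (abs_pos.2 x.ne_zero) (abs_pos.2 y.ne_zero) (n+1) (Nat.succ_ne_zero n)
  refine ⟨(⟨u, t, ht⟩, e, d), ?_⟩
  simp only [FF, Prod.mk.injEq, Units.ext_iff, Units.val_mk0]
  refine ⟨⟨?_, ?_⟩, ?_⟩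
  · rw [h1, he]
  · rw [h2, hd]
  · rw [h3]; rfl

noncomputable def FE : TT × (ℤˣ × ℤˣ) ≃ (ℚˣ × ℚˣ) × ℕ := Equiv.ofBijective FF ⟨FF_inj, FF_surj⟩

theorem height_nonneg (x y : ℚˣ) : 0 ≤ cubicTorusHeight x y := by
  obtain ⟨z, hz⟩ := FF_surj ((x, y), 0)
  have := FF_height z
  rw [hz] at this
  simp only [Nat.cast_zero, zero_add, mul_one] at this
  rw [this]
  unfold mx; positivity

theorem FF_pow (s : ℂ) (z : TT × (ℤˣ × ℤˣ)) :
    (cubicTorusHeight ((FF z).1.1 : ℚ) ((FF z).1.2 : ℚ) : ℂ) ^ (-s) * (1 / (((FF z).2 : ℂ) + 1) ^ s) =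
      ((mx z.1.2 : ℝ) : ℂ) ^ (-s) * 1 := by
  rw [mul_one, ← FF_height z, Complex.ofReal_mul, Complex.mul_cpow_ofReal_nonneg (height_nonneg _ _) (by positivity),
    Complex.cpow_neg (((((FF z).2 : ℝ) + 1 : ℝ)) : ℂ)]
  push_cast
  rw [one_div]

theorem Z_main {s : ℂ} (hs : 1 < s.re) :
    Summable (fun q : ℚˣ × ℚˣ => ‖(cubicTorusHeight (q.1 : ℚ) (q.2 : ℚ) : ℂ) ^ (-s)‖) ∧
    cubicTorusZeta s = (∑ S : Finset (Fin 9), Jint (GB Sᶜ) S (s - 1) 0 0) / Real.pi ^ 2 := by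
  have hw : 0 < (s - 1).re := by simpa using hs
  have hW := W_eq hw
  have e1 : 1 + (s - 1) = s := by ring
  rw [e1] at hW
  have hWn := hW.summable.norm
  have hO : Summable (fun _ : ℤˣ × ℤˣ => ‖(1:ℂ)‖) := Summable.of_finite
  have hP := (summable_mul_of_summable_norm hWn hO).norm
  have hPt := tsum_mul_tsum_of_summable_norm hWn hO
  have hfun : ∀ z : TT × (ℤˣ × ℤˣ), ((mx z.1.2 : ℝ) : ℂ) ^ (-s) * 1 =
      (fun q : (ℚˣ × ℚˣ) × ℕ => (cubicTorusHeight (q.1.1 : ℚ) (q.1.2 : ℚ) : ℂ) ^ (-s) * (1 / ((q.2 : ℂ) + 1) ^ s)) (FE z) :=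
    fun z => (FF_pow s z).symm
  simp_rw [hfun] at hP hPt
  rw [FE.tsum_eq (fun q : (ℚˣ × ℚˣ) × ℕ => (cubicTorusHeight (q.1.1 : ℚ) (q.1.2 : ℚ) : ℂ) ^ (-s) * (1 / ((q.2 : ℂ) + 1) ^ s))] at hPt
  have hP2 := (FE.summable_iff (f := fun q : (ℚˣ × ℚˣ) × ℕ => ‖(cubicTorusHeight (q.1.1 : ℚ) (q.1.2 : ℚ) : ℂ) ^ (-s) * (1 / ((q.2 : ℂ) + 1) ^ s)‖)).1 hP
  have hS : Summable (fun q : ℚˣ × ℚˣ => ‖(cubicTorusHeight (q.1 : ℚ) (q.2 : ℚ) : ℂ) ^ (-s)‖) := by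
    have hi : Function.Injective (fun q : ℚˣ × ℚˣ => (q, 0) : ℚˣ × ℚˣ → (ℚˣ × ℚˣ) × ℕ) := fun a b h => (Prod.mk.inj h).1
    refine (hP2.comp_injective hi).congr fun q => ?_
    simp
  refine ⟨hS, ?_⟩
  have hzn : Summable (fun n : ℕ => ‖1 / ((n : ℂ) + 1) ^ s‖) := by
    have := ((summable_nat_add_iff 1).2 (Complex.summable_one_div_nat_cpow.2 hs)).norm
    simpa using this
  rw [← tsum_mul_tsum_of_summable_norm hS hzn, ← zeta_eq_tsum_one_div_nat_add_one_cpow hs, hW.tsum_eq] at hPt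
  have hz0 := riemannZeta_ne_zero_of_one_lt_re hs
  have hpi : (Real.pi : ℂ) ≠ 0 := by exact_mod_cast Real.pi_ne_zero
  have h4 : (∑' _ : ℤˣ × ℤˣ, (1:ℂ)) = 4 := by
    rw [tsum_fintype]; simp [Fintype.card_prod]; try norm_num
  rw [h4] at hPt
  have : cubicTorusZeta s * riemannZeta s = ((∑ S : Finset (Fin 9), Jint (GB Sᶜ) S (s - 1) 0 0) / Real.pi ^ 2) * riemannZeta s := by
    unfold cubicTorusZeta
    rw [← hPt]
    field_simp
    ring
  exact mul_right_cancel₀ hz0 this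

end CT


namespace CT
open MeasureTheory

theorem EE_third : EE (1/3, 1/3, 1/3) = ((∏' p : Nat.Primes, cubicTorusEulerFactor p : ℝ) : ℂ) := by
  have hmem : ((1/3, 1/3, 1/3) : ℂ × ℂ × ℂ) ∈ SDom := by
    have : ((1/3 : ℂ)).re = 1/3 := by
      have : (1/3 : ℂ) = ((1/3 : ℝ) : ℂ) := by push_cast; rfl
      rw [this, Complex.ofReal_re]
    refine ⟨?_, ?_, ?_⟩ <;> simp only [this] <;> norm_num [eps]
  have hloc : ∀ p : Nat.Primes, Eloc p (1/3, 1/3, 1/3) = (cubicTorusEulerFactor p : ℂ) := by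
    intro p
    have hp : ((p:ℕ):ℂ) ≠ 0 := by exact_mod_cast p.2.ne_zero
    have hX : (((p:ℕ):ℂ)^(-(1/3:ℂ)))^3 = 1 / ((p:ℕ):ℂ) := by
      rw [← Complex.cpow_nat_mul]
      have : ((3:ℕ):ℂ) * (-(1/3)) = -1 := by push_cast; norm_num
      rw [this, Complex.cpow_neg_one, one_div]
    unfold Eloc cubicTorusEulerFactor
    push_cast
    rw [show (1:ℂ) / ((p:ℕ):ℂ)^2 = (1 / ((p:ℕ):ℂ))^2 by rw [one_div_pow], show (7:ℂ) / ((p:ℕ):ℂ) = 7 * (1 / ((p:ℕ):ℂ)) by ring, ← hX]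
    unfold Ep Np
    ring
  have h := EE_hasProd _ hmem
  simp_rw [hloc] at h
  have hre : HasProd (fun p => cubicTorusEulerFactor p) ((EE (1/3,1/3,1/3)).re) ∧ ((EE (1/3,1/3,1/3)).re : ℂ) = EE (1/3,1/3,1/3) := by
    have h1 : Tendsto (fun F : Finset Nat.Primes => ((∏ p ∈ F, cubicTorusEulerFactor p : ℝ) : ℂ)) atTop (𝓝 (EE (1/3,1/3,1/3))) := by
      have h0 : Tendsto (fun F : Finset Nat.Primes => ∏ p ∈ F, (cubicTorusEulerFactor p : ℂ)) atTop (𝓝 (EE (1/3,1/3,1/3))) := by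
        simpa [HasProd] using h
      refine h0.congr fun F => ?_
      push_cast; rfl
    have h2 := (Complex.continuous_re.tendsto _).comp h1
    have h3 : Tendsto (fun F : Finset Nat.Primes => (∏ p ∈ F, cubicTorusEulerFactor p : ℝ)) atTop (𝓝 ((EE (1/3,1/3,1/3)).re)) :=
      h2.congr fun F => Complex.ofReal_re _
    refine ⟨by simpa [HasProd] using h3, ?_⟩
    exact tendsto_nhds_unique ((Complex.continuous_ofReal.tendsto _).comp h3) h1
  rw [← hre.2, hre.1.tprod_eq]

theorem GB_zero : GB (Finset.univ)ᶜ 0 0 0 = 27 * EE (1/3, 1/3, 1/3) := by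
  have : sv 0 0 0 = (1/3, 1/3, 1/3) := by
    unfold sv; refine Prod.ext ?_ (Prod.ext ?_ ?_) <;> simp
  unfold GB
  rw [this, Finset.compl_univ, Finset.prod_empty]
  norm_num
  ring

theorem main_cont : ∃ Φ : ℂ → ℂ, DifferentiableOn ℂ Φ {w | -(eps/10) < w.re} ∧
    (∀ w : ℂ, 0 < w.re → w ^ 7 * ((∑ S : Finset (Fin 9), Jint (GB Sᶜ) S w 0 0) / Real.pi ^ 2) = Φ w) ∧
    Φ 0 = EE (1/3, 1/3, 1/3) := by
  have hη : 0 < eps := by norm_num [eps]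
  choose Ψ hΨ hΨe using fun S : Finset (Fin 9) => Jint_cont hη (GB_good Sᶜ) S
  have hk : ∀ S : Finset (Fin 9), kap S ≤ 7 := by
    intro S
    by_cases h : S = Finset.univ
    · rw [h, kap_univ]
    · exact (kap_lt S h).trans (by norm_num)
  have hpi : (Real.pi : ℂ) ≠ 0 := by exact_mod_cast Real.pi_ne_zero
  refine ⟨fun w => (∑ S : Finset (Fin 9), w ^ (7 - kap S) * Ψ S w) / Real.pi ^ 2, ?_, ?_, ?_⟩
  · refine DifferentiableOn.div_const ?_ _
    refine DifferentiableOn.fun_sum fun S _ => ?_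
    exact (differentiableOn_id.pow _).mul (hΨ S)
  · intro w hw
    rw [← mul_div_assoc, Finset.mul_sum]
    congr 1
    refine Finset.sum_congr rfl fun S _ => ?_
    rw [← hΨe S w hw, ← mul_assoc, ← pow_add, Nat.sub_add_cancel (hk S)]
  · simp only
    have h0 : Ψ Finset.univ 0 = Real.pi ^ 2 * EE (1/3, 1/3, 1/3) := by
      have hl := IsLim_univ hη (GB_good (Finset.univ)ᶜ)
      have hc : Tendsto (fun w : ℝ => Ψ Finset.univ (w:ℂ)) (𝓝[>] 0) (𝓝 (Ψ Finset.univ 0)) := by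
        have hop : IsOpen {w : ℂ | -(eps/10) < w.re} := isOpen_lt continuous_const Complex.continuous_re
        have hm : (0:ℂ) ∈ {w : ℂ | -(eps/10) < w.re} := by
          simp only [Set.mem_setOf_eq, Complex.zero_re]; linarith
        have := ((hΨ Finset.univ).differentiableAt (hop.mem_nhds hm)).continuousAt
        have h2 : Tendsto (fun w : ℝ => (w:ℂ)) (𝓝[>] 0) (𝓝 0) := by
          have := (Complex.continuous_ofReal.tendsto 0).mono_left (nhdsWithin_le_nhds (s := Set.Ioi (0:ℝ)))
          simpa using this
        exact this.tendsto.comp h2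
      have he : (fun w : ℝ => (w:ℂ)^7 * Jint (GB (Finset.univ)ᶜ) Finset.univ w 0 0) =ᶠ[𝓝[>] 0] (fun w : ℝ => Ψ Finset.univ (w:ℂ)) := by
        filter_upwards [self_mem_nhdsWithin] with w hw
        have := hΨe Finset.univ (w:ℂ) (by simpa using hw)
        rw [kap_univ] at this
        exact this
      have := tendsto_nhds_unique hc (hl.congr' he)
      rw [this, GB_zero]
      ring
    rw [Finset.sum_eq_single Finset.univ]
    · rw [kap_univ, h0]
      simp only [Nat.sub_self, pow_zero, one_mul]
      field_simp
    · intro S _ hS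
      have := kap_lt S hS
      rw [zero_pow (by omega), zero_mul]
    · intro h; exact absurd (Finset.mem_univ _) h

end CT

theorem cubicTorus_height_zeta :
    (∀ s : ℂ, 1 < s.re →
      Summable (fun q : ℚˣ × ℚˣ => ‖(cubicTorusHeight (q.1 : ℚ) (q.2 : ℚ) : ℂ) ^ (-s)‖)) ∧
    ∃ ε : ℝ, 0 < ε ∧
      ∃ f : ℂ → ℂ,
        DifferentiableOn ℂ f {s : ℂ | 1 - ε < s.re} ∧
        ∀ s : ℂ, 1 < s.re →
          cubicTorusZeta s =
            ((∏' p : Nat.Primes, cubicTorusEulerFactor p : ℝ) : ℂ) / (s - 1) ^ 7 +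
              f s / (s - 1) ^ 6 := by
  refine ⟨fun s hs => (CT.Z_main hs).1, CT.eps / 10, by norm_num [CT.eps], ?_⟩
  obtain ⟨Φ, hd, he, h0⟩ := CT.main_cont
  rw [CT.EE_third] at h0
  refine ⟨fun s => dslope Φ 0 (s - 1), ?_, ?_⟩
  · have hop : IsOpen {w : ℂ | -(CT.eps/10) < w.re} := isOpen_lt continuous_const Complex.continuous_re
    have hm : {w : ℂ | -(CT.eps/10) < w.re} ∈ 𝓝 (0:ℂ) := by
      refine hop.mem_nhds ?_
      simp only [Set.mem_setOf_eq, Complex.zero_re]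
      norm_num [CT.eps]
    have h2 := (Complex.differentiableOn_dslope hm).2 hd
    refine h2.comp (differentiableOn_id.sub_const 1) ?_
    intro s hs
    simp only [Set.mem_setOf_eq, Complex.sub_re, Complex.one_re, id] at hs ⊢
    linarith
  · intro s hs
    have hw : 0 < (s - 1).re := by simpa using hs
    have hne : s - 1 ≠ 0 := by
      intro h; rw [h] at hw; simp at hw
    have h1 := he (s - 1) hw
    rw [← (CT.Z_main hs).2] at h1
    simp only
    rw [dslope_of_ne _ hne, slope_def_field, ← h1, h0]
    field_simp
    ring
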